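/- Fix an integer d ≥ 2 and let c_n denote the number of congruence subgroups of SL_d(ℤ) of index at most n. Then the liminf as n → ∞ of (log c_n) / ((log n)^2 / log log n) is at least (√(d(d+2)) − d)^2 / (4d^2). -/

import Mathlib

open Filter

/-- `H` is a congruence subgroup of `SL_d(ℤ)`: it contains the kernel of the
reduction homomorphism `SL_d(ℤ) → SL_d(ℤ/mℤ)` for some integer `m ≥ 1`. -/
def IsCongruenceSubgroup {d : ℕ} (H : Subgroup (Matrix.SpecialLinearGroup (Fin d) ℤ)) : Prop :=
  ∃ m : ℕ, 1 ≤ m ∧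
    (Matrix.SpecialLinearGroup.map (n := Fin d) (Int.castRingHom (ZMod m))).ker ≤ H

/-- The number of congruence subgroups of `SL_d(ℤ)` of index at most `n`. -/
noncomputable def congCount (d n : ℕ) : ℕ :=
  Nat.card {H : Subgroup (Matrix.SpecialLinearGroup (Fin d) ℤ) //
    IsCongruenceSubgroup H ∧ H.index ≤ n}


namespace CG

/-- `H` can be generated by at most `r` elements. -/
def GenLE {G : Type*} [Group G] (H : Subgroup G) (r : ℕ) : Prop :=
  ∃ S : Finset G, S.card ≤ r ∧ Subgroup.closure (S : Set G) = H

theorem GenLE.mono {G : Type*} [Group G] {H : Subgroup G} {r s : ℕ} (h : GenLE H r)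
    (hrs : r ≤ s) : GenLE H s := by
  obtain ⟨S, h1, h2⟩ := h
  exact ⟨S, h1.trans hrs, h2⟩

theorem GenLE.map {G G' : Type*} [Group G] [Group G'] {H : Subgroup G} {r : ℕ} (h : GenLE H r)
    (f : G →* G') : GenLE (H.map f) r := by
  classical
  obtain ⟨S, h1, h2⟩ := h
  refine ⟨S.image f, Finset.card_image_le.trans h1, ?_⟩
  rw [← h2, MonoidHom.map_closure, Finset.coe_image]

theorem GenLE.sup {G : Type*} [Group G] {H K : Subgroup G} {r s : ℕ} (h : GenLE H r)
    (hk : GenLE K s) : GenLE (H ⊔ K) (r + s) := by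
  classical
  obtain ⟨S, h1, h2⟩ := h
  obtain ⟨T, h3, h4⟩ := hk
  refine ⟨S ∪ T, (Finset.card_union_le _ _).trans (by omega), ?_⟩
  rw [Finset.coe_union, Subgroup.closure_union, h2, h4]

theorem genLE_bot {G : Type*} [Group G] : GenLE (⊥ : Subgroup G) 0 :=
  ⟨∅, by simp, by simp⟩

theorem GenLE.ext {G G' : Type*} [Group G] [Group G'] {H : Subgroup G} {r s : ℕ} (f : G →* G')
    (h : GenLE (H.map f) r) (hk : GenLE (H ⊓ f.ker) s) : GenLE H (r + s) := by
  classical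
  obtain ⟨S, h1, h2⟩ := h
  have hS : ∀ x ∈ S, ∃ y ∈ H, f y = x := by
    intro x hx
    have : x ∈ H.map f := h2 ▸ Subgroup.subset_closure hx
    exact this
  choose! g hg hgf using hS
  have hgen : GenLE (Subgroup.closure (S.image g : Set G)) r :=
    ⟨S.image g, Finset.card_image_le.trans h1, rfl⟩
  have := hgen.sup hk
  convert this using 1
  apply le_antisymm
  · intro x hx
    have hfx : f x ∈ (Subgroup.closure (S.image g : Set G)).map f := by
      rw [MonoidHom.map_closure]
      have : Set.image f (S.image g : Set G) = S := by
        ext y; simp only [Finset.coe_image, Set.mem_image, Finset.mem_coe]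
        constructor
        · rintro ⟨_, ⟨z, hz, rfl⟩, rfl⟩; rw [hgf z hz]; exact hz
        · intro hy; exact ⟨_, ⟨y, hy, rfl⟩, hgf y hy⟩
      rw [this, h2]
      exact ⟨x, hx, rfl⟩
    obtain ⟨y, hy, hyx⟩ := hfx
    have hyH : y ∈ H := by
      have : Subgroup.closure (S.image g : Set G) ≤ H := by
        rw [Subgroup.closure_le]; intro z hz
        simp only [Finset.coe_image, Set.mem_image, Finset.mem_coe] at hz
        obtain ⟨w, hw, rfl⟩ := hz
        exact hg w hw
      exact this hy
    have : x = y * (y⁻¹ * x) := by group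
    rw [this]
    refine mul_mem (Subgroup.mem_sup_left hy) (Subgroup.mem_sup_right
      (Subgroup.mem_inf.mpr ⟨mul_mem (inv_mem hyH) hx, ?_⟩))
    rw [MonoidHom.mem_ker]; simp [hyx]
  · refine sup_le ?_ inf_le_left
    rw [Subgroup.closure_le]; intro z hz
    simp only [Finset.coe_image, Set.mem_image, Finset.mem_coe] at hz
    obtain ⟨w, hw, rfl⟩ := hz
    exact hg w hw

theorem GenLE.of_map_inj {G G' : Type*} [Group G] [Group G'] {H : Subgroup G} {r : ℕ} (f : G →* G')
    (h : GenLE (H.map f) r) (hk : H ⊓ f.ker = ⊥) : GenLE H r := by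
  have := h.ext f (s := 0) (by rw [hk]; exact genLE_bot)
  simpa using this

theorem gen_aux {G : Type*} [Group G] [Finite G] (H : Subgroup G) (r : ℕ) : ∀ K ≤ H,
    (K.relIndex H).primeFactorsList.length ≤ r → ∃ S : Finset G, S.card ≤ r ∧
      K ⊔ Subgroup.closure (S : Set G) = H := by
  classical
  induction r with
  | zero =>
    intro K hK h
    refine ⟨∅, by simp, ?_⟩
    simp only [nonpos_iff_eq_zero, List.length_eq_zero_iff, Nat.primeFactorsList_eq_nil] at h
    rcases h with h | h
    · exact absurd h (Subgroup.index_ne_zero_of_finite)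
    · rw [Subgroup.relIndex_eq_one] at h
      simp [le_antisymm hK h]
  | succ r ih =>
    intro K hK h
    by_cases hKH : H ≤ K
    · exact ⟨∅, by simp, by simp [le_antisymm hK hKH]⟩
    · obtain ⟨x, hx, hxK⟩ := SetLike.not_le_iff_exists.mp hKH
      have hle : K ⊔ Subgroup.zpowers x ≤ H := sup_le hK (by simpa using hx)
      have h1 : K.relIndex (K ⊔ Subgroup.zpowers x) * (K ⊔ Subgroup.zpowers x).relIndex H
          = K.relIndex H := Subgroup.relIndex_mul_relIndex _ _ _ le_sup_left hle
      have h2 : K.relIndex (K ⊔ Subgroup.zpowers x) ≠ 1 := by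
        rw [Ne, Subgroup.relIndex_eq_one]
        intro h
        exact hxK (h (Subgroup.mem_sup_right (Subgroup.mem_zpowers x)))
      have h3 : K.relIndex (K ⊔ Subgroup.zpowers x) ≠ 0 := Subgroup.index_ne_zero_of_finite
      have h4 : (K ⊔ Subgroup.zpowers x).relIndex H ≠ 0 := Subgroup.index_ne_zero_of_finite
      have h5 : (K.relIndex (K ⊔ Subgroup.zpowers x)).primeFactorsList.length ≠ 0 := by
        simp [Nat.primeFactorsList_eq_nil, h2, h3]
      rw [← h1, (Nat.perm_primeFactorsList_mul h3 h4).length_eq, List.length_append] at h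
      obtain ⟨S, hS, hS2⟩ := ih _ hle (by omega)
      refine ⟨insert x S, (Finset.card_insert_le _ _).trans (by omega), ?_⟩
      rw [Finset.coe_insert, Set.insert_eq, Subgroup.closure_union, ← sup_assoc,
        ← Subgroup.zpowers_eq_closure, hS2]

theorem genLE_card {G : Type*} [Group G] [Finite G] (H : Subgroup G) :
    GenLE H (Nat.card H).primeFactorsList.length := by
  obtain ⟨S, h1, h2⟩ := gen_aux H _ ⊥ bot_le le_rfl
  rw [Subgroup.relIndex_bot_left] at h1
  exact ⟨S, h1, by simpa using h2⟩

theorem genLE_pgroup {G : Type*} [Group G] [Finite G] (H : Subgroup G) {p e : ℕ} (hp : p.Prime)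
    (hH : IsPGroup p H) (hc : Nat.card H ≤ p ^ e) : GenLE H e := by
  have := Fact.mk hp
  obtain ⟨k, hk⟩ := IsPGroup.iff_card.mp hH
  refine (genLE_card H).mono ?_
  rw [hk, hp.primeFactorsList_pow, List.length_replicate]
  rw [hk] at hc
  exact (Nat.pow_le_pow_iff_right hp.one_lt).mp hc

theorem genLE_log {G : Type*} [Group G] [Finite G] (H : Subgroup G) {e : ℕ}
    (hc : Nat.card H ≤ 2 ^ e) : GenLE H e := by
  refine (genLE_card H).mono ?_
  have h0 : Nat.card H ≠ 0 := Nat.card_pos.ne'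
  have : 2 ^ (Nat.card H).primeFactorsList.length ≤ (Nat.card H).primeFactorsList.prod := by
    apply List.pow_card_le_prod
    intro x hx
    exact (Nat.prime_of_mem_primeFactorsList hx).two_le
  rw [Nat.prod_primeFactorsList h0] at this
  exact (Nat.pow_le_pow_iff_right (by norm_num)).mp (this.trans hc)

end CG

namespace CG

theorem stable_range {R : Type*} [CommRing R] [Finite R] (x y r : R) (h : r * x + y = 1) :
    ∃ t, IsUnit (x + t * y) := by
  obtain ⟨i, k, hk, hik⟩ : ∃ i k : ℕ, 0 < k ∧ x ^ i * (1 - x ^ k) = 0 := by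
    obtain ⟨i, j, hij, he⟩ := Finite.exists_ne_map_eq_of_infinite (fun n : ℕ => x ^ n)
    replace he : x ^ i = x ^ j := he
    rcases lt_or_gt_of_ne hij with h | h
    · refine ⟨i, j - i, by omega, ?_⟩
      rw [mul_sub, ← pow_add, Nat.add_sub_cancel' h.le, he]; simp
    · refine ⟨j, i - j, by omega, ?_⟩
      rw [mul_sub, ← pow_add, Nat.add_sub_cancel' h.le, he]; simp
  refine ⟨1 - x ^ k, ?_⟩
  by_contra hu
  obtain ⟨m, hm, hmem⟩ := exists_max_ideal_of_mem_nonunits hu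
  have hp := hm.isPrime
  by_cases hx : x ∈ m
  · have hxk : x ^ k ∈ m := Ideal.pow_mem_of_mem m hx k hk
    have h1 : (1 - x ^ k) * y ∈ m := (Ideal.add_mem_iff_right m hx).mp hmem
    have h2 : y ∈ m := by
      have : y = (1 - x ^ k) * y + x ^ k * y := by ring
      rw [this]; exact m.add_mem h1 (m.mul_mem_right _ hxk)
    apply hm.ne_top
    rw [Ideal.eq_top_iff_one, ← h]
    exact m.add_mem (m.mul_mem_left _ hx) h2
  · have h1 : 1 - x ^ k ∈ m := by
      have : x ^ i * (1 - x ^ k) ∈ m := by rw [hik]; exact m.zero_mem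
      rcases hp.mem_or_mem this with h | h
      · exact absurd (hp.mem_of_pow_mem _ h) hx
      · exact h
    exact hx ((Ideal.add_mem_iff_left m (m.mul_mem_right _ h1)).mp hmem)

section elim
open Matrix
variable {d : ℕ} {R : Type*} [CommRing R]

/-- the matrix `A` is the underlying matrix of an element of `P` -/
def InP (P : Subgroup (SpecialLinearGroup (Fin d) R)) (A : Matrix (Fin d) (Fin d) R) : Prop :=
  ∃ g ∈ P, (g : Matrix (Fin d) (Fin d) R) = A

theorem InP.mul {P : Subgroup (SpecialLinearGroup (Fin d) R)} {A B : Matrix (Fin d) (Fin d) R}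
    (hA : InP P A) (hB : InP P B) : InP P (A * B) := by
  obtain ⟨g, hg, rfl⟩ := hA
  obtain ⟨h, hh, rfl⟩ := hB
  exact ⟨g * h, mul_mem hg hh, by simp⟩

theorem InP.one {P : Subgroup (SpecialLinearGroup (Fin d) R)} : InP P 1 :=
  ⟨1, one_mem _, by simp⟩

theorem InP.of_mul_left {P : Subgroup (SpecialLinearGroup (Fin d) R)}
    {A B : Matrix (Fin d) (Fin d) R}
    (hA : InP P A) (hB : InP P (A * B)) : InP P B := by
  obtain ⟨g, hg, rfl⟩ := hA
  obtain ⟨h, hh, hh2⟩ := hB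
  have key : (↑(g⁻¹) : Matrix (Fin d) (Fin d) R) * (g : Matrix (Fin d) (Fin d) R) = 1 :=
    congrArg Subtype.val (inv_mul_cancel g)
  have h3 : (↑(g⁻¹) : Matrix (Fin d) (Fin d) R) * (h : Matrix (Fin d) (Fin d) R) = B := by
    rw [hh2, ← mul_assoc, key, one_mul]
  exact ⟨g⁻¹ * h, mul_mem (inv_mem hg) hh, h3⟩

theorem InP.of_mul_right {P : Subgroup (SpecialLinearGroup (Fin d) R)}
    {A B : Matrix (Fin d) (Fin d) R}
    (hA : InP P A) (hB : InP P (B * A)) : InP P B := by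
  obtain ⟨g, hg, rfl⟩ := hA
  obtain ⟨h, hh, hh2⟩ := hB
  have key : (g : Matrix (Fin d) (Fin d) R) * (↑(g⁻¹) : Matrix (Fin d) (Fin d) R) = 1 :=
    congrArg Subtype.val (mul_inv_cancel g)
  have h3 : (h : Matrix (Fin d) (Fin d) R) * (↑(g⁻¹) : Matrix (Fin d) (Fin d) R) = B := by
    rw [hh2, mul_assoc, key, mul_one]
  exact ⟨h * g⁻¹, mul_mem hh (inv_mem hg), h3⟩

variable {P : Subgroup (SpecialLinearGroup (Fin d) R)} {a : R}

theorem rowT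
    (hP : ∀ i j : Fin d, i ≠ j → ∀ r : R, InP P (1 + single i j (a * r)))
    (s : Fin d) (v : Fin d → R) (hv : v s = 0) (hva : ∀ j, a ∣ v j) :
    InP P (1 + vecMulVec (Pi.single s 1) v) := by
  have key : ∀ T : Finset (Fin d), InP P (1 + ∑ j ∈ T, single s j (v j)) := by
    intro T
    induction T using Finset.induction_on with
    | empty => simpa using InP.one
    | insert j T hj ih =>
      by_cases hjs : j = s
      · subst hjs
        rw [Finset.sum_insert hj, hv]; simpa using ih
      · obtain ⟨c, hc⟩ := hva j
        have h1 := (hP s j (Ne.symm hjs) c)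
        rw [← hc] at h1
        convert h1.mul ih using 1
        have h0 : single s j (v j) * ∑ i ∈ T, single s i (v i) = 0 := by
          rw [Finset.mul_sum]
          exact Finset.sum_eq_zero (fun i _ => single_mul_single_of_ne _ _ _ _ hjs _)
        rw [Finset.sum_insert hj, add_mul, mul_add, one_mul, mul_add, h0]
        simp; abel
  convert key Finset.univ using 2
  ext i j
  simp only [vecMulVec_apply, Matrix.sum_apply, single_apply, Pi.single_apply]
  by_cases h : i = s
  · subst h; simp
  · simp [h, Ne.symm h]

theorem colT
    (hP : ∀ i j : Fin d, i ≠ j → ∀ r : R, InP P (1 + single i j (a * r)))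
    (s : Fin d) (v : Fin d → R) (hv : v s = 0) (hva : ∀ j, a ∣ v j) :
    InP P (1 + vecMulVec v (Pi.single s 1)) := by
  have key : ∀ T : Finset (Fin d), InP P (1 + ∑ j ∈ T, single j s (v j)) := by
    intro T
    induction T using Finset.induction_on with
    | empty => simpa using InP.one
    | insert j T hj ih =>
      by_cases hjs : j = s
      · subst hjs
        rw [Finset.sum_insert hj, hv]; simpa using ih
      · obtain ⟨c, hc⟩ := hva j
        have h1 := (hP j s (hjs) c)
        rw [← hc] at h1
        convert ih.mul h1 using 1
        have h0 : (∑ i ∈ T, single i s (v i)) * single j s (v j) = 0 := by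
          rw [Finset.sum_mul]
          exact Finset.sum_eq_zero (fun i _ => single_mul_single_of_ne _ _ _ _ (Ne.symm hjs) _)
        rw [Finset.sum_insert hj, add_mul, mul_add, one_mul, mul_add, h0]
        simp; abel
  convert key Finset.univ using 2
  ext i j
  simp only [vecMulVec_apply, Matrix.sum_apply, single_apply, Pi.single_apply]
  by_cases h : j = s
  · subst h; simp
  · simp [h, Ne.symm h]

theorem diagT
    (hP : ∀ i j : Fin d, i ≠ j → ∀ r : R, InP P (1 + single i j (a * r)))
    (s l : Fin d) (hsl : s ≠ l) (u w t : R) (hu : u = 1 + a ^ 2 * t) (huw : u * w = 1) :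
    InP P (1 + single s s (u - 1) + single l l (w - 1)) := by
  have h := (((hP l s hsl.symm (- t * w)).mul (hP s l hsl 1)).mul (hP l s hsl.symm t)).mul
    (hP s l hsl (- w))
  convert h using 1
  ext i j
  simp only [mul_add, add_mul, one_mul, mul_one, single_mul_single_same,
    single_mul_single_of_ne _ _ _ _ hsl, single_mul_single_of_ne _ _ _ _ hsl.symm,
    Matrix.add_apply, single_apply, add_zero]
  subst hu
  have hsl' := hsl.symm
  by_cases h1 : i = s
  · subst h1
    by_cases h3 : j = i
    · subst h3; simp [hsl']; ring
    · by_cases h4 : j = l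
      · subst h4; simp [hsl, hsl']; linear_combination a * huw
      · simp [hsl, hsl', h3, h4, Ne.symm h3, Ne.symm h4]
  · by_cases h2 : i = l
    · subst h2
      by_cases h3 : j = s
      · subst h3; simp [hsl, hsl']; linear_combination a * t * huw
      · by_cases h4 : j = i
        · subst h4; simp [hsl, hsl']; linear_combination (1 - a ^ 2 * t * w) * huw
        · simp [hsl, hsl', h3, h4, Ne.symm h3, Ne.symm h4]
    · simp [hsl, hsl', h1, h2, Ne.symm h1, Ne.symm h2]

/-- rows and columns with index below `s` are those of the identity -/
def Red (s : ℕ) (A : Matrix (Fin d) (Fin d) R) : Prop :=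
  ∀ i j : Fin d, (i.val < s ∨ j.val < s) → A i j = (1 : Matrix (Fin d) (Fin d) R) i j

theorem red_last {A : Matrix (Fin d) (Fin d) R} (hA : Red (d - 1) A) (hdet : A.det = 1) :
    A = 1 := by
  have hdiag : A = Matrix.diagonal (fun i => A i i) := by
    ext i j
    by_cases hij : i = j
    · subst hij; simp
    · rw [Matrix.diagonal_apply_ne _ hij]
      have : i.val < d - 1 ∨ j.val < d - 1 := by
        have := Fin.val_ne_of_ne hij; omega
      rw [hA i j this, Matrix.one_apply_ne hij]
  ext i j
  by_cases hij : i.val < d - 1 ∨ j.val < d - 1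
  · exact hA i j hij
  · have : i = j := by ext; omega
    subst this
    rw [hdiag, Matrix.det_diagonal, Finset.prod_eq_single i] at hdet
    · rw [hdet]; simp
    · intro b _ hb
      have : b.val < d - 1 := by have := Fin.val_ne_of_ne hb; omega
      rw [hA b b (Or.inl this)]; simp
    · simp

theorem elim_step
    (hP : ∀ i j : Fin d, i ≠ j → ∀ r : R, InP P (1 + single i j (a * r)))
    [Finite R] {s : ℕ} (hs : s + 1 < d) {A : Matrix (Fin d) (Fin d) R}
    (hdet : A.det = 1) (hA : ∀ i j, a ^ 2 ∣ A i j - (1 : Matrix (Fin d) (Fin d) R) i j)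
    (hR : Red s A) : ∃ L M : Matrix (Fin d) (Fin d) R, InP P L ∧ InP P M ∧
      Red (s + 1) (L * A * M) ∧
      ∀ i j, a ^ 2 ∣ (L * A * M) i j - (1 : Matrix (Fin d) (Fin d) R) i j := by
  set k : Fin d := ⟨s, by omega⟩ with hk
  obtain ⟨z, hz⟩ := hA k k
  rw [Matrix.one_apply_eq] at hz
  set B := A.adjugate with hB
  have hBA : ∑ j, B k j * A j k = 1 := by
    have : (B * A) k k = 1 := by rw [hB, Matrix.adjugate_mul, hdet]; simp
    rwa [Matrix.mul_apply] at this
  set Y := ∑ j, (if k < j then B k j else 0) * A j k with hY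
  have hxy : B k k * A k k + Y = 1 := by
    rw [← hBA, hY, ← Finset.add_sum_erase _ _ (Finset.mem_univ k),
      ← Finset.add_sum_erase Finset.univ (fun j => B k j * A j k) (Finset.mem_univ k)]
    simp only [lt_irrefl, if_false, zero_mul, zero_add]
    congr 1
    apply Finset.sum_congr rfl
    intro j hj
    have hjk : j ≠ k := (Finset.mem_erase.mp hj).1
    split_ifs with h
    · rfl
    · have hlt : j < k := lt_of_le_of_ne (not_lt.mp h) hjk
      rw [hR j k (Or.inl (Fin.lt_def.mp hlt)), Matrix.one_apply_ne hjk]; simp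
  obtain ⟨t, ht⟩ := stable_range (A k k) (-(a ^ 2 * z * Y)) (1 - a ^ 2 * z * B k k)
    (by linear_combination hz + (- a ^ 2 * z) * hxy)
  obtain ⟨w, hw⟩ := ht.exists_right_inv
  set u := A k k + t * (-(a ^ 2 * z * Y)) with hu
  set v : Fin d → R := fun j => if k < j then a ^ 2 * (-(t * z * B k j)) else 0 with hv
  set A1 := (1 + vecMulVec (Pi.single k 1) v) * A with hA1
  have hdv : ∀ x : R, a ^ 2 ∣ x → a ∣ x := fun x hx => (dvd_pow_self a two_ne_zero).trans hx
  have hva2 : ∀ j, a ^ 2 ∣ v j := by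
    intro j; simp only [hv]; split_ifs
    · exact dvd_mul_right _ _
    · exact dvd_zero _
  have hL1 : InP P (1 + vecMulVec (Pi.single k 1) v) :=
    rowT hP k v (by simp [hv]) (fun j => hdv _ (hva2 j))
  have A1_apply : ∀ i j, A1 i j = A i j + (if i = k then ∑ l, v l * A l j else 0) := by
    intro i j
    simp only [hA1, add_mul, one_mul, Matrix.add_apply, Matrix.mul_apply, vecMulVec_apply,
      Pi.single_apply]
    split_ifs <;> simp
  have hA1k : A1 k k = u := by
    rw [A1_apply, if_pos rfl, hu, hY, Finset.mul_sum, ← Finset.sum_neg_distrib, Finset.mul_sum]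
    congr 1
    apply Finset.sum_congr rfl
    intro j _
    simp only [hv]
    split_ifs <;> ring
  have hA1d : ∀ i j, a ^ 2 ∣ A1 i j - (1 : Matrix (Fin d) (Fin d) R) i j := by
    intro i j
    rw [A1_apply, add_sub_right_comm]
    refine dvd_add (hA i j) ?_
    split_ifs
    · exact Finset.dvd_sum fun l _ => (hva2 l).mul_right _
    · exact dvd_zero _
  have hA1R : Red s A1 := by
    intro i j hij
    rw [A1_apply, hR i j hij]
    split_ifs with h
    · subst h
      have hj : j.val < s := by simpa [hk] using hij
      rw [Finset.sum_eq_zero, add_zero]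
      intro l _
      rw [hR l j (Or.inr hj)]
      by_cases hlj : l = j
      · subst hlj
        have : ¬ k < l := by rw [Fin.lt_def]; simp [hk]; omega
        simp [hv, this]
      · simp [Matrix.one_apply_ne hlj]
    · simp
  set w1 : Fin d → R := fun j => if k < j then -(A1 j k * w) else 0 with hw1
  have hw1a : ∀ j, a ^ 2 ∣ w1 j := by
    intro j; simp only [hw1]; split_ifs with h
    · have := hA1d j k
      rw [Matrix.one_apply_ne (ne_of_gt h), sub_zero] at this
      exact (this.mul_right _).neg_right
    · exact dvd_zero _
  have hL2 : InP P (1 + vecMulVec w1 (Pi.single k 1)) :=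
    colT hP k w1 (by simp [hw1]) (fun j => hdv _ (hw1a j))
  set A2 := (1 + vecMulVec w1 (Pi.single k 1)) * A1 with hA2
  have A2_apply : ∀ i j, A2 i j = A1 i j + w1 i * A1 k j := by
    intro i j
    simp only [hA2, add_mul, one_mul, Matrix.add_apply, Matrix.mul_apply, vecMulVec_apply,
      Pi.single_apply]
    simp
  have hw1k : w1 k = 0 := by simp [hw1]
  have hA2k : A2 k k = u := by rw [A2_apply, hw1k, hA1k]; ring
  have hA2c : ∀ i, k < i → A2 i k = 0 := by
    intro i hi
    rw [A2_apply, hA1k]; simp only [hw1, if_pos hi]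
    linear_combination (- A1 i k) * hw
  have hA2R : Red s A2 := by
    intro i j hij
    rw [A2_apply, hA1R i j hij]
    rcases hij with h | h
    · have : ¬ k < i := by rw [Fin.lt_def]; simp [hk]; omega
      simp [hw1, this]
    · have hne : k ≠ j := by
        intro h'; rw [← h'] at h; simp [hk] at h
      rw [hA1R k j (Or.inr h), Matrix.one_apply_ne hne]; simp
  have hA2d : ∀ i j, a ^ 2 ∣ A2 i j - (1 : Matrix (Fin d) (Fin d) R) i j := by
    intro i j
    rw [A2_apply, add_sub_right_comm]
    exact dvd_add (hA1d i j) ((hw1a i).mul_right _)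
  set z1 : Fin d → R := fun j => if k < j then -(A2 k j * w) else 0 with hz1
  have hz1a : ∀ j, a ^ 2 ∣ z1 j := by
    intro j; simp only [hz1]; split_ifs with h
    · have := hA2d k j
      rw [Matrix.one_apply_ne (ne_of_lt h), sub_zero] at this
      exact (this.mul_right _).neg_right
    · exact dvd_zero _
  have hM1 : InP P (1 + vecMulVec (Pi.single k 1) z1) :=
    rowT hP k z1 (by simp [hz1]) (fun j => hdv _ (hz1a j))
  set A3 := A2 * (1 + vecMulVec (Pi.single k 1) z1) with hA3
  have A3_apply : ∀ i j, A3 i j = A2 i j + A2 i k * z1 j := by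
    intro i j
    simp only [hA3, mul_add, mul_one, Matrix.add_apply, Matrix.mul_apply, vecMulVec_apply,
      Pi.single_apply]
    simp
  have hz1k : z1 k = 0 := by simp [hz1]
  have hA3k : A3 k k = u := by rw [A3_apply, hz1k, hA2k]; ring
  have hA3d : ∀ i j, a ^ 2 ∣ A3 i j - (1 : Matrix (Fin d) (Fin d) R) i j := by
    intro i j
    rw [A3_apply, add_sub_right_comm]
    exact dvd_add (hA2d i j) ((hz1a j).mul_left _)
  have hA3R : Red s A3 := by
    intro i j hij
    rw [A3_apply, hA2R i j hij]
    rcases hij with h | h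
    · have hne : i ≠ k := by
        intro h'; rw [h'] at h; simp [hk] at h
      rw [hA2R i k (Or.inl h), Matrix.one_apply_ne hne]; simp
    · have : ¬ k < j := by rw [Fin.lt_def]; simp [hk]; omega
      simp [hz1, this]
  have hA3c : ∀ i, i ≠ k → A3 i k = 0 := by
    intro i hi
    rcases lt_or_gt_of_ne hi with h | h
    · rw [hA3R i k (Or.inl (Fin.lt_def.mp h)), Matrix.one_apply_ne hi]
    · rw [A3_apply, hA2c i h, hz1k]; ring
  have hA3r : ∀ j, j ≠ k → A3 k j = 0 := by
    intro j hj
    rcases lt_or_gt_of_ne hj with h | h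
    · rw [hA3R k j (Or.inr (Fin.lt_def.mp h)), Matrix.one_apply_ne hj.symm]
    · rw [A3_apply, hA2k]; simp only [hz1, if_pos h]
      linear_combination (- A2 k j) * hw
  obtain ⟨t', ht'⟩ := hA3d k k
  rw [hA3k, Matrix.one_apply_eq] at ht'
  set l : Fin d := ⟨d - 1, by omega⟩ with hl
  have hkl : k ≠ l := by rw [Ne, Fin.ext_iff]; simp [hk, hl]; omega
  have hD := diagT hP k l hkl w u (-(t' * w)) (by linear_combination hw - w * ht')
    (by linear_combination hw)
  set D := 1 + single k k (w - 1) + single l l (u - 1) with hDdef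
  refine ⟨(1 + vecMulVec w1 (Pi.single k 1)) * (1 + vecMulVec (Pi.single k 1) v),
    (1 + vecMulVec (Pi.single k 1) z1) * D, hL2.mul hL1, hM1.mul hD, ?_⟩
  have heq : (1 + vecMulVec w1 (Pi.single k 1)) * (1 + vecMulVec (Pi.single k 1) v) * A *
      ((1 + vecMulVec (Pi.single k 1) z1) * D) = A3 * D := by
    rw [hA3, hA2, hA1]; simp only [mul_assoc]
  rw [heq]
  have hDdiag : D = Matrix.diagonal (fun j => if j = k then w else if j = l then u else 1) := by
    ext i j
    simp only [hDdef, Matrix.add_apply, single_apply, Matrix.diagonal_apply, Matrix.one_apply]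
    by_cases hij : i = j
    · subst hij
      by_cases h1 : i = k
      · subst h1; simp [hkl, hkl.symm]
      · by_cases h2 : i = l
        · subst h2; simp [hkl, hkl.symm]
        · simp [h1, h2, Ne.symm h1, Ne.symm h2]
    · have h1 : ¬ (k = i ∧ k = j) := fun h => hij (h.1.symm.trans h.2)
      have h2 : ¬ (l = i ∧ l = j) := fun h => hij (h.1.symm.trans h.2)
      simp [hij, h1, h2]
  have hAD : ∀ i j, (A3 * D) i j = A3 i j * (if j = k then w else if j = l then u else 1) := by
    intro i j; rw [hDdiag, Matrix.mul_diagonal]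
  constructor
  · intro i j hij
    rw [hAD]
    by_cases hj : j = k
    · rw [hj]
      by_cases hi : i = k
      · rw [hi]; simp [hA3k, hw]
      · rw [hA3c i hi, Matrix.one_apply_ne hi]; simp
    · by_cases hi : i = k
      · rw [hi]
        rw [hA3r j hj, Matrix.one_apply_ne (Ne.symm hj)]; simp
      · have hij' : i.val < s ∨ j.val < s := by
          have h1 := Fin.val_ne_of_ne hi
          have h2 := Fin.val_ne_of_ne hj
          simp only [hk] at h1 h2
          omega
        rw [hA3R i j hij', if_neg hj]
        split_ifs with h
        · have : i ≠ j := by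
            rintro rfl
            rw [h] at hij'; simp [hl] at hij'; omega
          rw [Matrix.one_apply_ne this]; simp
        · simp
  · intro i j
    rw [hAD]
    have h1 : a ^ 2 ∣ (if j = k then w else if j = l then u else 1) - 1 := by
      split_ifs
      · exact ⟨-(t' * w), by linear_combination hw - w * ht'⟩
      · exact ⟨t', ht'⟩
      · simp
    have := dvd_add ((hA3d i j).mul_right (if j = k then w else if j = l then u else 1))
      (h1.mul_left ((1 : Matrix (Fin d) (Fin d) R) i j))
    convert this using 1
    ring

theorem elim
    (hP : ∀ i j : Fin d, i ≠ j → ∀ r : R, InP P (1 + single i j (a * r)))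
    [Finite R] (n : ℕ) : ∀ s, d ≤ s + n + 1 → ∀ A : Matrix (Fin d) (Fin d) R,
    A.det = 1 → (∀ i j, a ^ 2 ∣ A i j - (1 : Matrix (Fin d) (Fin d) R) i j) →
    Red s A → InP P A := by
  induction n with
  | zero =>
    intro s hs A hdet hA hR
    have : A = 1 := red_last (fun i j hij => hR i j (by omega)) hdet
    rw [this]; exact InP.one
  | succ n ih =>
    intro s hs A hdet hA hR
    by_cases h : s + 1 < d
    · obtain ⟨L, M, hL, hM, hLM, hLM2⟩ := elim_step hP h hdet hA hR
      have hLd : L.det = 1 := by obtain ⟨g, _, rfl⟩ := hL; exact g.2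
      have hMd : M.det = 1 := by obtain ⟨g, _, rfl⟩ := hM; exact g.2
      have := ih (s + 1) (by omega) (L * A * M) (by simp [hLd, hMd, hdet]) hLM2 hLM
      exact hL.of_mul_left (hM.of_mul_right this)
    · have : A = 1 := red_last (fun i j hij => hR i j (by omega)) hdet
      rw [this]; exact InP.one

end elim
end CG

namespace CG
open Matrix

abbrev rd (d m : ℕ) : Matrix.SpecialLinearGroup (Fin d) ℤ →* Matrix.SpecialLinearGroup (Fin d) (ZMod m) :=
  Matrix.SpecialLinearGroup.map (n := Fin d) (Int.castRingHom (ZMod m))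

theorem rd_apply {d m : ℕ} (g : Matrix.SpecialLinearGroup (Fin d) ℤ) (i j : Fin d) :
    (rd d m g : Matrix (Fin d) (Fin d) (ZMod m)) i j = ((g i j : ℤ) : ZMod m) := by
  rfl

theorem mem_rd_ker {d m : ℕ} (g : Matrix.SpecialLinearGroup (Fin d) ℤ) :
    g ∈ (rd d m).ker ↔ ∀ i j, (m : ℤ) ∣ g i j - (1 : Matrix (Fin d) (Fin d) ℤ) i j := by
  rw [MonoidHom.mem_ker]
  refine (Matrix.SpecialLinearGroup.ext_iff _ _).trans ?_
  refine forall_congr' fun i => forall_congr' fun j => ?_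
  rw [rd_apply, ← ZMod.intCast_zmod_eq_zero_iff_dvd]
  push_cast
  rw [sub_eq_zero, Matrix.SpecialLinearGroup.coe_one]
  by_cases h : i = j
  · subst h; simp
  · simp [Matrix.one_apply_ne h]

theorem index_ne_zero_of_cong {d : ℕ} {H : Subgroup (Matrix.SpecialLinearGroup (Fin d) ℤ)}
    (hc : IsCongruenceSubgroup H) : H.index ≠ 0 := by
  obtain ⟨m, hm, hle⟩ := hc
  have : NeZero m := ⟨by omega⟩
  have : (rd d m).ker.index ≠ 0 := by
    rw [Subgroup.index_ker]
    exact Nat.card_pos.ne'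
  intro h
  exact this (Nat.eq_zero_of_zero_dvd (h ▸ Subgroup.index_dvd_of_le hle))

theorem tv_zpow {d : ℕ} {i j : Fin d} (hij : i ≠ j) (c : ℤ) (k : ℤ) :
    (Matrix.SpecialLinearGroup.transvection hij c) ^ k = Matrix.SpecialLinearGroup.transvection hij (k * c) := by
  let f : Multiplicative ℤ →* Matrix.SpecialLinearGroup (Fin d) ℤ := 
    { toFun := fun c => Matrix.SpecialLinearGroup.transvection hij c.toAdd
      map_one' := Matrix.SpecialLinearGroup.transvection_coeff_zero hij
      map_mul' := fun a b => by
        ext i' j'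
        simp [Matrix.SpecialLinearGroup.transvection_coe, add_mul, mul_add, single_mul_single_of_ne _ _ _ _ hij.symm,
          single_add]
        try ring }
  have := map_zpow f (Multiplicative.ofAdd c) k
  simp only [f, MonoidHom.coe_mk, OneHom.coe_mk] at this
  simpa using this.symm

theorem level {d n : ℕ} {H : Subgroup (Matrix.SpecialLinearGroup (Fin d) ℤ)}
    (hc : IsCongruenceSubgroup H) (hn : H.index ≤ n) :
    ∃ m : ℕ, 1 ≤ m ∧ m ≤ n ^ (2 * d ^ 2) ∧ (rd d m).ker ≤ H := by
  have hidx := index_ne_zero_of_cong hc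
  obtain ⟨M, hM, hMH⟩ := hc
  have : NeZero M := ⟨by omega⟩
  have h1 : ∀ i j : Fin d, ∃ e : ℕ, 0 < e ∧ e ≤ n ∧ ∀ hij : i ≠ j,
      Matrix.SpecialLinearGroup.transvection hij (e : ℤ) ∈ H := by
    intro i j
    by_cases hij : i = j
    · exact ⟨1, one_pos, by omega, fun h => absurd hij h⟩
    · obtain ⟨e, he, hen, hH⟩ := Subgroup.exists_pow_mem_of_index_ne_zero hidx
        (Matrix.SpecialLinearGroup.transvection hij (1 : ℤ))
      refine ⟨e, he, hen.trans hn, fun _ => ?_⟩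
      rw [← zpow_natCast, tv_zpow] at hH
      simpa using hH
  choose e he hen hH using h1
  set a : ℕ := ∏ i, ∏ j, e i j with ha
  have ha0 : 0 < a := Finset.prod_pos fun i _ => Finset.prod_pos fun j _ => he i j
  have han : a ≤ n ^ (d ^ 2) := by
    calc a ≤ ∏ i : Fin d, ∏ j : Fin d, n :=
          Finset.prod_le_prod' fun i _ => Finset.prod_le_prod' fun j _ => hen i j
      _ = n ^ (d ^ 2) := by simp [← pow_mul, sq]
  refine ⟨a ^ 2, Nat.one_le_pow _ _ ha0, ?_, ?_⟩
  · calc a ^ 2 ≤ (n ^ (d ^ 2)) ^ 2 := Nat.pow_le_pow_left han 2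
      _ = n ^ (2 * d ^ 2) := by rw [← pow_mul]; ring_nf
  intro g hg
  rw [mem_rd_ker] at hg
  set P := H.map (rd d M) with hP
  have hPt : ∀ i j : Fin d, i ≠ j → ∀ r : ZMod M, InP P (1 + single i j ((a : ZMod M) * r)) := by
    intro i j hij r
    obtain ⟨r, rfl⟩ := ZMod.intCast_surjective r
    obtain ⟨c, hcc⟩ : e i j ∣ a :=
      (Finset.dvd_prod_of_mem _ (Finset.mem_univ j)).trans
        (Finset.dvd_prod_of_mem (fun i => ∏ j, e i j) (Finset.mem_univ i))
    have h2 := zpow_mem (hH i j hij) (c * r)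
    rw [tv_zpow] at h2
    refine ⟨rd d M _, Subgroup.mem_map_of_mem _ h2, ?_⟩
    ext i' j'
    rw [rd_apply, Matrix.SpecialLinearGroup.transvection_coe, hcc]
    simp only [Matrix.add_apply, single_apply, Matrix.one_apply]
    push_cast
    split_ifs <;> push_cast <;> ring
  have hin : InP P ((rd d M g : Matrix (Fin d) (Fin d) (ZMod M))) := by
    refine elim hPt d 0 (by omega) _ (rd d M g).2 ?_ ?_
    · intro i j
      obtain ⟨c, hcc⟩ := hg i j
      refine ⟨(c : ZMod M), ?_⟩
      rw [rd_apply]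
      have := congrArg (Int.cast : ℤ → ZMod M) hcc
      push_cast at this
      rw [← this]
      by_cases h : i = j
      · subst h; simp
      · simp [Matrix.one_apply_ne h]
    · intro i j hij; omega
  obtain ⟨g', hg', hgg⟩ := hin
  have hgg' : g' = rd d M g := Subtype.ext hgg
  obtain ⟨h, hh, rfl⟩ := hg'
  have : h⁻¹ * g ∈ H := hMH (by
    rw [MonoidHom.mem_ker, map_mul, map_inv]
    change (rd d M h)⁻¹ * rd d M g = 1
    rw [hgg', inv_mul_cancel])
  simpa using mul_mem hh this

end CG

namespace CG
open Matrix

section padic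
variable {d p k : ℕ}

/-- reduction mod `p` -/
def rp (hk : p ∣ p ^ k) : ZMod (p ^ k) →+* ZMod p := ZMod.castHom hk (ZMod p)

theorem rp_ker (hk : p ∣ p ^ k) (x : ZMod (p ^ k)) (h : rp hk x = 0) :
    ∃ y, x = p * y := by
  obtain ⟨z, rfl⟩ := ZMod.intCast_surjective x
  rw [map_intCast, ZMod.intCast_zmod_eq_zero_iff_dvd] at h
  obtain ⟨c, rfl⟩ := h
  exact ⟨c, by push_cast; ring⟩

theorem one_add_pow_mat (Y : Matrix (Fin d) (Fin d) (ZMod (p ^ k))) (n : ℕ) :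
    ∃ Z, (1 + Y) ^ n = 1 + (n : ZMod (p ^ k)) • Y + Y ^ 2 * Z := by
  induction n with
  | zero => exact ⟨0, by simp⟩
  | succ n ih =>
    obtain ⟨Z, hZ⟩ := ih
    refine ⟨Z + (n : ZMod (p ^ k)) • 1 + Z * Y, ?_⟩
    rw [pow_succ, hZ]
    push_cast
    simp only [add_mul, mul_add, one_mul, mul_one, add_smul, one_smul, smul_mul_assoc,
      mul_smul_comm, sq, mul_assoc]
    abel

/-- the classes mod `p` of `X` with `1 + p^i X` in `K` -/
def WW (hk : p ∣ p ^ k) (hp0 : 0 < p) (i : ℕ)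
    (K : Subgroup (Matrix.SpecialLinearGroup (Fin d) (ZMod (p ^ k)))) :
    AddSubmonoid (Matrix (Fin d) (Fin d) (ZMod p)) where
  carrier := {X | ∃ g ∈ K, ∃ Y : Matrix (Fin d) (Fin d) (ZMod (p ^ k)),
    Y.map (rp hk) = X ∧ (g : Matrix (Fin d) (Fin d) (ZMod (p ^ k))) =
      1 + ((p : ZMod (p ^ k)) ^ (i + 1)) • Y}
  zero_mem' := ⟨1, one_mem _, 0, by ext; simp, by simp⟩
  add_mem' := by
    rintro _ _ ⟨g, hg, Y, rfl, hY⟩ ⟨g', hg', Y', rfl, hY'⟩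
    refine ⟨g * g', mul_mem hg hg', Y + Y' + ((p : ZMod (p ^ k)) ^ (i + 1)) • (Y * Y'), ?_, ?_⟩
    · ext a b
      simp only [Matrix.map_apply, Matrix.add_apply, Matrix.smul_apply, smul_eq_mul, map_add,
        map_mul, map_pow, map_natCast]
      simp
    · rw [Matrix.SpecialLinearGroup.coe_mul, hY, hY']
      simp only [add_mul, mul_add, one_mul, mul_one, smul_add, smul_mul_assoc, mul_smul_comm]
      abel

def WG (hk : p ∣ p ^ k) (hp0 : 0 < p) (i : ℕ)
    (K : Subgroup (Matrix.SpecialLinearGroup (Fin d) (ZMod (p ^ k)))) :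
    Subgroup (Multiplicative (Matrix (Fin d) (Fin d) (ZMod p))) where
  toSubmonoid := AddSubmonoid.toSubmonoid (WW hk hp0 i K)
  inv_mem' := by
    intro x hx
    have h1 : x⁻¹ = x ^ (p - 1) := by
      have h2 : x ^ p = 1 := by
        apply Multiplicative.toAdd.injective
        rw [toAdd_pow, toAdd_one]
        ext a b
        simp
      rw [inv_eq_iff_mul_eq_one, ← pow_succ', Nat.sub_add_cancel hp0, h2]
    rw [h1]
    exact (AddSubmonoid.toSubmonoid (WW hk hp0 i K)).pow_mem hx _

theorem mem_WG {hk : p ∣ p ^ k} {hp0 : 0 < p} {i : ℕ}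
    {K : Subgroup (Matrix.SpecialLinearGroup (Fin d) (ZMod (p ^ k)))}
    {x : Multiplicative (Matrix (Fin d) (Fin d) (ZMod p))} :
    x ∈ WG hk hp0 i K ↔ ∃ g ∈ K, ∃ Y : Matrix (Fin d) (Fin d) (ZMod (p ^ k)),
    Y.map (rp hk) = x.toAdd ∧ (g : Matrix (Fin d) (Fin d) (ZMod (p ^ k))) =
      1 + ((p : ZMod (p ^ k)) ^ (i + 1)) • Y := Iff.rfl

theorem WG_mono {hk : p ∣ p ^ k} {hp0 : 0 < p} {i : ℕ}
    {K L : Subgroup (Matrix.SpecialLinearGroup (Fin d) (ZMod (p ^ k)))} (h : K ≤ L) :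
    WG hk hp0 i K ≤ WG hk hp0 i L := by
  intro x hx
  rw [mem_WG] at hx ⊢
  obtain ⟨g, hg, hY⟩ := hx
  exact ⟨g, h hg, hY⟩

theorem WG_succ {hk : p ∣ p ^ k} {hp0 : 0 < p} {i : ℕ} (hi : 1 ≤ i)
    {K : Subgroup (Matrix.SpecialLinearGroup (Fin d) (ZMod (p ^ k)))} :
    WG hk hp0 i K ≤ WG hk hp0 (i + 1) K := by
  intro x hx
  rw [mem_WG] at hx ⊢
  obtain ⟨g, hg, Y, hY, hgY⟩ := hx
  obtain ⟨Z, hZ⟩ := one_add_pow_mat (((p : ZMod (p ^ k)) ^ (i + 1)) • Y) p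
  refine ⟨g ^ p, pow_mem hg _, Y + ((p : ZMod (p ^ k)) ^ i) • (Y ^ 2 * Z), ?_, ?_⟩
  · rw [← hY]
    ext a b
    have : i ≠ 0 := by omega
    simp only [Matrix.map_apply, Matrix.add_apply, Matrix.smul_apply, smul_eq_mul, map_add,
        map_mul, map_pow, map_natCast]
    simp [this]
  · rw [Matrix.SpecialLinearGroup.coe_pow, hgY, hZ, smul_add, smul_smul, smul_pow, smul_smul,
      add_assoc, smul_mul_assoc]
    congr 3
    · ring
    · ring

theorem plen {a b : ℕ} (ha : a ≠ 0) (hb : b ≠ 0) : (a * b).primeFactorsList.length =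
    a.primeFactorsList.length + b.primeFactorsList.length := by
  rw [(Nat.perm_primeFactorsList_mul ha hb).length_eq, List.length_append]

theorem WG_step [Fact p.Prime] {hk : p ∣ p ^ k} {hp0 : 0 < p} {i : ℕ}
    {N : Subgroup (Matrix.SpecialLinearGroup (Fin d) (ZMod (p ^ k)))}
    (S : Finset (Matrix.SpecialLinearGroup (Fin d) (ZMod (p ^ k)))) (hS : Subgroup.closure S ≤ N)
    (B : Subgroup (Multiplicative (Matrix (Fin d) (Fin d) (ZMod p))))
    (hB : B ≤ WG hk hp0 i (Subgroup.closure S))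
    (hcard : S.card ≤ (Nat.card B).primeFactorsList.length) :
    ∃ S' : Finset (Matrix.SpecialLinearGroup (Fin d) (ZMod (p ^ k))), S ⊆ S' ∧
      Subgroup.closure S' ≤ N ∧ WG hk hp0 i N ≤ WG hk hp0 i (Subgroup.closure S') ∧
      S'.card ≤ (Nat.card (WG hk hp0 i N)).primeFactorsList.length := by
  classical
  have hBN : B ≤ WG hk hp0 i N := hB.trans (WG_mono hS)
  obtain ⟨T, hT1, hT2⟩ := gen_aux (WG hk hp0 i N) _ B hBN le_rfl
  have hT : ∀ x ∈ T, ∃ g ∈ N, ∃ Y : Matrix (Fin d) (Fin d) (ZMod (p ^ k)),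
      Y.map (rp hk) = x.toAdd ∧ (g : Matrix (Fin d) (Fin d) (ZMod (p ^ k))) =
      1 + ((p : ZMod (p ^ k)) ^ (i + 1)) • Y := by
    intro x hx
    rw [← mem_WG (hp0 := hp0), ← hT2]
    exact Subgroup.mem_sup_right (Subgroup.subset_closure hx)
  choose! g hg hY using hT
  refine ⟨S ∪ T.image g, Finset.subset_union_left, ?_, ?_, ?_⟩
  · rw [Subgroup.closure_le] at hS ⊢
    intro x hx
    rw [Finset.mem_coe, Finset.mem_union] at hx
    rcases hx with hx | hx
    · exact hS hx
    · obtain ⟨y, hy, rfl⟩ := Finset.mem_image.mp hx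
      exact hg y hy
  · rw [← hT2, sup_le_iff]
    constructor
    · exact hB.trans (WG_mono (Subgroup.closure_mono (by simp)))
    · rw [Subgroup.closure_le]
      intro x hx
      exact mem_WG.mpr ⟨g x, Subgroup.subset_closure (by
        rw [Finset.mem_coe, Finset.mem_union]
        exact Or.inr (Finset.mem_image_of_mem g hx)), hY x hx⟩
  · have hc : B.relIndex (WG hk hp0 i N) * Nat.card B = Nat.card (WG hk hp0 i N) := by
      rw [← Subgroup.relIndex_bot_left, ← Subgroup.relIndex_bot_left, mul_comm]
      exact Subgroup.relIndex_mul_relIndex _ _ _ bot_le hBN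
    have hr : B.relIndex (WG hk hp0 i N) ≠ 0 := Subgroup.index_ne_zero_of_finite
    rw [← hc, plen hr Nat.card_pos.ne']
    have h1 := Finset.card_union_le S (T.image g)
    have h2 : (T.image g).card ≤ T.card := Finset.card_image_le
    omega

theorem WG_chain [Fact p.Prime] {hk : p ∣ p ^ k} {hp0 : 0 < p}
    {N : Subgroup (Matrix.SpecialLinearGroup (Fin d) (ZMod (p ^ k)))} (n : ℕ) :
    ∃ S : Finset (Matrix.SpecialLinearGroup (Fin d) (ZMod (p ^ k))),
      Subgroup.closure S ≤ N ∧
      (∀ i ≤ n, WG hk hp0 (i + 1) N ≤ WG hk hp0 (i + 1) (Subgroup.closure S)) ∧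
      S.card ≤ (Nat.card (WG hk hp0 (n + 1) N)).primeFactorsList.length := by
  induction n with
  | zero =>
    obtain ⟨S, h1, h2, h3, h4⟩ := WG_step (hk := hk) (hp0 := hp0) (i := 1) (N := N) ∅ (by simp) ⊥
      bot_le (by simp)
    exact ⟨S, h2, fun i hi => by obtain rfl : i = 0 := by omega
                                 exact h3, h4⟩
  | succ n ih =>
    obtain ⟨S, h1, h2, h3⟩ := ih
    obtain ⟨S', h4, h5, h6, h7⟩ := WG_step (hk := hk) (hp0 := hp0) (i := n + 1 + 1) (N := N) S h1
      (WG hk hp0 (n + 1) N) ((h2 n le_rfl).trans (WG_succ (by omega))) h3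
    refine ⟨S', h5, fun i hi => ?_, h7⟩
    rcases Nat.lt_or_ge n i with h | h
    · obtain rfl : i = n + 1 := by omega
      exact h6
    · exact (h2 i h).trans (WG_mono (Subgroup.closure_mono (by exact_mod_cast h4)))

theorem WG_lift {hk : p ∣ p ^ k} {hp0 : 0 < p}
    {N K : Subgroup (Matrix.SpecialLinearGroup (Fin d) (ZMod (p ^ k)))} (hKN : K ≤ N)
    (h : ∀ i < k, WG hk hp0 (i + 1) N ≤ WG hk hp0 (i + 1) K) (j : ℕ) : ∀ i, k ≤ i + j →
    ∀ g ∈ N, (∃ Y : Matrix (Fin d) (Fin d) (ZMod (p ^ k)),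
      (g : Matrix (Fin d) (Fin d) (ZMod (p ^ k))) =
      1 + ((p : ZMod (p ^ k)) ^ (i + 1 + 1)) • Y) → g ∈ K := by
  have hbase : ∀ i, k ≤ i → ∀ g : Matrix.SpecialLinearGroup (Fin d) (ZMod (p ^ k)),
    (∃ Y : Matrix (Fin d) (Fin d) (ZMod (p ^ k)),
      (g : Matrix (Fin d) (Fin d) (ZMod (p ^ k))) =
      1 + ((p : ZMod (p ^ k)) ^ (i + 1 + 1)) • Y) → g ∈ K := by
    rintro i hi g ⟨Y, hY⟩
    have h0 : ((p : ZMod (p ^ k)) ^ (i + 1 + 1)) = 0 := by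
      rw [← Nat.cast_pow, ZMod.natCast_eq_zero_iff]
      exact pow_dvd_pow _ (by omega)
    have : g = 1 := Subtype.ext (by rw [hY, h0]; simp)
    rw [this]; exact one_mem _
  induction j with
  | zero =>
    intro i hi g _ hg
    exact hbase i (by omega) g hg
  | succ j ih =>
    intro i hi g hgN hg
    by_cases hik : k ≤ i
    · exact hbase i hik g hg
    obtain ⟨Y, hY⟩ := hg
    obtain ⟨g', hg', Y', hYY, hY'⟩ := mem_WG.mp (h i (by omega)
      (mem_WG.mpr ⟨g, hgN, Y, (toAdd_ofAdd _).symm, hY⟩))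
    rw [toAdd_ofAdd] at hYY
    have hZ : ∀ a b, ∃ z, Y a b - Y' a b = p * z := fun a b => by
      apply rp_ker hk
      have := congrFun (congrFun hYY a) b
      simp only [Matrix.map_apply] at this
      rw [map_sub, this, sub_self]
    choose Z hZ using hZ
    have hZ' : Y = Y' + (p : ZMod (p ^ k)) • Matrix.of Z := by
      ext a b
      simp [← hZ]
    have key : (↑(g'⁻¹) : Matrix (Fin d) (Fin d) (ZMod (p ^ k))) *
        (g' : Matrix (Fin d) (Fin d) (ZMod (p ^ k))) = 1 :=
      congrArg Subtype.val (inv_mul_cancel g')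
    have h2 : (↑(g'⁻¹) : Matrix (Fin d) (Fin d) (ZMod (p ^ k))) *
        (g : Matrix (Fin d) (Fin d) (ZMod (p ^ k))) = 1 + ((p : ZMod (p ^ k)) ^ (i + 1 + 1 + 1)) •
        ((↑(g'⁻¹) : Matrix (Fin d) (Fin d) (ZMod (p ^ k))) * Matrix.of Z) := by
      rw [← key, ← mul_smul_comm, ← mul_add]
      congr 1
      rw [hY, hZ', hY', smul_add, smul_smul, ← add_assoc, pow_succ _ (i + 1 + 1)]
    have h3 := ih (i + 1) (by omega) (g'⁻¹ * g) (mul_mem (inv_mem (hKN hg')) hgN) ⟨_, h2⟩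
    simpa using mul_mem hg' h3

theorem genLE_K2 [Fact p.Prime] (hk : p ∣ p ^ k) (hp0 : 0 < p)
    (N : Subgroup (Matrix.SpecialLinearGroup (Fin d) (ZMod (p ^ k))))
    (hN : ∀ g ∈ N, ∃ Y : Matrix (Fin d) (Fin d) (ZMod (p ^ k)),
      (g : Matrix (Fin d) (Fin d) (ZMod (p ^ k))) = 1 + ((p : ZMod (p ^ k)) ^ 2) • Y) :
    GenLE N (d ^ 2) := by
  obtain ⟨S, h1, h2, h3⟩ := WG_chain (hk := hk) (hp0 := hp0) (N := N) k
  refine ⟨S, h3.trans ?_, le_antisymm h1 ?_⟩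
  · have hd : Nat.card (WG hk hp0 (k + 1) N) ∣ p ^ (d ^ 2) := by
      have := Subgroup.card_subgroup_dvd_card (WG hk hp0 (k + 1) N)
      have h5 : Nat.card (Multiplicative (Matrix (Fin d) (Fin d) (ZMod p))) = p ^ (d ^ 2) := by
        rw [Nat.card_congr Multiplicative.toAdd]
        simp [Matrix, Nat.card_pi, ← pow_mul, sq]
      rwa [h5] at this
    obtain ⟨e, he, hee⟩ := (Nat.dvd_prime_pow Fact.out).mp hd
    rw [hee, Nat.Prime.primeFactorsList_pow Fact.out]
    simpa using he
  · intro g hg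
    exact WG_lift h1 (fun i hi => h2 i hi.le) k 0 (by omega) g hg (hN g hg)

theorem card_SL_le (d m : ℕ) [NeZero m] :
    Nat.card (Matrix.SpecialLinearGroup (Fin d) (ZMod m)) ≤ m ^ (d ^ 2) := by
  have h := Nat.card_le_card_of_injective
    (fun g : Matrix.SpecialLinearGroup (Fin d) (ZMod m) => (g : Matrix (Fin d) (Fin d) (ZMod m)))
    Subtype.val_injective
  refine h.trans (le_of_eq ?_)
  simp [Matrix, Nat.card_pi, ← pow_mul, sq]

theorem genLE_p (hp : p.Prime) (H : Subgroup (Matrix.SpecialLinearGroup (Fin d) (ZMod (p ^ k))))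
    (hH : IsPGroup p H) : GenLE H (3 * d ^ 2) := by
  have := Fact.mk hp
  have : NeZero (p ^ k) := ⟨pow_ne_zero _ hp.ne_zero⟩
  by_cases hk : k ≤ 2
  · refine (genLE_pgroup (e := 2 * d ^ 2) H hp hH ?_).mono (by omega)
    refine (Subgroup.card_le_card_group H).trans ((card_SL_le d (p ^ k)).trans ?_)
    rw [← pow_mul]
    exact Nat.pow_le_pow_right hp.pos (Nat.mul_le_mul_right _ hk)
  · have hd : p ^ 2 ∣ p ^ k := pow_dvd_pow _ (by omega)
    have : NeZero (p ^ 2) := ⟨pow_ne_zero _ hp.ne_zero⟩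
    let f := Matrix.SpecialLinearGroup.map (n := Fin d) (ZMod.castHom hd (ZMod (p ^ 2)))
    have h1 : GenLE (H.map f) (2 * d ^ 2) := by
      refine genLE_pgroup _ hp (hH.map f) ?_
      refine (Subgroup.card_le_card_group _).trans ((card_SL_le d (p ^ 2)).trans ?_)
      rw [← pow_mul]
    have h2 : GenLE (H ⊓ f.ker) (d ^ 2) := by
      apply genLE_K2 (dvd_pow_self p (by omega)) hp.pos
      rintro g ⟨_, hg⟩
      have hZ : ∀ a b, ∃ z, g a b - (1 : Matrix (Fin d) (Fin d) (ZMod (p ^ k))) a b =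
          (p : ZMod (p ^ k)) ^ 2 * z := by
        intro a b
        have h3 : f g a b = (1 : Matrix.SpecialLinearGroup (Fin d) (ZMod (p ^ 2))) a b := by
          rw [MonoidHom.mem_ker.mp hg]
        have h4 : (ZMod.castHom hd (ZMod (p ^ 2)))
          (g a b - (1 : Matrix (Fin d) (Fin d) (ZMod (p ^ k))) a b) = 0 := by
          rw [map_sub, sub_eq_zero]
          refine Eq.trans h3 ?_
          rw [Matrix.SpecialLinearGroup.coe_one]
          by_cases hab : a = b
          · subst hab; rw [Matrix.one_apply_eq, Matrix.one_apply_eq, map_one]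
          · rw [Matrix.one_apply_ne hab, Matrix.one_apply_ne hab, map_zero]
        obtain ⟨z, hz⟩ := ZMod.intCast_surjective
          (g a b - (1 : Matrix (Fin d) (Fin d) (ZMod (p ^ k))) a b)
        rw [← hz, map_intCast, ZMod.intCast_zmod_eq_zero_iff_dvd] at h4
        obtain ⟨c, rfl⟩ := h4
        exact ⟨c, by rw [← hz]; push_cast; ring⟩
      choose Z hZ using hZ
      refine ⟨Matrix.of Z, ?_⟩
      ext a b
      simp [← hZ]
    exact (h1.ext f h2).mono (by omega)

end padic
end CG

namespace CG

theorem genLE_cyclic {G : Type*} [Group G] (H : Subgroup G) [h : IsCyclic H] : GenLE H 1 := by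
  obtain ⟨g, hg⟩ := (Subgroup.isCyclic_iff_exists_zpowers_eq_top H).mp h
  exact ⟨{g}, by simp, by rw [← hg]; simp [Subgroup.zpowers_eq_closure]⟩

theorem genLE_chars {G ι K : Type*} [Group G] [Finite G] [Field K] (T : Finset ι)
    (χ : ι → G →* Kˣ) : ∀ H : Subgroup G, (∀ g ∈ H, (∀ i ∈ T, χ i g = 1) → g = 1) →
    GenLE H T.card := by
  classical
  induction T using Finset.induction_on with
  | empty =>
    intro H h
    have : H = ⊥ := by rw [Subgroup.eq_bot_iff_forall]; intro g hg; exact h g hg (by simp)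
    rw [this]; exact genLE_bot
  | insert i T hi ih =>
    intro H h
    rw [Finset.card_insert_of_notMem hi, add_comm]
    refine GenLE.ext (χ i) ?_ (ih _ ?_)
    · have : Finite (H.map (χ i)) := Set.Finite.image (χ i) (Set.toFinite (H : Set G))
      exact genLE_cyclic _
    · rintro g ⟨hg, hk⟩ hT
      refine h g hg ?_
      intro j hj
      rcases Finset.mem_insert.mp hj with rfl | hj
      · exact hk
      · exact hT j hj

open scoped commutatorElement in
theorem exists_max_abelian {S : Type*} [Group S] [Finite S] [hn : Group.IsNilpotent S] :
    ∃ A : Subgroup S, A.Normal ∧ A ≤ Subgroup.centralizer A ∧ Subgroup.centralizer A ≤ A := by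
  obtain ⟨A, hA⟩ := Set.Finite.exists_maximal
    (s := {A : Subgroup S | A.Normal ∧ A ≤ Subgroup.centralizer A})
    (Set.toFinite _) ⟨⊥, inferInstance, bot_le⟩
  obtain ⟨⟨hAn, hAc⟩, hmax⟩ := hA
  refine ⟨A, hAn, hAc, ?_⟩
  obtain ⟨n, hn⟩ := hn.nilpotent
  have key : ∀ i, Subgroup.centralizer A ⊓ Subgroup.upperCentralSeries S i ≤ A := by
    intro i
    induction i with
    | zero => simp
    | succ i ih =>
      rintro x ⟨hxC, hxZ⟩
      have hxC : x ∈ Subgroup.centralizer (A : Set S) := hxC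
      have hcom : ∀ s : S, s * x * s⁻¹ ∈ A ⊔ Subgroup.zpowers x := by
        intro s
        have h1 : ⁅x, s⁆ ∈ A := ih ⟨by
          rw [commutatorElement_def, mul_assoc, mul_assoc]
          refine mul_mem hxC ?_
          rw [← mul_assoc]
          exact Subgroup.Normal.conj_mem inferInstance _ (inv_mem hxC) _,
          (Subgroup.mem_upperCentralSeries_succ_iff.mp hxZ s)⟩
        have h2 : s * x * s⁻¹ = ⁅x, s⁆⁻¹ * x := by
          rw [commutatorElement_def]; group
        rw [h2]
        exact mul_mem (Subgroup.mem_sup_left (inv_mem h1))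
          (Subgroup.mem_sup_right (Subgroup.mem_zpowers x))
      have hxA : Subgroup.zpowers x ≤ Subgroup.centralizer A := by
        rw [Subgroup.zpowers_le]; exact hxC
      have hB : A ⊔ Subgroup.zpowers x ∈ {A : Subgroup S | A.Normal ∧ A ≤ Subgroup.centralizer A} := by
        constructor
        · constructor
          intro y hy s
          have : A ⊔ Subgroup.zpowers x ≤ (A ⊔ Subgroup.zpowers x).comap (MulAut.conj s).toMonoidHom := by
            rw [sup_le_iff, Subgroup.zpowers_le]
            constructor
            · intro a ha
              exact Subgroup.mem_sup_left (hAn.conj_mem a ha s)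
            · exact hcom s
          exact this hy
        · rw [sup_le_iff, Subgroup.le_centralizer_iff, Subgroup.le_centralizer_iff
            (H := Subgroup.zpowers x), sup_le_iff, sup_le_iff]
          refine ⟨⟨hAc, hxA⟩, Subgroup.le_centralizer_iff.mp hxA, ?_⟩
          rw [Subgroup.zpowers_le]
          intro y hy
          obtain ⟨k, rfl⟩ := Subgroup.mem_zpowers_iff.mp hy
          exact (Commute.refl x).zpow_left k
      exact hmax hB le_sup_left (Subgroup.mem_sup_right (Subgroup.mem_zpowers x))
  intro x hx
  exact key n ⟨hx, by rw [hn]; trivial⟩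

theorem genLE_rep {S K V : Type*} [Group S] [Finite S] {l : ℕ} [Fact l.Prime] (hS : IsPGroup l S)
    [Field K] [IsAlgClosed K] [AddCommGroup V] [Module K V] [FiniteDimensional K V]
    (ρ : S →* Module.End K V) (hinj : Function.Injective ρ) (hc : (Nat.card S : K) ≠ 0) :
    GenLE (⊤ : Subgroup S) (Module.finrank K V ^ 2 + Module.finrank K V) := by
  classical
  have := hS.isNilpotent
  obtain ⟨A, hAn, hAc, hAm⟩ := exists_max_abelian (S := S)
  have hss : ∀ s : S, (ρ s).IsSemisimple := by
    intro s
    refine Module.End.isSemisimple_of_squarefree_aeval_eq_zero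
      (p := (Polynomial.X ^ (Nat.card S) - 1 : Polynomial K))
      (Polynomial.X_pow_sub_one_separable_iff.mpr hc).squarefree ?_
    rw [map_sub, map_pow, Polynomial.aeval_X, map_one, ← map_pow, pow_card_eq_one', map_one, sub_self]
  have hcomm : ∀ a b : A, Commute (ρ a) (ρ b) := by
    intro a b
    have : (a : S) * b = b * a := hAc b.2 a a.2
    rw [Commute, SemiconjBy, ← map_mul, this, map_mul]
  let E : (A → K) → Submodule K V := fun χ => ⨅ a : A, (ρ a).eigenspace (χ a)
  have hE : ∀ χ : A → K, E χ = ⨅ a : A, (ρ a).maxGenEigenspace (χ a) := by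
    intro χ
    simp only [E]
    congr 1; ext1 a
    rw [(hss a).isFinitelySemisimple.maxGenEigenspace_eq_eigenspace]
  have hEmem : ∀ χ v, v ∈ E χ ↔ ∀ a : A, ρ a v = χ a • v := by
    intro χ v
    simp only [E, Submodule.mem_iInf, Module.End.mem_eigenspace_iff]
  have htop : ⨆ χ, E χ = ⊤ := by
    simp only [hE]
    exact Module.End.iSup_iInf_maxGenEigenspace_eq_top_of_iSup_maxGenEigenspace_eq_top_of_commute
      (fun a : A => ρ a) (fun a b _ => hcomm a b)
      (fun a => Module.End.iSup_maxGenEigenspace_eq_top _)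
  have hind : iSupIndep E := by
    have : E = fun χ => ⨅ a : A, (ρ a).maxGenEigenspace (χ a) := funext hE
    rw [this]
    exact Module.End.independent_iInf_maxGenEigenspace_of_forall_mapsTo (fun a : A => ρ a)
      (fun a b => Module.End.mapsTo_maxGenEigenspace_of_comm (hcomm b a))
  let X := {χ : A → K // E χ ≠ ⊥}
  have : Fintype X := (hind.fintypeNeBotOfFiniteDimensional)
  have hX : Fintype.card X ≤ Module.finrank K V := hind.subtype_ne_bot_le_finrank
  -- elements acting trivially on all eigenspaces
  have hext : ∀ f g : Module.End K V, (∀ χ : X, ∀ v ∈ E χ.1, f v = g v) → f = g := by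
    intro f g h
    have : (⊤ : Submodule K V) ≤ LinearMap.eqLocus f g := by
      rw [← htop, iSup_le_iff]
      intro χ v hv
      by_cases hχ : E χ = ⊥
      · rw [hχ, Submodule.mem_bot] at hv; rw [hv]; simp
      · exact h ⟨χ, hχ⟩ v hv
    ext v
    exact this (Submodule.mem_top : v ∈ ⊤)
  have hρ : ∀ s t : S, ∀ v, ρ s (ρ t v) = ρ (s * t) v := by
    intro s t v; rw [map_mul]; rfl
  have hmove : ∀ (s : S) (χ : A → K), E χ ≠ ⊥ →
      E (fun a => χ (MulAut.conjNormal s⁻¹ a)) ≠ ⊥ := by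
    intro s χ hχ
    obtain ⟨v, hv, hv0⟩ := Submodule.exists_mem_ne_zero_of_ne_bot hχ
    rw [Submodule.ne_bot_iff]
    refine ⟨ρ s v, ?_, ?_⟩
    · rw [hEmem] at hv ⊢
      intro a
      rw [← map_smul, ← hv, hρ, hρ, MulAut.conjNormal_apply]
      congr 2; group
    · intro h0
      apply hv0
      have := hρ s⁻¹ s v
      rw [h0] at this
      simpa using this.symm
  let Φ : S →* Equiv.Perm X :=
    MonoidHom.toHomPerm 
    { toFun := fun s χ => ⟨fun a => χ.1 (MulAut.conjNormal s⁻¹ a), hmove s χ.1 χ.2⟩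
      map_one' := by
        funext χ
        apply Subtype.ext
        funext a
        simp [Function.End.one_def]
      map_mul' := fun s t => by
        funext χ
        apply Subtype.ext
        funext a
        simp only [mul_inv_rev, map_mul]
        rfl }
  have hΦker : Φ.ker ≤ A := by
    intro s hs
    apply hAm
    rw [MonoidHom.mem_ker] at hs
    rw [Subgroup.mem_centralizer_iff]
    intro a ha
    apply hinj
    apply hext
    intro χ v hv
    have h1 : (Φ s χ).1 = χ.1 := by rw [hs]; rfl
    have h2 : ∀ a, χ.1 (MulAut.conjNormal s⁻¹ a) = χ.1 a := fun a => congrFun h1 a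
    rw [hEmem] at hv
    have h3 := h2 (MulAut.conjNormal s ⟨a, ha⟩)
    have h4 : (MulAut.conjNormal s⁻¹ : MulAut A) ((MulAut.conjNormal s : MulAut A) ⟨a, ha⟩) =
      ⟨a, ha⟩ := by
      rw [map_inv]; simp
    rw [h4] at h3
    have h5 := hv ⟨a, ha⟩
    have h6 := hv (MulAut.conjNormal s ⟨a, ha⟩)
    rw [MulAut.conjNormal_apply] at h6
    rw [← h3, ← h5] at h6
    have h7 := congrArg (ρ s⁻¹) h6
    rw [hρ, hρ] at h7
    -- s⁻¹ s a s⁻¹ v = s⁻¹ a v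
    have h8 : ∀ w ∈ E χ.1, ρ s w ∈ E χ.1 := by
      intro w hw
      rw [hEmem] at hw ⊢
      intro b
      rw [hρ, ← h2 b, ← map_smul, ← hw, hρ, MulAut.conjNormal_apply]
      congr 2; simp [mul_assoc]
    have h9 := (hEmem _ _).mp (h8 v ((hEmem _ _).mpr hv)) ⟨a, ha⟩
    rw [← hρ, ← hρ, h9, h5, map_smul]
  have h1 : GenLE ((⊤ : Subgroup S).map Φ) (Module.finrank K V ^ 2) := by
    apply genLE_log
    refine (Subgroup.card_le_card_group _).trans ?_
    rw [Nat.card_eq_fintype_card, Fintype.card_perm]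
    calc (Fintype.card X).factorial ≤ (Module.finrank K V).factorial := Nat.factorial_le hX
      _ ≤ (Module.finrank K V) ^ (Module.finrank K V) := Nat.factorial_le_pow _
      _ ≤ (2 ^ (Module.finrank K V)) ^ (Module.finrank K V) :=
          Nat.pow_le_pow_left Nat.lt_two_pow_self.le _
      _ = _ := by rw [← pow_mul, sq]
  refine h1.ext Φ ?_
  have hlift : ∀ χ : X, ∃ ψ : A →* K, ∀ a, ψ a = χ.1 a := by
    rintro ⟨χ, hχ⟩
    obtain ⟨v, hv, hv0⟩ := Submodule.exists_mem_ne_zero_of_ne_bot hχ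
    rw [hEmem] at hv
    refine ⟨{ toFun := χ, map_one' := ?_, map_mul' := ?_}, fun a => rfl⟩
    · have := hv 1
      simp only [OneMemClass.coe_one, map_one, Module.End.one_apply] at this
      exact smul_left_injective K hv0 (by simpa using this.symm)
    · intro a b
      have := hv (a * b)
      rw [Subgroup.coe_mul, ← hρ, hv b, map_smul, hv a, smul_smul] at this
      exact smul_left_injective K hv0 (by simpa [mul_comm] using this.symm)
  choose ψ hψ using hlift
  have h2 : GenLE (Φ.ker.subgroupOf A) (Module.finrank K V) := by
    refine (genLE_chars (Finset.univ : Finset X) (fun χ => (ψ χ).toHomUnits) _ ?_).mono hX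
    intro a _ ha
    apply Subtype.ext
    apply hinj
    apply hext
    intro χ v hv
    rw [hEmem] at hv
    have := congrArg Units.val (ha χ (Finset.mem_univ _))
    rw [MonoidHom.coe_toHomUnits, hψ] at this
    rw [hv, this]
    simp
  have h3 := h2.map A.subtype
  rw [Subgroup.subgroupOf_map_subtype, inf_eq_left.mpr hΦker] at h3
  simpa using h3

end CG

namespace CG

theorem pow_ker_eq_one {d p k : ℕ} (g : Matrix.SpecialLinearGroup (Fin d) (ZMod (p ^ k)))
    (Y : Matrix (Fin d) (Fin d) (ZMod (p ^ k)))
    (hY : (g : Matrix (Fin d) (Fin d) (ZMod (p ^ k))) = 1 + (p : ZMod (p ^ k)) • Y) :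
    g ^ (p ^ k) = 1 := by
  have key : ∀ j : ℕ, ∃ Y : Matrix (Fin d) (Fin d) (ZMod (p ^ k)),
      ((g ^ (p ^ j) : Matrix.SpecialLinearGroup (Fin d) (ZMod (p ^ k))) :
        Matrix (Fin d) (Fin d) (ZMod (p ^ k))) = 1 + ((p : ZMod (p ^ k)) ^ (j + 1)) • Y := by
    intro j
    induction j with
    | zero => exact ⟨Y, by simpa using hY⟩
    | succ j ih =>
      obtain ⟨Y, hY⟩ := ih
      obtain ⟨Z, hZ⟩ := one_add_pow_mat (((p : ZMod (p ^ k)) ^ (j + 1)) • Y) p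
      refine ⟨Y + ((p : ZMod (p ^ k)) ^ j) • (Y ^ 2 * Z), ?_⟩
      rw [pow_succ, pow_mul, Matrix.SpecialLinearGroup.coe_pow, hY, hZ, smul_add, smul_smul,
        smul_pow, smul_smul, add_assoc, smul_mul_assoc]
      congr 3
      · ring
      · ring
  obtain ⟨Y, hY⟩ := key k
  apply Subtype.ext
  rw [hY]
  have : (p : ZMod (p ^ k)) ^ (k + 1) = 0 := by
    rw [pow_succ, ← Nat.cast_pow]; simp
  rw [this]; simp

theorem genLE_l {d p k l : ℕ} (hp : p.Prime) (hl : l.Prime) (hne : l ≠ p) (hk : k ≠ 0)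
    (H : Subgroup (Matrix.SpecialLinearGroup (Fin d) (ZMod (p ^ k))))
    (hH : IsPGroup l H) : GenLE H (d ^ 2 + d) := by
  have := Fact.mk hp
  have := Fact.mk hl
  have : NeZero (p ^ k) := ⟨pow_ne_zero _ hp.ne_zero⟩
  let K := AlgebraicClosure (ZMod p)
  have hdv : p ∣ p ^ k := dvd_pow_self p hk
  let f := Matrix.SpecialLinearGroup.map (n := Fin d) (ZMod.castHom hdv (ZMod p))
  let f2 := Matrix.SpecialLinearGroup.map (n := Fin d) (algebraMap (ZMod p) K)
  have hf2 : Function.Injective f2 := by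
    intro a b hab
    apply Matrix.SpecialLinearGroup.ext
    intro i j
    have : f2 a i j = f2 b i j := by rw [hab]
    exact (algebraMap (ZMod p) K).injective this
  have hker : ∀ g ∈ H, f g = 1 → g = 1 := by
    intro g hgH hg
    have hZ : ∀ a b, ∃ z, g a b - (1 : Matrix (Fin d) (Fin d) (ZMod (p ^ k))) a b =
        (p : ZMod (p ^ k)) * z := by
      intro a b
      apply rp_ker hdv
      have h3 : f g a b = (1 : Matrix.SpecialLinearGroup (Fin d) (ZMod p)) a b := by rw [hg]
      rw [map_sub, sub_eq_zero]
      refine Eq.trans h3 ?_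
      rw [Matrix.SpecialLinearGroup.coe_one]
      by_cases hab : a = b
      · subst hab; rw [Matrix.one_apply_eq, Matrix.one_apply_eq, map_one]
      · rw [Matrix.one_apply_ne hab, Matrix.one_apply_ne hab, map_zero]
    choose Z hZ using hZ
    have h1 : g ^ (p ^ k) = 1 := pow_ker_eq_one g (Matrix.of Z) (by ext a b; simp [← hZ])
    obtain ⟨e, he⟩ := hH ⟨g, hgH⟩
    have h2 : g ^ (l ^ e) = 1 := congrArg Subtype.val he
    have hco : Nat.Coprime (p ^ k) (l ^ e) :=
      Nat.Coprime.pow _ _ ((Nat.coprime_primes hp hl).mpr hne.symm)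
    have h3 : orderOf g ∣ 1 := by
      rw [← hco.gcd_eq_one]
      exact Nat.dvd_gcd (orderOf_dvd_of_pow_eq_one h1) (orderOf_dvd_of_pow_eq_one h2)
    exact orderOf_eq_one_iff.mp (Nat.dvd_one.mp h3)
  let ρ : H →* Module.End K (Fin d → K) :=
    ((Matrix.toLinAlgEquiv' : Matrix (Fin d) (Fin d) K ≃ₐ[K] _).toMulEquiv.toMonoidHom.comp
      (Matrix.SpecialLinearGroup.coeMonoidHom)).comp ((f2.comp f).comp H.subtype)
  have hρ : Function.Injective ρ := by
    rw [injective_iff_map_eq_one]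
    intro h hh
    apply Subtype.ext
    apply hker _ h.2
    apply hf2
    rw [map_one]
    apply Subtype.ext
    apply (Matrix.toLinAlgEquiv' : Matrix (Fin d) (Fin d) K ≃ₐ[K] _).injective
    refine Eq.trans hh ?_
    symm
    exact map_one _
  obtain ⟨e, he⟩ := IsPGroup.iff_card.mp hH
  have hc : (Nat.card H : K) ≠ 0 := by
    have : CharP K p := inferInstance
    rw [he, Ne, CharP.cast_eq_zero_iff K p]
    intro h
    exact hne ((Nat.prime_dvd_prime_iff_eq hp hl).mp (hp.dvd_of_dvd_pow h)).symm
  have h := genLE_rep hH ρ hρ hc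
  have h2 := h.map H.subtype
  rw [← MonoidHom.range_eq_map, Subgroup.range_subtype] at h2
  simpa using h2

theorem genLE_pp {d p k l : ℕ} (hp : p.Prime) (hl : l.Prime) (hk : k ≠ 0)
    (H : Subgroup (Matrix.SpecialLinearGroup (Fin d) (ZMod (p ^ k))))
    (hH : IsPGroup l H) : GenLE H (4 * d ^ 2) := by
  have hd : d ≤ d ^ 2 := Nat.le_self_pow (by norm_num) d
  by_cases h : l = p
  · subst h
    exact (genLE_p hp H hH).mono (by omega)
  · exact (genLE_l hp hl h hk H hH).mono (by omega)

theorem genLE_sylow {d l : ℕ} (hl : l.Prime) (m : ℕ) : m ≠ 0 →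
    ∀ H : Subgroup (Matrix.SpecialLinearGroup (Fin d) (ZMod m)), IsPGroup l H →
      GenLE H (4 * d ^ 2 * m.primeFactors.card) := by
  induction m using Nat.recOnPosPrimePosCoprime with
  | prime_pow p k hp hk =>
    intro _ H hH
    rw [Nat.primeFactors_prime_pow hk.ne' hp]
    simpa using genLE_pp hp hl hk.ne' H hH
  | zero => intro h; exact absurd rfl h
  | one =>
    intro _ H hH
    have : H = ⊥ := by
      rw [Subgroup.eq_bot_iff_forall]
      intro g _
      apply Matrix.SpecialLinearGroup.ext
      intro i j
      exact Subsingleton.elim _ _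
    rw [this]
    exact genLE_bot.mono (by omega)
  | coprime a b ha hb hab iha ihb =>
    intro _ H hH
    let f := Matrix.SpecialLinearGroup.map (n := Fin d) (ZMod.castHom (dvd_mul_right a b) (ZMod a))
    let g := Matrix.SpecialLinearGroup.map (n := Fin d) (ZMod.castHom (dvd_mul_left b a) (ZMod b))
    have h1 := iha (by omega) (H.map f) (hH.map f)
    have h2 := ihb (by omega) ((H ⊓ f.ker).map g) ((hH.to_le inf_le_left).map g)
    have h3 : GenLE (H ⊓ f.ker) (4 * d ^ 2 * b.primeFactors.card) := by
      refine h2.of_map_inj g ?_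
      rw [Subgroup.eq_bot_iff_forall]
      rintro x ⟨⟨_, hx1⟩, hx2⟩
      have hx1 : f x = 1 := hx1
      have hx2 : g x = 1 := hx2
      apply Matrix.SpecialLinearGroup.ext
      intro i j
      apply (ZMod.chineseRemainder hab).injective
      have e1 : ZMod.castHom (dvd_mul_right a b) (ZMod a) (x i j) =
        ZMod.castHom (dvd_mul_right a b) (ZMod a) ((1 : Matrix.SpecialLinearGroup (Fin d) _) i j) := by
        have h4 : f x i j = f 1 i j := by rw [hx1, map_one]
        exact h4
      have e2 : ZMod.castHom (dvd_mul_left b a) (ZMod b) (x i j) =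
        ZMod.castHom (dvd_mul_left b a) (ZMod b) ((1 : Matrix.SpecialLinearGroup (Fin d) _) i j) := by
        have h4 : g x i j = g 1 i j := by rw [hx2, map_one]
        exact h4
      obtain ⟨y, hy⟩ := ZMod.intCast_surjective (x i j)
      obtain ⟨y', hy'⟩ := ZMod.intCast_surjective 
        ((1 : Matrix.SpecialLinearGroup (Fin d) (ZMod (a * b))) i j)
      rw [← hy, ← hy'] at e1 e2 ⊢
      rw [map_intCast, map_intCast] at e1 e2 ⊢
      ext
      · simpa using e1
      · simpa using e2
    refine (h1.ext f h3).mono (le_of_eq ?_)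
    rw [hab.primeFactors_mul, Finset.card_union_of_disjoint hab.disjoint_primeFactors, mul_add]

end CG

namespace CG

theorem GenLE.exists_fun {G : Type*} [Group G] {H : Subgroup G} {r : ℕ} (h : GenLE H r) :
    ∃ f : Fin r → G, Subgroup.closure (Set.range f) = H := by
  classical
  obtain ⟨S, hS, rfl⟩ := h
  have e : S ↪ Fin r := S.equivFin.toEmbedding.trans (Fin.castLEEmb hS)
  refine ⟨fun i => if h : ∃ s, e s = i then (h.choose : G) else 1, le_antisymm ?_ ?_⟩
  · rw [Subgroup.closure_le]
    rintro _ ⟨i, rfl⟩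
    dsimp only
    split_ifs with h
    · exact Subgroup.subset_closure h.choose.2
    · exact one_mem _
  · apply Subgroup.closure_mono
    intro s hs
    have h : ∃ t, e t = e ⟨s, hs⟩ := ⟨_, rfl⟩
    refine ⟨e ⟨s, hs⟩, ?_⟩
    dsimp only
    rw [dif_pos h]
    have := e.injective h.choose_spec
    rw [this]

open scoped Pointwise in
theorem card_subgroups_le {G : Type*} [Group G] [Finite G] (r : ℕ)
    (hr : ∀ l : ℕ, l.Prime → ∀ H : Subgroup G, IsPGroup l H → GenLE H r) :
    Nat.card (Subgroup G) ≤ Nat.card G ^ ((Nat.card G).primeFactors.card + r) := by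
  classical
  have hG0 : Nat.card G ≠ 0 := Nat.card_pos.ne'
  let I := {l // l ∈ (Nat.card G).primeFactors}
  let T : ∀ l : I, Sylow l.1 G := fun l => Classical.arbitrary _
  let X := ∀ l : I, G × (Fin r → T l)
  let F : X → Subgroup G := fun x =>
    ⨆ l : I, Subgroup.closure (Set.range fun i => (x l).1 * ((x l).2 i : G) * ((x l).1)⁻¹)
  have hF : Function.Surjective F := by
    intro H
    have hex : ∀ l : I, ∃ y : G × (Fin r → T l), ∃ Q : Sylow l.1 H,
        Subgroup.closure (Set.range fun i => y.1 * (y.2 i : G) * y.1⁻¹) =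
          (Q : Subgroup H).map H.subtype := by
      intro l
      have hl : l.1.Prime := Nat.prime_of_mem_primeFactors l.2
      have := Fact.mk hl
      let Q : Sylow l.1 H := Classical.arbitrary _
      have hQ : IsPGroup l.1 ((Q : Subgroup H).map H.subtype) := Q.2.map _
      obtain ⟨P, hP⟩ := hQ.exists_le_sylow
      obtain ⟨g, hg⟩ := MulAction.exists_smul_eq G (T l) P
      obtain ⟨f, hf⟩ := (hr _ hl _ hQ).exists_fun
      have hmem : ∀ i, g⁻¹ * f i * g ∈ T l := by
        intro i
        have h1 : f i ∈ P := hP (by rw [← hf]; exact Subgroup.subset_closure ⟨i, rfl⟩)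
        rw [← hg] at h1
        have h2 : f i ∈ MulAut.conj g • (T l : Subgroup G) := h1
        rw [Subgroup.mem_pointwise_smul_iff_inv_smul_mem] at h2
        have h3 : g⁻¹ * f i * g ∈ (T l : Subgroup G) := by
          simpa [← map_inv, MulAut.conj_apply] using h2
        exact h3
      refine ⟨⟨g, fun i => ⟨_, hmem i⟩⟩, Q, ?_⟩
      rw [← hf]
      congr 2
      funext i
      simp [mul_assoc]
    choose x Q hx using hex
    refine ⟨x, ?_⟩
    have hFx : F x = ⨆ l : I, ((Q l : Subgroup H).map H.subtype) := by
      simp only [F]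
      congr 1
      funext l
      exact hx l
    have hle : F x ≤ H := by
      rw [hFx, iSup_le_iff]
      intro l
      exact Subgroup.map_subtype_le _
    refine Subgroup.eq_of_le_of_card_ge hle (Nat.le_of_dvd Nat.card_pos ?_)
    rw [Nat.dvd_iff_prime_pow_dvd_dvd]
    intro p k hp hk
    rcases Nat.eq_zero_or_pos k with rfl | hk0
    · simp
    have hpG : p ∈ (Nat.card G).primeFactors := by
      rw [Nat.mem_primeFactors]
      exact ⟨hp, ((dvd_pow_self p hk0.ne').trans hk).trans (Subgroup.card_subgroup_dvd_card H), hG0⟩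
    have := Fact.mk hp
    have h1 := (Q ⟨p, hpG⟩).pow_dvd_card_of_pow_dvd_card hk
    have h2 : Nat.card ((Q ⟨p, hpG⟩ : Subgroup H).map H.subtype) = Nat.card (Q ⟨p, hpG⟩) :=
      Subgroup.card_map_of_injective H.subtype_injective
    have h3 : ((Q ⟨p, hpG⟩ : Subgroup H).map H.subtype) ≤ F x := by
      rw [hFx]
      exact le_iSup (fun l : I => ((Q l : Subgroup H).map H.subtype)) ⟨p, hpG⟩
    exact h1.trans (h2 ▸ Subgroup.card_dvd_of_le h3)
  refine (Nat.card_le_card_of_surjective F hF).trans (le_of_eq ?_)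
  have hprod : ∏ l : I, Nat.card (T l) = Nat.card G := by
    have : ∀ l : I, Nat.card (T l) = l.1 ^ (Nat.card G).factorization l.1 := by
      intro l
      have := Fact.mk (Nat.prime_of_mem_primeFactors l.2)
      exact Sylow.card_eq_multiplicity _
    simp only [this]
    rw [Finset.prod_coe_sort (Nat.card G).primeFactors
      (fun l => l ^ (Nat.card G).factorization l)]
    exact Nat.prod_factorization_pow_eq_self hG0
  simp only [X]
  rw [Nat.card_pi]
  simp only [Nat.card_prod, Nat.card_fun, Finset.prod_mul_distrib, Finset.prod_pow]
  rw [Nat.card_fin]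
  have hprod' : (∏ x : I, Nat.card ↥(T x)) = Nat.card G := hprod
  have hc : (∏ _x : I, Nat.card G) = Nat.card G ^ (Nat.card G).primeFactors.card := by
    simp [I]
  rw [hc, pow_add]
  congr 2

theorem card_factorial_le_prod (k : ℕ) : ∀ s : Finset ℕ, (∀ x ∈ s, 0 < x) → s.card = k →
    k.factorial ≤ ∏ x ∈ s, x := by
  induction k with
  | zero => intro s _ h; simp [Finset.card_eq_zero.mp h]
  | succ k ih =>
    intro s hs hk
    have hne : s.Nonempty := by rw [← Finset.card_pos]; omega
    have hm := s.max'_mem hne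
    rw [← Finset.mul_prod_erase s _ hm, Nat.factorial_succ]
    refine Nat.mul_le_mul ?_ (ih _ (fun x hx => hs x (Finset.mem_of_mem_erase hx)) ?_)
    · have : s ⊆ Finset.Icc 1 (s.max' hne) := fun x hx =>
        Finset.mem_Icc.mpr ⟨hs x hx, s.le_max' x hx⟩
      have := Finset.card_le_card this
      simp at this; omega
    · rw [Finset.card_erase_of_mem hm]; omega

theorem omega_factorial_le {N : ℕ} (hN : N ≠ 0) : (N.primeFactors.card).factorial ≤ N :=
  (card_factorial_le_prod _ _ (fun _ hx => Nat.pos_of_mem_primeFactors hx) rfl).trans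
    (Nat.le_of_dvd (Nat.pos_of_ne_zero hN) (Nat.prod_primeFactors_dvd N))

theorem omega_bound {N : ℕ} (hN : N ≠ 0) {L : ℝ} (hNL : Real.log N ≤ L) (hL : 4 ≤ Real.log L)
    (hL0 : 0 < L) :
    (N.primeFactors.card : ℝ) ≤ 4 * L / Real.log L := by
  set k := N.primeFactors.card with hk
  have hlog : 0 < Real.log L := by linarith
  rw [le_div_iff₀ hlog]
  have hf : (k.factorial : ℝ) ≤ N := by exact_mod_cast omega_factorial_le hN
  have hsq : Real.sqrt L ^ 2 = L := Real.sq_sqrt hL0.le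
  have hs0 : 0 < Real.sqrt L := Real.sqrt_pos.mpr hL0
  have hls : Real.log L = 2 * Real.log (Real.sqrt L) := by
    rw [Real.log_sqrt hL0.le]; ring
  by_cases h : (k : ℝ) ≤ Real.sqrt L
  · have h1 : Real.log (Real.sqrt L) ≤ Real.sqrt L := (Real.log_le_sub_one_of_pos hs0).trans (by linarith)
    have : (k : ℝ) * Real.log L ≤ Real.sqrt L * (2 * Real.sqrt L) := by
      apply mul_le_mul h _ hlog.le hs0.le
      rw [hls]; linarith
    nlinarith
  · push Not at h
    have hk0 : (0 : ℝ) < k := hs0.trans h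
    have h1 : Real.log (Real.sqrt L) ≤ Real.log k := Real.log_le_log hs0 h.le
    have h2 : (k : ℝ) ^ k ≤ Real.exp k * N := by
      have := Real.pow_div_factorial_le_exp (k : ℝ) hk0.le k
      rw [div_le_iff₀ (by positivity)] at this
      exact this.trans (mul_le_mul_of_nonneg_left hf (Real.exp_pos _).le)
    have h3 : (k : ℝ) * Real.log k ≤ k + L := by
      have := Real.log_le_log (by positivity) h2
      rw [Real.log_pow, Real.log_mul (Real.exp_pos _).ne' (by exact_mod_cast hN), Real.log_exp] at this
      linarith
    nlinarith

end CG

namespace CG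

abbrev CS (d n : ℕ) := {H : Subgroup (Matrix.SpecialLinearGroup (Fin d) ℤ) //
  IsCongruenceSubgroup H ∧ H.index ≤ n}

abbrev LV (d M : ℕ) := Σ m : Fin M, Subgroup (Matrix.SpecialLinearGroup (Fin d) (ZMod (m.1 + 1)))

theorem exists_inj (d n : ℕ) : ∃ f : CS d n → LV d (n ^ (2 * d ^ 2)), Function.Injective f := by
  have h : ∀ H : CS d n, ∃ m : Fin (n ^ (2 * d ^ 2)), (rd d (m.1 + 1)).ker ≤ H.1 := by
    rintro ⟨H, hc, hn⟩
    obtain ⟨m, h1, h2, h3⟩ := level hc hn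
    obtain ⟨k, rfl⟩ : ∃ k, m = k + 1 := ⟨m - 1, by omega⟩
    exact ⟨⟨k, by omega⟩, h3⟩
  choose m hm using h
  refine ⟨fun H => ⟨m H, H.1.map (rd d ((m H).1 + 1))⟩, ?_⟩
  have key : ∀ (a b : Fin (n ^ (2 * d ^ 2))) (H K : Subgroup (Matrix.SpecialLinearGroup (Fin d) ℤ)),
      (rd d (a.1 + 1)).ker ≤ H → (rd d (b.1 + 1)).ker ≤ K →
      (⟨a, H.map (rd d (a.1 + 1))⟩ : LV d (n ^ (2 * d ^ 2))) = ⟨b, K.map (rd d (b.1 + 1))⟩ →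
      H = K := by
    intro a b H K ha hb hab
    obtain rfl : a = b := congrArg Sigma.fst hab
    have hab' := eq_of_heq (Sigma.mk.inj hab).2
    rw [← Subgroup.comap_map_eq_self ha, hab', Subgroup.comap_map_eq_self hb]
  intro H K hHK
  exact Subtype.ext (key _ _ _ _ (hm H) (hm K) hHK)

instance finite_CS (d n : ℕ) : Finite (CS d n) := by
  obtain ⟨f, hf⟩ := exists_inj d n
  exact Finite.of_injective f hf

theorem log_card_le (d n m : ℕ) (hm : m ≠ 0) (hmn : m ≤ n ^ (2 * d ^ 2)) (hd : 2 ≤ d) (hn : 1 ≤ n)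
    (hL : 4 ≤ Real.log (2 * d ^ 4 * Real.log n)) (hL0 : 0 < 2 * (d : ℝ) ^ 4 * Real.log n) :
    Real.log (Nat.card (Subgroup (Matrix.SpecialLinearGroup (Fin d) (ZMod m)))) ≤
      (2 * d ^ 4 * Real.log n) * ((1 + 4 * d ^ 2) *
        (4 * (2 * d ^ 4 * Real.log n) / Real.log (2 * d ^ 4 * Real.log n))) := by
  haveI : NeZero m := ⟨hm⟩
  set L : ℝ := 2 * d ^ 4 * Real.log n with hLdef
  have hd1 : (1 : ℝ) ≤ d := by exact_mod_cast (by omega : 1 ≤ d)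
  have hln : 0 ≤ Real.log n := Real.log_natCast_nonneg n
  set g := Nat.card (Matrix.SpecialLinearGroup (Fin d) (ZMod m)) with hg
  have hg0 : g ≠ 0 := Nat.card_pos.ne'
  have hlm : Real.log m ≤ 2 * d ^ 2 * Real.log n := by
    have : (m : ℝ) ≤ (n : ℝ) ^ (2 * d ^ 2) := by exact_mod_cast hmn
    calc Real.log m ≤ Real.log ((n : ℝ) ^ (2 * d ^ 2)) :=
          Real.log_le_log (by exact_mod_cast Nat.pos_of_ne_zero hm) this
      _ = _ := by rw [Real.log_pow]; push_cast; ring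
  have hlmL : Real.log m ≤ L := by
    refine hlm.trans ?_
    rw [hLdef]
    gcongr 2 * ?_ * _
    exact pow_le_pow_right₀ hd1 (by norm_num)
  have hlg : Real.log g ≤ L := by
    have h1 : (g : ℝ) ≤ (m : ℝ) ^ (d ^ 2) := by exact_mod_cast card_SL_le d m
    calc Real.log g ≤ Real.log ((m : ℝ) ^ (d ^ 2)) :=
          Real.log_le_log (by exact_mod_cast Nat.pos_of_ne_zero hg0) h1
      _ = d ^ 2 * Real.log m := by rw [Real.log_pow]; push_cast; ring
      _ ≤ d ^ 2 * (2 * d ^ 2 * Real.log n) := by gcongr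
      _ = L := by rw [hLdef]; ring
  have hs := card_subgroups_le (G := Matrix.SpecialLinearGroup (Fin d) (ZMod m))
    (4 * d ^ 2 * m.primeFactors.card) (fun l hl H hH => genLE_sylow hl m hm H hH)
  have h1 := omega_bound hg0 hlg hL hL0
  have h2 := omega_bound hm hlmL hL hL0
  set W := 4 * L / Real.log L
  have hcs : 0 < Nat.card (Subgroup (Matrix.SpecialLinearGroup (Fin d) (ZMod m))) := Nat.card_pos
  have hs' : (Nat.card (Subgroup (Matrix.SpecialLinearGroup (Fin d) (ZMod m))) : ℝ) ≤
      (g : ℝ) ^ (g.primeFactors.card + 4 * d ^ 2 * m.primeFactors.card) := by exact_mod_cast hs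
  calc _ ≤ Real.log ((g : ℝ) ^ (g.primeFactors.card + 4 * d ^ 2 * m.primeFactors.card)) :=
        Real.log_le_log (by exact_mod_cast hcs) hs'
    _ = Real.log g * (g.primeFactors.card + 4 * d ^ 2 * m.primeFactors.card) := by
        rw [Real.log_pow]; push_cast; ring
    _ ≤ L * (W + 4 * d ^ 2 * W) := by
        gcongr
    _ = _ := by ring

theorem upper_bound (d : ℕ) (hd : 2 ≤ d) : ∃ C : ℝ, ∀ᶠ n : ℕ in atTop,
    Real.log (congCount d n) / ((Real.log n) ^ 2 / Real.log (Real.log n)) ≤ C := by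
  have hd1 : (1 : ℝ) ≤ d := by exact_mod_cast (by omega : 1 ≤ d)
  have hd4 : (1 : ℝ) ≤ (d : ℝ) ^ 4 := one_le_pow₀ hd1
  refine ⟨(1 + 4 * (1 + 4 * d ^ 2)) * (2 * d ^ 4) ^ 2, ?_⟩
  have ht : Tendsto (fun n : ℕ => Real.log (Real.log n)) atTop atTop :=
    Real.tendsto_log_atTop.comp (Real.tendsto_log_atTop.comp tendsto_natCast_atTop_atTop)
  have ht1 : Tendsto (fun n : ℕ => Real.log n) atTop atTop :=
    Real.tendsto_log_atTop.comp tendsto_natCast_atTop_atTop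
  filter_upwards [ht.eventually_ge_atTop 4, ht1.eventually_ge_atTop 1, eventually_ge_atTop 1]
    with n h4 h1 hn
  set l := Real.log n
  have hl : l ≤ 2 * d ^ 4 * l := by nlinarith
  have hlL : Real.log l ≤ Real.log (2 * d ^ 4 * l) := Real.log_le_log (by linarith) hl
  set L := 2 * (d : ℝ) ^ 4 * l with hLdef
  have hL0 : 0 < L := by linarith
  have hloglog : 0 < Real.log l := by linarith
  rw [div_le_iff₀ (by positivity)]
  obtain ⟨f, hf⟩ := exists_inj d n
  have hc : congCount d n ≤ ∑ m : Fin (n ^ (2 * d ^ 2)),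
      Nat.card (Subgroup (Matrix.SpecialLinearGroup (Fin d) (ZMod (m.1 + 1)))) := by
    have := Nat.card_le_card_of_injective f hf
    rwa [Nat.card_sigma] at this
  set E := L * ((1 + 4 * d ^ 2) * (4 * L / Real.log L))
  have hc' : (congCount d n : ℝ) ≤ (n : ℝ) ^ (2 * d ^ 2) * Real.exp E := by
    calc (congCount d n : ℝ) ≤ ∑ m : Fin (n ^ (2 * d ^ 2)),
        (Nat.card (Subgroup (Matrix.SpecialLinearGroup (Fin d) (ZMod (m.1 + 1)))) : ℝ) := by
          exact_mod_cast hc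
      _ ≤ ∑ m : Fin (n ^ (2 * d ^ 2)), Real.exp E := by
          refine Finset.sum_le_sum fun m _ => ?_
          rw [← Real.log_le_iff_le_exp (by exact_mod_cast Nat.card_pos)]
          exact log_card_le d n (m.1 + 1) (by omega) m.2 hd hn (h4.trans hlL) hL0
      _ = _ := by simp
  have hlog : Real.log (congCount d n) ≤ L + E := by
    rcases Nat.eq_zero_or_pos (congCount d n) with h0 | h0
    · rw [h0]; simp
      have : 0 < Real.log L := by linarith
      positivity
    calc Real.log (congCount d n) ≤ Real.log ((n : ℝ) ^ (2 * d ^ 2) * Real.exp E) :=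
          Real.log_le_log (by exact_mod_cast h0) hc'
      _ = 2 * d ^ 2 * l + E := by
          rw [Real.log_mul (by positivity) (by positivity), Real.log_pow, Real.log_exp]
          push_cast; rfl
      _ ≤ L + E := by
          rw [hLdef]
          gcongr 2 * ?_ * _ + _
          exact pow_le_pow_right₀ hd1 (by norm_num)
  refine hlog.trans ?_
  have hLL : Real.log L ≤ L := (Real.log_le_sub_one_of_pos hL0).trans (by linarith)
  have hlogL : 0 < Real.log L := by linarith
  have e1 : L ≤ L * (L / Real.log L) := by
    have : 1 ≤ L / Real.log L := by rw [le_div_iff₀ hlogL]; linarith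
    nlinarith
  have e2 : L * (L / Real.log L) ≤ L * (L / Real.log l) := by gcongr
  calc L + E ≤ L * (L / Real.log L) + E := by gcongr
    _ = (1 + 4 * (1 + 4 * d ^ 2)) * (L * (L / Real.log L)) := by simp only [E]; ring
    _ ≤ (1 + 4 * (1 + 4 * d ^ 2)) * (L * (L / Real.log l)) := by gcongr
    _ = _ := by rw [hLdef]; ring

end CG

namespace CG

/-- upper triangular subgroup -/
def Bor (d : ℕ) (F : Type) [Field F] : Subgroup (Matrix.SpecialLinearGroup (Fin d) F) where
  carrier := {g | Matrix.BlockTriangular (g : Matrix (Fin d) (Fin d) F) id}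
  mul_mem' := by
    intro a b ha hb
    exact Matrix.BlockTriangular.mul ha hb
  one_mem' := Matrix.blockTriangular_one
  inv_mem' := by
    intro a ha
    have h : ((a⁻¹ : Matrix.SpecialLinearGroup (Fin d) F) : Matrix (Fin d) (Fin d) F) =
        (a : Matrix (Fin d) (Fin d) F)⁻¹ := by
      refine (Matrix.inv_eq_left_inv ?_).symm
      exact congrArg Subtype.val (inv_mul_cancel a)
    have hdet : IsUnit (a : Matrix (Fin d) (Fin d) F).det := by rw [a.2]; exact isUnit_one
    haveI := (a : Matrix (Fin d) (Fin d) F).invertibleOfIsUnitDet hdet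
    change Matrix.BlockTriangular ((a⁻¹ : Matrix.SpecialLinearGroup (Fin d) F) :
      Matrix (Fin d) (Fin d) F) id
    rw [h]
    exact Matrix.blockTriangular_inv_of_blockTriangular ha

theorem mem_Bor {d : ℕ} {F : Type} [Field F] {g : Matrix.SpecialLinearGroup (Fin d) F} :
    g ∈ Bor d F ↔ Matrix.BlockTriangular (g : Matrix (Fin d) (Fin d) F) id := Iff.rfl

abbrev UpT (d : ℕ) := {x : Fin d × Fin d // x.1 < x.2}

theorem card_UpT (d : ℕ) : 2 * Nat.card (UpT d) + d = d ^ 2 := by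
  classical
  rw [Nat.card_eq_fintype_card, Fintype.card_subtype]
  have h1 := Finset.card_filter_add_card_filter_not (s := (Finset.univ : Finset (Fin d × Fin d)))
    (fun x => x.1 = x.2)
  have h2 : (Finset.univ.filter fun x : Fin d × Fin d => x.1 = x.2).card = d := by
    have : (Finset.univ.filter fun x : Fin d × Fin d => x.1 = x.2) =
        (Finset.univ : Finset (Fin d)).image fun i => (i, i) := by
      ext ⟨a, b⟩; simp
    rw [this, Finset.card_image_of_injective]
    · simp
    · intro a b h; exact (Prod.mk.inj h).1
  have h3 : (Finset.univ.filter fun x : Fin d × Fin d => ¬ x.1 = x.2) =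
      (Finset.univ.filter fun x : Fin d × Fin d => x.1 < x.2) ∪
      (Finset.univ.filter fun x : Fin d × Fin d => x.2 < x.1) := by
    ext ⟨a, b⟩; simp
  have h4 : (Finset.univ.filter fun x : Fin d × Fin d => x.2 < x.1).card =
      (Finset.univ.filter fun x : Fin d × Fin d => x.1 < x.2).card := by
    refine Finset.card_bij (fun x _ => (x.2, x.1)) ?_ ?_ ?_
    · rintro ⟨a, b⟩ h; simpa using h
    · rintro ⟨a, b⟩ _ ⟨a', b'⟩ _ h; simp at h ⊢; tauto
    · rintro ⟨a, b⟩ h; exact ⟨(b, a), by simpa using h, rfl⟩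
  rw [h2, h3, Finset.card_union_of_disjoint, h4] at h1
  · simp only [Finset.card_univ, Fintype.card_prod, Fintype.card_fin] at h1
    rw [sq]; omega
  · rw [Finset.disjoint_filter]
    rintro ⟨a, b⟩ _ h h'
    exact absurd h (not_lt.mpr h'.le)

def utm {d : ℕ} {F : Type} [Field F] (D : Fin d → Fˣ) (U : UpT d → F) : Matrix (Fin d) (Fin d) F :=
  fun i j => if h : i < j then U ⟨(i, j), h⟩ else if i = j then (D i : F) else 0

theorem utm_tri {d : ℕ} {F : Type} [Field F] (D : Fin d → Fˣ) (U : UpT d → F) :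
    (utm D U).BlockTriangular id := by
  intro i j h
  have h' : j < i := h
  simp [utm, h'.not_gt, h'.ne']

theorem utm_det {d : ℕ} {F : Type} [Field F] (D : Fin d → Fˣ) (U : UpT d → F) :
    IsUnit (utm D U).det := by
  rw [Matrix.det_of_upperTriangular (utm_tri D U)]
  have : ∏ i, utm D U i i = ((∏ i, D i : Fˣ) : F) := by
    simp [utm]
  rw [this]
  exact Units.isUnit _

theorem utm_inj {d : ℕ} {F : Type} [Field F] {D D' : Fin d → Fˣ} {U U' : UpT d → F}
    (h : utm D U = utm D' U') : D = D' ∧ U = U' := by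
  constructor
  · funext i
    have := congrFun (congrFun h i) i
    simp only [utm, lt_irrefl, dite_false, if_true] at this
    exact Units.ext this
  · funext ⟨⟨i, j⟩, hij⟩
    have := congrFun (congrFun h i) j
    have hij' : i < j := hij
    simpa [utm, hij'] using this

theorem index_Bor_aux (d : ℕ) (F : Type) [Field F] [Fintype F] [DecidableEq F] :
    (Bor d F).index * (Fintype.card F - 1) ^ d * Fintype.card F ^ Nat.card (UpT d) ≤
      Fintype.card F ^ (d ^ 2) := by
  classical
  let f : (Matrix.SpecialLinearGroup (Fin d) F ⧸ Bor d F) × (Fin d → Fˣ) × (UpT d → F) →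
      Matrix (Fin d) (Fin d) F := fun x =>
    ((Quotient.out x.1 : Matrix.SpecialLinearGroup (Fin d) F) : Matrix (Fin d) (Fin d) F) *
      utm x.2.1 x.2.2
  have hf : Function.Injective f := by
    rintro ⟨c, D, U⟩ ⟨c', D', U'⟩ h
    simp only [f] at h
    set g := (Quotient.out c : Matrix.SpecialLinearGroup (Fin d) F) with hg
    set g' := (Quotient.out c' : Matrix.SpecialLinearGroup (Fin d) F) with hg'
    have hcc : c = c' := by
      rw [← QuotientGroup.out_eq' c, ← QuotientGroup.out_eq' c', QuotientGroup.eq]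
      have : c'.out⁻¹ * c.out ∈ Bor d F := by
        rw [mem_Bor]
        have hdu := utm_det D U
        haveI := (utm D U).invertibleOfIsUnitDet hdu
        have e1 : ((g'⁻¹ * g : Matrix.SpecialLinearGroup (Fin d) F) : Matrix (Fin d) (Fin d) F) =
            utm D' U' * (utm D U)⁻¹ := by
          have e2 : ((g'⁻¹ : Matrix.SpecialLinearGroup (Fin d) F) : Matrix (Fin d) (Fin d) F) *
              (g' : Matrix (Fin d) (Fin d) F) = 1 := congrArg Subtype.val (inv_mul_cancel g')
          have e3 : utm D' U' = ((g'⁻¹ : Matrix.SpecialLinearGroup (Fin d) F) :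
              Matrix (Fin d) (Fin d) F) * ((g : Matrix (Fin d) (Fin d) F) * utm D U) := by
            rw [h, ← mul_assoc, e2, one_mul]
          rw [e3, ← mul_assoc, mul_assoc, Matrix.mul_nonsing_inv _ hdu, mul_one]
          rfl
        change Matrix.BlockTriangular ((g'⁻¹ * g : Matrix.SpecialLinearGroup (Fin d) F) :
          Matrix (Fin d) (Fin d) F) id
        rw [e1]
        exact (utm_tri _ _).mul (Matrix.blockTriangular_inv_of_blockTriangular (utm_tri _ _))
      have h2 := inv_mem this
      simpa using h2
    subst hcc
    have e2 : ((g⁻¹ : Matrix.SpecialLinearGroup (Fin d) F) : Matrix (Fin d) (Fin d) F) *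
              (g : Matrix (Fin d) (Fin d) F) = 1 := congrArg Subtype.val (inv_mul_cancel g)
    have e3 : utm D U = utm D' U' := by
      have := congrArg (fun x => ((g⁻¹ : Matrix.SpecialLinearGroup (Fin d) F) :
        Matrix (Fin d) (Fin d) F) * x) h
      simp only [← mul_assoc] at this
      rwa [e2, one_mul, one_mul] at this
    obtain ⟨rfl, rfl⟩ := utm_inj e3
    rfl
  have := Nat.card_le_card_of_injective f hf
  rw [Nat.card_prod, Nat.card_prod, Nat.card_fun, Nat.card_fun] at this
  have hM : Nat.card (Matrix (Fin d) (Fin d) F) = Fintype.card F ^ (d ^ 2) := by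
    have : Nat.card (Matrix (Fin d) (Fin d) F) = Nat.card (Fin d → Fin d → F) := rfl
    rw [this, Nat.card_fun, Nat.card_fun]
    simp [← pow_mul, sq]
  rw [hM] at this
  simp only [Nat.card_eq_fintype_card (α := Fˣ), Fintype.card_units,
    Nat.card_eq_fintype_card (α := F), Nat.card_eq_fintype_card (α := Fin d), Fintype.card_fin]
    at this
  rw [Subgroup.index, mul_assoc]
  exact this

theorem index_Bor (d p : ℕ) [Fact p.Prime] : (Bor d (ZMod p)).index ≤ 2 ^ d * p ^ Nat.card (UpT d) := by
  have h := index_Bor_aux d (ZMod p)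
  rw [ZMod.card] at h
  have hp := (Fact.out : p.Prime).two_le
  set t := Nat.card (UpT d) with ht
  have hd : d ^ 2 = t + d + t := by have := card_UpT d; omega
  rw [hd, pow_add p (t + d) t] at h
  have h2 := Nat.le_of_mul_le_mul_right h (by positivity)
  have h3 : p ^ d ≤ 2 ^ d * (p - 1) ^ d := by
    rw [← mul_pow]; exact Nat.pow_le_pow_left (by omega) _
  have h4 : (Bor d (ZMod p)).index * (p - 1) ^ d ≤ 2 ^ d * p ^ t * (p - 1) ^ d := by
    calc _ ≤ p ^ (t + d) := h2
      _ = p ^ t * p ^ d := pow_add _ _ _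
      _ ≤ p ^ t * (2 ^ d * (p - 1) ^ d) := Nat.mul_le_mul_left _ h3
      _ = _ := by ring
  exact Nat.le_of_mul_le_mul_right h4 (Nat.pow_pos (by omega))

theorem exists_chi (p q : ℕ) (hp : p.Prime) (hq : q ∣ p - 1) :
    ∃ χ : (ZMod p)ˣ →* Multiplicative (ZMod q), Function.Surjective χ := by
  have := Fact.mk hp
  have hc : Nat.card (ZMod p)ˣ = p - 1 := by
    rw [Nat.card_eq_fintype_card, ZMod.card_units]
  let e := (zmodCyclicMulEquiv (G := (ZMod p)ˣ) inferInstance).symm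
  have hq' : q ∣ Nat.card (ZMod p)ˣ := by rwa [hc]
  refine ⟨(AddMonoidHom.toMultiplicative (ZMod.castHom hq' (ZMod q)).toAddMonoidHom).comp
    e.toMonoidHom, ?_⟩
  have h1 : Function.Surjective (ZMod.castHom hq' (ZMod q)) := ZMod.castHom_surjective hq'
  intro y
  obtain ⟨x, hx⟩ := h1 y.toAdd
  obtain ⟨z, hz⟩ := e.surjective (Multiplicative.ofAdd x)
  refine ⟨z, ?_⟩
  simp only [MonoidHom.comp_apply, MulEquiv.toMonoidHom_eq_coe, MonoidHom.coe_coe]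
  erw [hz]
  exact congrArg Multiplicative.ofAdd hx

/-- an integer matrix with prescribed diagonal entry -/
theorem exists_mat (e : ℕ) (i : Fin e) (a b m f : ℤ) (ha : a ≠ 0) (h : a * f - b * m = 1) :
    ∃ g : Matrix.SpecialLinearGroup (Fin (e + 1)) ℤ,
      g i.castSucc i.castSucc = a ∧ (∀ j : Fin e, j ≠ i → g j.castSucc j.castSucc = 1) ∧
      (∀ r s, s < r → m ∣ g r s) := by
  classical
  set i' := i.castSucc
  set la := Fin.last e
  have hil : i' < la := Fin.castSucc_lt_last i
  let U : Matrix (Fin (e + 1)) (Fin (e + 1)) ℤ := fun r s =>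
    if r = s then (if r = i' then a else 1) else if r = i' ∧ s = la then b else 0
  let v : Fin (e + 1) → ℤ := fun s => if s = i' then m else if s = la then f else 0
  have hUt : U.BlockTriangular id := by
    intro r s hrs
    have hrs' : s < r := hrs
    simp only [U]
    rw [if_neg hrs'.ne', if_neg]
    rintro ⟨rfl, rfl⟩
    exact absurd hrs' (not_lt.mpr hil.le)
  have hUd : U.det = a := by
    rw [Matrix.det_of_upperTriangular hUt]
    simp [U]
  have hrow : U la = a • v + (-m) • U i' := by
    funext s
    simp only [U, v, Pi.add_apply, Pi.smul_apply, smul_eq_mul]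
    by_cases h1 : s = i'
    · subst h1
      simp [hil.ne, hil.ne']; ring
    by_cases h2 : s = la
    · subst h2
      simp [hil.ne, hil.ne']; linarith
    · have h1' : ¬ i' = s := fun h => h1 h.symm
      have h2' : ¬ la = s := fun h => h2 h.symm
      simp [h1, h2, h1', h2', hil.ne']
  have hdet : (U.updateRow la v).det = 1 := by
    have e1 : U.det = (U.updateRow la (a • v + (-m) • U i')).det := by
      rw [← hrow, Matrix.updateRow_eq_self]
    rw [Matrix.det_updateRow_add, Matrix.det_updateRow_smul, Matrix.det_updateRow_smul,
      Matrix.det_updateRow_eq_zero hil.ne, hUd] at e1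
    have : a * ((U.updateRow la v).det - 1) = 0 := by simp at e1; linarith
    rcases mul_eq_zero.mp this with h | h
    · exact absurd h ha
    · linarith
  refine ⟨⟨_, hdet⟩, ?_, ?_, ?_⟩
  · change U.updateRow la v i' i' = a
    rw [Matrix.updateRow_ne hil.ne]; simp [U]
  · intro j hj
    change U.updateRow la v j.castSucc j.castSucc = 1
    rw [Matrix.updateRow_ne (Fin.castSucc_lt_last j).ne]
    have : j.castSucc ≠ i' := fun h => hj (Fin.castSucc_injective _ h)
    simp [U, this]
  · intro r s hrs
    change m ∣ U.updateRow la v r s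
    by_cases hr : r = la
    · subst hr
      rw [Matrix.updateRow_self]
      simp only [v]
      have : s ≠ la := hrs.ne
      rw [if_neg this]
      split_ifs <;> simp
    · rw [Matrix.updateRow_ne hr]
      have := hUt (i := r) (j := s) hrs
      rw [this]; simp

end CG

namespace CG

theorem abs_count {G : Type*} [Group G] (B : Subgroup G) {ι : Type*} [Fintype ι] {q : ℕ} [NeZero q]
    (φ : B →* Multiplicative (ι → ZMod q)) (hφ : Function.Surjective φ) (k l : ℕ)
    (hkl : k + l = Fintype.card ι) (n : ℕ) (hn : B.index * q ^ l ≤ n) :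
    ∃ f : Matrix (Fin l) (Fin k) (ZMod q) → Subgroup G, Function.Injective f ∧
      ∀ T, (φ.ker).map B.subtype ≤ f T ∧ (f T).index ≤ n := by
  classical
  have e : ι ≃ Fin k ⊕ Fin l := Fintype.equivOfCardEq (by simp [hkl])
  let ψ : Matrix (Fin l) (Fin k) (ZMod q) → (ι → ZMod q) →+ (Fin l → ZMod q) := fun T =>
    { toFun := fun v => (fun j => v (e.symm (Sum.inr j))) - T.mulVec (fun i => v (e.symm (Sum.inl i)))
      map_zero' := by
        have : (fun i => (0 : ι → ZMod q) (e.symm (Sum.inl i))) = (0 : Fin k → ZMod q) := rfl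
        rw [this, Matrix.mulVec_zero, sub_zero]; rfl
      map_add' := by
        intro v w
        have : (fun i => (v + w) (e.symm (Sum.inl i))) =
            (fun i => v (e.symm (Sum.inl i))) + (fun i => w (e.symm (Sum.inl i))) := rfl
        rw [this, Matrix.mulVec_add]
        funext j
        simp only [Pi.sub_apply, Pi.add_apply]; ring }
  let Ψ : Matrix (Fin l) (Fin k) (ZMod q) →
    (Multiplicative (ι → ZMod q) →* Multiplicative (Fin l → ZMod q)) :=
    fun T => AddMonoidHom.toMultiplicative (ψ T)
  have hΨ : Function.Injective fun T => (Ψ T).ker := by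
    intro T T' h
    have h' : (Ψ T).ker = (Ψ T').ker := h
    refine Matrix.ext_of_mulVec_single fun i => ?_
    set x : Fin k → ZMod q := Pi.single i 1
    let v : ι → ZMod q := fun a => Sum.elim x (T.mulVec x) (e a)
    have hv : ∀ S : Matrix (Fin l) (Fin k) (ZMod q), ψ S v = T.mulVec x - S.mulVec x := by
      intro S
      change (fun j => v (e.symm (Sum.inr j))) - S.mulVec (fun i => v (e.symm (Sum.inl i))) = _
      simp [v]
    have h1 : Multiplicative.ofAdd v ∈ (Ψ T).ker := by
      rw [MonoidHom.mem_ker]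
      change Multiplicative.ofAdd (ψ T v) = 1
      rw [hv, sub_self]; rfl
    rw [h', MonoidHom.mem_ker] at h1
    have h2 : ψ T' v = 0 := h1
    rw [hv] at h2
    exact sub_eq_zero.mp h2
  refine ⟨fun T => ((Ψ T).ker.comap φ).map B.subtype, ?_, ?_⟩
  · intro T T' h
    exact hΨ (Subgroup.comap_injective hφ (Subgroup.map_injective B.subtype_injective h))
  · intro T
    constructor
    · refine Subgroup.map_mono ?_
      intro x hx
      rw [Subgroup.mem_comap, MonoidHom.mem_ker.mp hx]
      exact one_mem _
    · refine le_trans ?_ hn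
      rw [Subgroup.index_map_subtype, mul_comm]
      refine Nat.mul_le_mul_left _ ?_
      rw [Subgroup.index_comap_of_surjective _ hφ, Subgroup.index_ker]
      refine (Subgroup.card_le_card_group _).trans (le_of_eq ?_)
      have : Nat.card (Multiplicative (Fin l → ZMod q)) = Nat.card (Fin l → ZMod q) := rfl
      rw [this, Nat.card_fun]; simp

def Bt (d : ℕ) (P : Finset ℕ) (hP : ∀ p ∈ P, p.Prime) :
    Subgroup (Matrix.SpecialLinearGroup (Fin d) ℤ) :=
  ⨅ p : P, haveI := Fact.mk (hP p.1 p.2); (Bor d (ZMod p.1)).comap (rd d p.1)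

theorem mem_Bt {d : ℕ} {P : Finset ℕ} {hP : ∀ p ∈ P, p.Prime}
    {g : Matrix.SpecialLinearGroup (Fin d) ℤ} :
    g ∈ Bt d P hP ↔ ∀ p ∈ P, ∀ i j, j < i → ((g i j : ℤ) : ZMod p) = 0 := by
  rw [Bt, Subgroup.mem_iInf]
  constructor
  · intro h p hp i j hij
    exact h ⟨p, hp⟩ hij
  · intro h p i j hij
    exact h p.1 p.2 i j hij

theorem index_Bt (d : ℕ) (P : Finset ℕ) (hP : ∀ p ∈ P, p.Prime) :
    (Bt d P hP).index ≤ ∏ p ∈ P, (2 ^ d * p ^ Nat.card (UpT d)) := by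
  rw [← Finset.prod_coe_sort]
  refine (Subgroup.index_iInf_le _).trans (Finset.prod_le_prod' fun p _ => ?_)
  haveI := Fact.mk (hP p.1 p.2)
  refine le_trans ?_ (index_Bor d p.1)
  rw [Subgroup.index_comap, ← Subgroup.relIndex_top_right]
  refine Subgroup.relIndex_le_of_le_right le_top ?_
  rw [Subgroup.relIndex_top_right]
  exact Subgroup.index_ne_zero_of_finite

def dg {d : ℕ} {P : Finset ℕ} (hP : ∀ p ∈ P, p.Prime) (p : P) (i : Fin d) :
    Bt d P hP →* ZMod p.1 where
  toFun g := ((g.1 i i : ℤ) : ZMod p.1)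
  map_one' := by
    have : ((1 : Bt d P hP).1 i i) = 1 := Matrix.one_apply_eq i
    rw [this]; simp
  map_mul' := by
    intro g h
    have hg := mem_Bt.mp g.2 p.1 p.2
    have hh := mem_Bt.mp h.2 p.1 p.2
    have : ((g * h).1 i i) = ∑ j, g.1 i j * h.1 j i := Matrix.mul_apply
    rw [this, Int.cast_sum, Finset.sum_eq_single i]
    · push_cast; rfl
    · intro j _ hj
      rw [Int.cast_mul]
      rcases lt_or_gt_of_ne hj with h1 | h1
      · rw [hg _ _ h1, zero_mul]
      · rw [hh _ _ h1, mul_zero]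
    · simp

def phi {e q : ℕ} {P : Finset ℕ} (hP : ∀ p ∈ P, p.Prime)
    (χ : ∀ p : P, (ZMod p.1)ˣ →* Multiplicative (ZMod q)) :
    Bt (e + 1) P hP →* Multiplicative (Fin e × P → ZMod q) where
  toFun g := Multiplicative.ofAdd fun x =>
    (χ x.2 ((dg hP x.2 x.1.castSucc).toHomUnits g)).toAdd
  map_one' := by
    simp only [map_one]; rfl
  map_mul' := by
    intro g h
    simp only [map_mul]; rfl

theorem phi_surj {e q : ℕ} {P : Finset ℕ} (hP : ∀ p ∈ P, p.Prime)
    (χ : ∀ p : P, (ZMod p.1)ˣ →* Multiplicative (ZMod q)) (hχ : ∀ p, Function.Surjective (χ p)) :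
    Function.Surjective (phi (e := e) hP χ) := by
  classical
  have key : ∀ (i : Fin e) (w : P → ZMod q), ∃ g, phi (e := e) hP χ g =
      Multiplicative.ofAdd fun x => if x.1 = i then w x.2 else 0 := by
    intro i w
    choose u hu using fun p => hχ p (Multiplicative.ofAdd (w p))
    let M : ℕ := ∏ p : P, p.1
    have hM : 0 < M := Finset.prod_pos fun p _ => (hP p.1 p.2).pos
    obtain ⟨a0, ha0⟩ := Nat.chineseRemainderOfFinset (fun p : P => (u p : ZMod p.1).val)
      (fun p : P => p.1) Finset.univ (fun p _ => (hP p.1 p.2).ne_zero) (by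
        intro p _ r _ hpr
        exact (Nat.coprime_primes (hP p.1 p.2) (hP r.1 r.2)).mpr fun h => hpr (Subtype.ext h))
    have hpM : ∀ p : P, p.1 ∣ M := fun p => Finset.dvd_prod_of_mem _ (Finset.mem_univ p)
    let a := a0 + M
    have hau : ∀ p : P, ((a : ℕ) : ZMod p.1) = u p := by
      intro p
      haveI := Fact.mk (hP p.1 p.2)
      have h1 : ((a0 : ℕ) : ZMod p.1) = ((u p : ZMod p.1).val : ℕ) :=
        (ZMod.natCast_eq_natCast_iff _ _ _).mpr (ha0 p (Finset.mem_univ p))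
      have h2 : ((M : ℕ) : ZMod p.1) = 0 := (ZMod.natCast_eq_zero_iff _ _).mpr (hpM p)
      simp only [a]
      rw [Nat.cast_add, h1, h2, ZMod.natCast_zmod_val, add_zero]
    have hcop : IsCoprime (a : ℤ) (M : ℤ) := by
      rw [Nat.isCoprime_iff_coprime]
      refine Nat.Coprime.prod_right fun p _ => ?_
      haveI := Fact.mk (hP p.1 p.2)
      rw [← ZMod.isUnit_iff_coprime, hau]
      exact Units.isUnit _
    obtain ⟨f, b, hfb⟩ := hcop
    obtain ⟨g, hg1, hg2, hg3⟩ := exists_mat e i (a : ℤ) (-b) (M : ℤ) f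
      (by have : 0 < a := by simp only [a]; omega
          exact_mod_cast this.ne') (by linarith)
    have hgB : g ∈ Bt (e + 1) P hP := by
      rw [mem_Bt]
      intro p hp r s hrs
      rw [ZMod.intCast_zmod_eq_zero_iff_dvd]
      exact (Int.natCast_dvd_natCast.mpr (hpM ⟨p, hp⟩)).trans (hg3 r s hrs)
    refine ⟨⟨g, hgB⟩, ?_⟩
    change (Multiplicative.ofAdd fun x : Fin e × P =>
      (χ x.2 ((dg hP x.2 x.1.castSucc).toHomUnits ⟨g, hgB⟩)).toAdd) = _
    congr 1
    funext ⟨j, p⟩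
    by_cases hj : j = i
    · subst hj
      have : (dg hP p j.castSucc).toHomUnits ⟨g, hgB⟩ = u p := by
        ext
        rw [MonoidHom.coe_toHomUnits]
        change ((g j.castSucc j.castSucc : ℤ) : ZMod p.1) = _
        rw [hg1, Int.cast_natCast, hau]
      simp only [this, hu, if_true]
      rfl
    · have : (dg hP p j.castSucc).toHomUnits ⟨g, hgB⟩ = 1 := by
        ext
        rw [MonoidHom.coe_toHomUnits]
        change ((g j.castSucc j.castSucc : ℤ) : ZMod p.1) = _
        rw [hg2 j hj]; simp
      simp only [this, map_one, if_neg hj]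
      rfl
  intro y
  change y ∈ (phi (e := e) hP χ).range
  have hy : y = ∏ i : Fin e, Multiplicative.ofAdd
      (fun x : Fin e × P => if x.1 = i then (y.toAdd (i, x.2)) else 0) := by
    rw [← ofAdd_sum]
    apply Multiplicative.toAdd.injective
    rw [toAdd_ofAdd]
    funext ⟨j, p⟩
    simp
  rw [hy]
  refine Subgroup.prod_mem _ fun i _ => ?_
  exact key i fun p => y.toAdd (i, p)

theorem lower_count {d : ℕ} (hd : 2 ≤ d) {q : ℕ} (hq : q.Prime) (P : Finset ℕ)
    (hP : ∀ p ∈ P, p.Prime) (hPq : ∀ p ∈ P, q ∣ p - 1) (k l : ℕ)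
    (hkl : k + l = (d - 1) * P.card) (n : ℕ)
    (hn : (∏ p ∈ P, (2 ^ d * p ^ Nat.card (UpT d))) * q ^ l ≤ n) :
    q ^ (l * k) ≤ congCount d n := by
  classical
  obtain ⟨e, rfl⟩ : ∃ e, d = e + 1 := ⟨d - 1, by omega⟩
  haveI : NeZero q := ⟨hq.ne_zero⟩
  choose χ hχ using fun p : P => exists_chi p.1 q (hP p.1 p.2) (hPq p.1 p.2)
  obtain ⟨f, hf, hf2⟩ := abs_count (Bt (e + 1) P hP) (phi hP χ) (phi_surj hP χ hχ) k l
    (by simp [hkl]) n ((Nat.mul_le_mul_right _ (index_Bt _ _ _)).trans hn)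
  have hcong : ∀ T, IsCongruenceSubgroup (f T) := by
    intro T
    refine ⟨∏ p : P, p.1, Finset.prod_pos fun (p : P) _ => (hP p.1 p.2).pos, ?_⟩
    refine le_trans ?_ (hf2 T).1
    intro g hg
    have hg' : ∀ p : P, ∀ i j, ((g i j : ℤ) : ZMod p.1) =
        (((1 : Matrix (Fin (e + 1)) (Fin (e + 1)) ℤ) i j : ℤ) : ZMod p.1) := by
      intro p i j
      have h1 := (mem_rd_ker g).mp hg i j
      have h2 : (p.1 : ℤ) ∣ g i j - (1 : Matrix (Fin (e + 1)) (Fin (e + 1)) ℤ) i j :=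
        (Int.natCast_dvd_natCast.mpr (Finset.dvd_prod_of_mem (fun p : P => p.1)
          (Finset.mem_univ p))).trans h1
      rw [← sub_eq_zero, ← Int.cast_sub, ZMod.intCast_zmod_eq_zero_iff_dvd]
      exact h2
    have hgB : g ∈ Bt (e + 1) P hP := by
      rw [mem_Bt]
      intro p hp i j hij
      rw [hg' ⟨p, hp⟩, Matrix.one_apply_ne hij.ne']; simp
    refine ⟨⟨g, hgB⟩, ?_, rfl⟩
    change _ = _
    apply Multiplicative.toAdd.injective
    funext ⟨i, p⟩
    change (χ p ((dg hP p i.castSucc).toHomUnits ⟨g, hgB⟩)).toAdd = 0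
    have : (dg hP p i.castSucc).toHomUnits ⟨g, hgB⟩ = 1 := by
      ext
      rw [MonoidHom.coe_toHomUnits]
      change ((g i.castSucc i.castSucc : ℤ) : ZMod p.1) = _
      rw [hg', Matrix.one_apply_eq]; simp
    rw [this, map_one]; rfl
  have := Nat.card_le_card_of_injective
    (fun T => (⟨f T, hcong T, (hf2 T).2⟩ : CS (e + 1) n))
    (fun T T' h => hf (congrArg Subtype.val h))
  have hc : Nat.card (Matrix (Fin l) (Fin k) (ZMod q)) = q ^ (l * k) := by
    have : Nat.card (Matrix (Fin l) (Fin k) (ZMod q)) = Nat.card (Fin l → Fin k → ZMod q) := rfl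
    rw [this, Nat.card_fun, Nat.card_fun]
    simp [← pow_mul, mul_comm]
  rw [hc] at this
  exact this

end CG

namespace CG

/-- additive character -/
noncomputable def ee (t : ℝ) : ℂ := Complex.exp (Complex.I * ((2 * Real.pi * t : ℝ) : ℂ))

theorem ee_add (s t : ℝ) : ee (s + t) = ee s * ee t := by
  rw [ee, ee, ee, ← Complex.exp_add]; congr 1; push_cast; ring

theorem ee_int (k : ℤ) : ee k = 1 := by
  rw [ee, Complex.exp_eq_one_iff]
  exact ⟨k, by push_cast; ring⟩

theorem ee_norm (t : ℝ) : ‖ee t‖ = 1 := by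
  rw [ee, mul_comm, Complex.norm_exp_ofReal_mul_I]

theorem ee_conj (t : ℝ) : (starRingEnd ℂ) (ee t) = ee (-t) := by
  rw [ee, ee, ← Complex.exp_conj]
  rw [map_mul, Complex.conj_I, Complex.conj_ofReal]
  congr 1; push_cast; ring

theorem ee_natmul (n : ℕ) (t : ℝ) : ee (n * t) = ee t ^ n := by
  rw [ee, ee, ← Complex.exp_nat_mul]; congr 1; push_cast; ring

theorem ee_zero : ee 0 = 1 := by simpa using ee_int 0

theorem ee_fract (t : ℝ) : ee (Int.fract t) = ee t := by
  have : t = Int.fract t + (⌊t⌋ : ℝ) := (Int.fract_add_floor t).symm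
  conv_rhs => rw [this, ee_add, ee_int, mul_one]

theorem ee_sub_one (t : ℝ) (h0 : 0 < t) (h1 : t < 1) : 4 * min t (1 - t) ≤ ‖ee t - 1‖ := by
  rw [ee, Complex.norm_exp_I_mul_ofReal_sub_one]
  have hpi := Real.pi_pos
  have hs : (2 * Real.pi * t) / 2 = Real.pi * t := by ring
  rw [hs]
  have key : 2 * min t (1 - t) ≤ Real.sin (Real.pi * t) := by
    rcases le_total t (1 / 2) with h | h
    · have := Real.mul_le_sin (x := Real.pi * t) (by positivity) (by nlinarith)
      have e : 2 / Real.pi * (Real.pi * t) = 2 * t := by field_simp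
      rw [e] at this
      exact le_trans (by gcongr; exact min_le_left _ _) this
    · have := Real.mul_le_sin (x := Real.pi * (1 - t)) (mul_nonneg hpi.le (by linarith))
        (by nlinarith)
      have e : 2 / Real.pi * (Real.pi * (1 - t)) = 2 * (1 - t) := by field_simp
      have e2 : Real.pi * (1 - t) = Real.pi - Real.pi * t := by ring
      rw [e, e2, Real.sin_pi_sub] at this
      exact le_trans (by gcongr; exact min_le_right _ _) this
  rw [Real.norm_eq_abs]
  refine le_trans ?_ (le_abs_self _)
  linarith

theorem geom_bound (N : ℕ) (t : ℝ) (h0 : 0 < t) (h1 : t < 1) :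
    ‖∑ n ∈ Finset.range N, ee (n * t)‖ ≤ 1 / t + 1 / (1 - t) := by
  simp only [ee_natmul]
  have hm : 0 < min t (1 - t) := lt_min h0 (by linarith)
  have h := ee_sub_one t h0 h1
  have hg := congrArg norm (mul_geom_sum (ee t) N)
  rw [norm_mul] at hg
  have h2 : ‖ee t ^ N - 1‖ ≤ 2 := by
    refine (norm_sub_le _ _).trans ?_
    rw [norm_pow, ee_norm]; norm_num
  have h3 : ‖∑ i ∈ Finset.range N, ee t ^ i‖ ≤ 1 / min t (1 - t) := by
    rw [le_div_iff₀ hm]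
    have := norm_nonneg (∑ i ∈ Finset.range N, ee t ^ i)
    nlinarith
  refine h3.trans ?_
  have ht : 0 ≤ 1 / t := by positivity
  have ht' : 0 ≤ 1 / (1 - t) := div_nonneg zero_le_one (by linarith)
  rcases min_cases t (1 - t) with ⟨h, _⟩ | ⟨h, _⟩ <;> rw [h] <;> linarith

theorem sum_inv_sep {ι : Type*} (s : Finset ι) (t : ι → ℝ) (D : ℕ) (hD : 0 < D)
    (h1 : ∀ i ∈ s, (1 : ℝ) / D ≤ t i) (h2 : ∀ i ∈ s, t i < 1)
    (h3 : ∀ i ∈ s, ∀ j ∈ s, i ≠ j → (1 : ℝ) / D ≤ |t i - t j|) :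
    ∑ i ∈ s, 1 / t i ≤ D * (1 + Real.log D) := by
  classical
  have hD' : (0 : ℝ) < D := by exact_mod_cast hD
  let g : ι → ℕ := fun i => ⌊D * t i⌋₊
  have hpos : ∀ i ∈ s, 0 < t i := fun i hi => lt_of_lt_of_le (by positivity) (h1 i hi)
  have hg1 : ∀ i ∈ s, 1 ≤ g i := by
    intro i hi
    apply Nat.le_floor
    have := h1 i hi
    rw [div_le_iff₀ hD'] at this
    push_cast; linarith
  have hg2 : ∀ i ∈ s, g i ≤ D := by
    intro i hi
    refine Nat.floor_le_of_le ?_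
    nlinarith [h2 i hi]
  have hinj : Set.InjOn g s := by
    intro i hi j hj hij
    by_contra hne
    have h := h3 i hi j hj hne
    have a1 := Nat.floor_le (mul_nonneg hD'.le (hpos i hi).le)
    have a2 := Nat.lt_floor_add_one (D * t i)
    have b1 := Nat.floor_le (mul_nonneg hD'.le (hpos j hj).le)
    have b2 := Nat.lt_floor_add_one (D * t j)
    have hij' : (⌊D * t i⌋₊ : ℝ) = ⌊D * t j⌋₊ := by exact_mod_cast hij
    rw [div_le_iff₀ hD'] at h
    have : |t i - t j| * D < 1 := by
      have e : |t i - t j| * D = |(t i - t j) * D| := by rw [abs_mul, abs_of_pos hD']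
      rw [e, abs_lt]
      constructor <;> nlinarith
    linarith
  calc ∑ i ∈ s, 1 / t i ≤ ∑ i ∈ s, (D : ℝ) * ((g i : ℝ))⁻¹ := by
        refine Finset.sum_le_sum fun i hi => ?_
        have a1 := Nat.floor_le (mul_nonneg hD'.le (hpos i hi).le)
        have : (0 : ℝ) < g i := by exact_mod_cast hg1 i hi
        rw [← div_eq_mul_inv, div_le_div_iff₀ (hpos i hi) this]
        simp only [g] at *
        linarith
    _ = D * ∑ k ∈ s.image g, ((k : ℝ))⁻¹ := by
        rw [← Finset.mul_sum, Finset.sum_image hinj]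
    _ ≤ D * ∑ k ∈ Finset.Icc 1 D, ((k : ℝ))⁻¹ := by
        gcongr
        intro k hk
        obtain ⟨i, hi, rfl⟩ := Finset.mem_image.mp hk
        exact Finset.mem_Icc.mpr ⟨hg1 i hi, hg2 i hi⟩
    _ ≤ D * (1 + Real.log D) := by
        gcongr
        have := harmonic_le_one_add_log D
        rw [harmonic_eq_sum_Icc] at this
        push_cast at this
        exact this

/-- large sieve for separated points -/
theorem large_sieve_pts {ι : Type*} (s : Finset ι) (x : ι → ℝ) (D : ℕ) (hD : 0 < D)
    (hsep : ∀ i ∈ s, ∀ j ∈ s, i ≠ j → ∀ k : ℤ, (1 : ℝ) / D ≤ |x i - x j + k|)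
    (N : ℕ) (a : ℕ → ℝ) :
    ∑ i ∈ s, ‖∑ n ∈ Finset.range N, (a n : ℂ) * ee (n * x i)‖ ^ 2 ≤
      (N + 2 * D * (1 + Real.log D)) * ∑ n ∈ Finset.range N, (a n) ^ 2 := by
  classical
  have hD' : (0 : ℝ) < D := by exact_mod_cast hD
  set Δ : ℝ := N + 2 * D * (1 + Real.log D) with hΔ
  set S : ι → ℂ := fun i => ∑ n ∈ Finset.range N, (a n : ℂ) * ee (n * x i) with hS
  set T : ℝ := ∑ i ∈ s, ‖S i‖ ^ 2 with hT
  have hT0 : 0 ≤ T := Finset.sum_nonneg fun i _ => by positivity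
  -- kernel
  let K : ι → ι → ℂ := fun i j => ∑ n ∈ Finset.range N, ee (n * (x i - x j))
  have hfr : ∀ i ∈ s, ∀ j ∈ s, i ≠ j → (1 : ℝ) / D ≤ Int.fract (x j - x i) ∧
      (1 : ℝ) / D ≤ 1 - Int.fract (x j - x i) := by
    intro i hi j hj hij
    have e : Int.fract (x j - x i) = x j - x i - ⌊x j - x i⌋ := rfl
    have a1 := Int.fract_nonneg (x j - x i)
    have a2 := Int.fract_lt_one (x j - x i)
    constructor
    · have := hsep j hj i hi hij.symm (-⌊x j - x i⌋)
      push_cast at this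
      rw [← sub_eq_add_neg, ← e, abs_of_nonneg a1] at this
      exact this
    · have := hsep j hj i hi hij.symm (-⌊x j - x i⌋ - 1)
      push_cast at this
      have e2 : x j - x i + (-(⌊x j - x i⌋ : ℝ) - 1) = -(1 - Int.fract (x j - x i)) := by
        rw [e]; ring
      rw [e2, abs_neg, abs_of_nonneg (by linarith)] at this
      exact this
  have hKrow : ∀ i ∈ s, ∑ j ∈ s, ‖K j i‖ ≤ Δ := by
    intro i hi
    rw [← Finset.add_sum_erase s _ hi]
    have h0 : ‖K i i‖ ≤ N := by
      simp [K, ee_zero]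
    have hb : ∑ j ∈ s.erase i, ‖K j i‖ ≤
        ∑ j ∈ s.erase i, (1 / Int.fract (x j - x i) + 1 / (1 - Int.fract (x j - x i))) := by
      refine Finset.sum_le_sum fun j hj => ?_
      obtain ⟨hji, hjs⟩ := Finset.mem_erase.mp hj
      have h := hfr i hi j hjs hji.symm
      have : K j i = ∑ n ∈ Finset.range N, ee (n * Int.fract (x j - x i)) := by
        refine Finset.sum_congr rfl fun n _ => ?_
        rw [ee_natmul, ee_natmul, ee_fract]
      rw [this]
      have hp : (0 : ℝ) < 1 / D := by positivity
      exact geom_bound N _ (by linarith [h.1]) (by linarith [h.2])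
    have hsep2 : ∀ j ∈ s.erase i, ∀ k ∈ s.erase i, j ≠ k → (1 : ℝ) / D ≤
        |Int.fract (x j - x i) - Int.fract (x k - x i)| := by
      intro j hj k hk hjk
      have := hsep j (Finset.mem_of_mem_erase hj) k (Finset.mem_of_mem_erase hk) hjk
        (⌊x k - x i⌋ - ⌊x j - x i⌋)
      push_cast at this
      have e : Int.fract (x j - x i) - Int.fract (x k - x i) =
          x j - x k + ((⌊x k - x i⌋ : ℝ) - ⌊x j - x i⌋) := by
        rw [Int.fract, Int.fract]; ring
      rw [e]; exact this
    have hp : (0 : ℝ) < 1 / D := by positivity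
    have c1 := sum_inv_sep (s.erase i) (fun j => Int.fract (x j - x i)) D hD
      (fun j hj => (hfr i hi j (Finset.mem_of_mem_erase hj) (Finset.ne_of_mem_erase hj).symm).1)
      (fun j _ => Int.fract_lt_one _) hsep2
    have c2 := sum_inv_sep (s.erase i) (fun j => 1 - Int.fract (x j - x i)) D hD
      (fun j hj => (hfr i hi j (Finset.mem_of_mem_erase hj) (Finset.ne_of_mem_erase hj).symm).2)
      (fun j hj => by
        have := (hfr i hi j (Finset.mem_of_mem_erase hj) (Finset.ne_of_mem_erase hj).symm).1
        linarith)
      (fun j hj k hk hjk => by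
        have := hsep2 j hj k hk hjk
        rw [abs_sub_comm] at this
        have e : (1 - Int.fract (x j - x i)) - (1 - Int.fract (x k - x i)) =
          Int.fract (x k - x i) - Int.fract (x j - x i) := by ring
        rw [e]; exact this)
    rw [Finset.sum_add_distrib] at hb
    rw [hΔ]; linarith
  have hKsymm : ∀ i j, ‖K i j‖ = ‖K j i‖ := by
    intro i j
    have : K j i = (starRingEnd ℂ) (K i j) := by
      simp only [K, map_sum, ee_conj]
      refine Finset.sum_congr rfl fun n _ => ?_
      congr 1; ring
    rw [this, Complex.norm_conj]
  let c : ι → ℂ := fun i => (starRingEnd ℂ) (S i)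
  let R : ℕ → ℂ := fun n => ∑ i ∈ s, c i * ee (n * x i)
  have hR : ∑ n ∈ Finset.range N, ‖R n‖ ^ 2 ≤ Δ * T := by
    have e1 : ((∑ n ∈ Finset.range N, ‖R n‖ ^ 2 : ℝ) : ℂ) =
        ∑ i ∈ s, ∑ j ∈ s, c i * (starRingEnd ℂ) (c j) * K i j := by
      push_cast
      have : ∀ n, ((‖R n‖ : ℂ)) ^ 2 = ∑ i ∈ s, ∑ j ∈ s,
          c i * (starRingEnd ℂ) (c j) * ee (n * (x i - x j)) := by
        intro n
        rw [← Complex.mul_conj']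
        simp only [R, map_sum, map_mul, ee_conj, Finset.sum_mul_sum]
        refine Finset.sum_congr rfl fun i _ => Finset.sum_congr rfl fun j _ => ?_
        have : (n : ℝ) * (x i - x j) = n * x i + -(n * x j) := by ring
        rw [this, ee_add]; ring
      simp only [this]
      rw [Finset.sum_comm]
      refine Finset.sum_congr rfl fun i _ => ?_
      rw [Finset.sum_comm]
      refine Finset.sum_congr rfl fun j _ => ?_
      rw [← Finset.mul_sum]
    have e2 : ∑ n ∈ Finset.range N, ‖R n‖ ^ 2 = ‖((∑ n ∈ Finset.range N, ‖R n‖ ^ 2 : ℝ) : ℂ)‖ := by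
      rw [Complex.norm_real, Real.norm_of_nonneg]
      exact Finset.sum_nonneg fun i _ => by positivity
    rw [e2, e1]
    calc _ ≤ ∑ i ∈ s, ∑ j ∈ s, ‖c i * (starRingEnd ℂ) (c j) * K i j‖ :=
          (norm_sum_le _ _).trans (Finset.sum_le_sum fun i _ => norm_sum_le _ _)
      _ ≤ ∑ i ∈ s, ∑ j ∈ s, (‖S i‖ ^ 2 * ‖K i j‖ / 2 + ‖S j‖ ^ 2 * ‖K i j‖ / 2) := by
          refine Finset.sum_le_sum fun i _ => Finset.sum_le_sum fun j _ => ?_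
          simp only [norm_mul, c, Complex.norm_conj]
          nlinarith [mul_nonneg (sq_nonneg (‖S i‖ - ‖S j‖)) (norm_nonneg (K i j))]
      _ = ∑ i ∈ s, ‖S i‖ ^ 2 * ∑ j ∈ s, ‖K j i‖ := by
          simp only [Finset.sum_add_distrib]
          rw [Finset.sum_comm (f := fun i j => ‖S j‖ ^ 2 * ‖K i j‖ / 2), ← Finset.sum_add_distrib]
          refine Finset.sum_congr rfl fun i _ => ?_
          rw [← Finset.sum_add_distrib, Finset.mul_sum]
          refine Finset.sum_congr rfl fun j _ => ?_
          rw [hKsymm i j]; ring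
      _ ≤ ∑ i ∈ s, ‖S i‖ ^ 2 * Δ := by
          refine Finset.sum_le_sum fun i hi => ?_
          exact mul_le_mul_of_nonneg_left (hKrow i hi) (by positivity)
      _ = Δ * T := by rw [hT, ← Finset.sum_mul, mul_comm]
  have hTR : T ≤ ∑ n ∈ Finset.range N, |a n| * ‖R n‖ := by
    have e1 : (T : ℂ) = ∑ n ∈ Finset.range N, (a n : ℂ) * R n := by
      rw [hT]; push_cast
      have : ∀ i, ((‖S i‖ : ℂ)) ^ 2 = ∑ n ∈ Finset.range N, (a n : ℂ) * (c i * ee (n * x i)) := by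
        intro i
        rw [← Complex.conj_mul']
        simp only [c]
        conv_lhs => rw [hS]
        rw [Finset.mul_sum]
        refine Finset.sum_congr rfl fun n _ => ?_
        ring
      simp only [this]
      rw [Finset.sum_comm]
      refine Finset.sum_congr rfl fun n _ => ?_
      rw [← Finset.mul_sum]
    have e2 : T = ‖(T : ℂ)‖ := by rw [Complex.norm_real, Real.norm_of_nonneg hT0]
    rw [e2, e1]
    refine (norm_sum_le _ _).trans (Finset.sum_le_sum fun n _ => ?_)
    rw [norm_mul, Complex.norm_real, Real.norm_eq_abs]
  have hCS := Finset.sum_mul_sq_le_sq_mul_sq (Finset.range N) (fun n => |a n|) (fun n => ‖R n‖)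
  simp only [sq_abs] at hCS
  set A : ℝ := ∑ n ∈ Finset.range N, a n ^ 2 with hA
  have hA0 : 0 ≤ A := Finset.sum_nonneg fun i _ => by positivity
  have h1 : T ^ 2 ≤ A * (Δ * T) := by
    calc T ^ 2 ≤ (∑ n ∈ Finset.range N, |a n| * ‖R n‖) ^ 2 := by gcongr
      _ ≤ _ := hCS
      _ ≤ A * (Δ * T) := by gcongr
  rcases hT0.eq_or_lt with h | h
  · rw [← h]
    have : 0 ≤ Real.log D := Real.log_natCast_nonneg D
    positivity
  · have : T * T ≤ (Δ * A) * T := by nlinarith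
    exact le_of_mul_le_mul_right this h

end CG

namespace CG

noncomputable def cls (q N : ℕ) (a : ℕ → ℝ) (u : ℕ) : ℝ :=
  ∑ n ∈ Finset.range N, if n % q = u then a n else 0

noncomputable def vr (q N : ℕ) (a : ℕ → ℝ) : ℝ :=
  ∑ u ∈ Finset.range q, (cls q N a u - (∑ n ∈ Finset.range N, a n) / q) ^ 2

theorem orth (q : ℕ) (hq : 0 < q) (m n : ℕ) :
    ∑ h ∈ Finset.range q, ee (h * (((m : ℝ) - n) / q)) = if m % q = n % q then (q : ℂ) else 0 := by
  have hq' : (q : ℝ) ≠ 0 := by exact_mod_cast hq.ne'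
  simp only [ee_natmul]
  have hmn : m % q = n % q ↔ (q : ℤ) ∣ (m : ℤ) - n := by
    rw [← Nat.modEq_iff_dvd]; exact eq_comm
  split_ifs with h
  · rw [hmn] at h
    obtain ⟨k, hk⟩ := h
    have e : ((m : ℝ) - n) / q = (k : ℤ) := by
      have : (m : ℝ) - n = q * k := by exact_mod_cast hk
      rw [this]; field_simp
    rw [e, ee_int]; simp
  · have hz : ee (((m : ℝ) - n) / q) ≠ 1 := by
      intro h1
      apply h
      rw [ee, Complex.exp_eq_one_iff] at h1
      obtain ⟨k, hk⟩ := h1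
      rw [hmn]
      refine ⟨k, ?_⟩
      have hk2 : (2 * Real.pi * Complex.I) * ((((m : ℝ) - n) / q : ℝ) : ℂ) =
          (2 * Real.pi * Complex.I) * ((k : ℝ) : ℂ) := by
        push_cast at hk ⊢
        linear_combination hk
      have hk3 := mul_left_cancel₀ Complex.two_pi_I_ne_zero hk2
      have hk4 : ((m : ℝ) - n) / q = k := by exact_mod_cast hk3
      rw [div_eq_iff hq'] at hk4
      have : (m : ℝ) - n = q * k := by rw [hk4]; ring
      exact_mod_cast this
    have hg := mul_geom_sum (ee (((m : ℝ) - n) / q)) q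
    have e : ee (((m : ℝ) - n) / q) ^ q = 1 := by
      rw [← ee_natmul]
      have : (q : ℝ) * (((m : ℝ) - n) / q) = (((m : ℤ) - n : ℤ) : ℝ) := by
        push_cast; field_simp
      rw [this, ee_int]
    rw [e, sub_self] at hg
    rcases mul_eq_zero.mp hg with h1 | h1
    · exact absurd (sub_eq_zero.mp h1) hz
    · exact h1

theorem sum_cls_sq (q N : ℕ) (hq : 0 < q) (a : ℕ → ℝ) :
    ∑ u ∈ Finset.range q, cls q N a u ^ 2 = ∑ m ∈ Finset.range N, ∑ n ∈ Finset.range N,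
      if m % q = n % q then a m * a n else 0 := by
  have : ∀ u, cls q N a u ^ 2 = ∑ m ∈ Finset.range N, ∑ n ∈ Finset.range N,
      if m % q = u then (if n % q = u then a m * a n else 0) else 0 := by
    intro u
    rw [cls, sq, Finset.sum_mul_sum]
    refine Finset.sum_congr rfl fun m _ => Finset.sum_congr rfl fun n _ => ?_
    split_ifs <;> simp
  simp only [this]
  rw [Finset.sum_comm]
  refine Finset.sum_congr rfl fun m _ => ?_
  rw [Finset.sum_comm]
  refine Finset.sum_congr rfl fun n _ => ?_
  rw [Finset.sum_ite_eq, if_pos (Finset.mem_range.mpr (Nat.mod_lt _ hq))]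
  simp only [eq_comm]

theorem sum_cls (q N : ℕ) (hq : 0 < q) (a : ℕ → ℝ) :
    ∑ u ∈ Finset.range q, cls q N a u = ∑ n ∈ Finset.range N, a n := by
  simp only [cls]
  rw [Finset.sum_comm]
  refine Finset.sum_congr rfl fun m _ => ?_
  rw [Finset.sum_ite_eq, if_pos (Finset.mem_range.mpr (Nat.mod_lt _ hq))]

theorem parseval (q N : ℕ) (hq : 0 < q) (a : ℕ → ℝ) :
    q * vr q N a = ∑ h ∈ Finset.Ico 1 q,
      ‖∑ n ∈ Finset.range N, (a n : ℂ) * ee (n * ((h : ℝ) / q))‖ ^ 2 := by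
  have hq' : (q : ℝ) ≠ 0 := by exact_mod_cast hq.ne'
  set S : ℕ → ℂ := fun h => ∑ n ∈ Finset.range N, (a n : ℂ) * ee (n * ((h : ℝ) / q)) with hS
  set A := ∑ n ∈ Finset.range N, a n with hA
  have h1 : ∑ h ∈ Finset.range q, ‖S h‖ ^ 2 = q * ∑ u ∈ Finset.range q, cls q N a u ^ 2 := by
    have : ((∑ h ∈ Finset.range q, ‖S h‖ ^ 2 : ℝ) : ℂ) =
        ((q * ∑ u ∈ Finset.range q, cls q N a u ^ 2 : ℝ) : ℂ) := by
      rw [sum_cls_sq q N hq]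
      push_cast
      have e : ∀ h : ℕ, ((‖S h‖ : ℂ)) ^ 2 = ∑ m ∈ Finset.range N, ∑ n ∈ Finset.range N,
          (a m : ℂ) * a n * ee (h * (((m : ℝ) - n) / q)) := by
        intro h
        rw [← Complex.mul_conj']
        simp only [S, map_sum, map_mul, ee_conj, Finset.sum_mul_sum, Complex.conj_ofReal]
        refine Finset.sum_congr rfl fun i _ => Finset.sum_congr rfl fun j _ => ?_
        have : (h : ℝ) * (((i : ℝ) - j) / q) = i * (h / q) + -(j * (h / q)) := by ring
        rw [this, ee_add]; ring
      simp only [e]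
      rw [Finset.sum_comm, Finset.mul_sum]
      refine Finset.sum_congr rfl fun m _ => ?_
      rw [Finset.sum_comm, Finset.mul_sum]
      refine Finset.sum_congr rfl fun n _ => ?_
      rw [← Finset.mul_sum, orth q hq]
      split_ifs <;> push_cast <;> ring
    exact_mod_cast this
  have h0 : ‖S 0‖ ^ 2 = A ^ 2 := by
    have : S 0 = (A : ℂ) := by
      simp only [S, hA]
      push_cast
      refine Finset.sum_congr rfl fun n _ => ?_
      simp [ee_zero]
    rw [this, Complex.norm_real, Real.norm_eq_abs, sq_abs]
  rw [Finset.range_eq_Ico, Finset.sum_eq_sum_Ico_succ_bot hq, h0] at h1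
  have h2 : vr q N a = ∑ u ∈ Finset.range q, cls q N a u ^ 2 - A ^ 2 / q := by
    rw [vr]
    have : ∀ u, (cls q N a u - A / q) ^ 2 = cls q N a u ^ 2 - 2 * (A / q) * cls q N a u +
        (A / q) ^ 2 := by intro u; ring
    simp only [← hA, this]
    rw [Finset.sum_add_distrib, Finset.sum_sub_distrib, ← Finset.mul_sum, sum_cls q N hq]
    simp
    field_simp
    ring
  rw [h2, Finset.range_eq_Ico]
  have h3 : ∑ h ∈ Finset.Ico 1 q, ‖S h‖ ^ 2 =
      q * ∑ u ∈ Finset.Ico 0 q, cls q N a u ^ 2 - A ^ 2 := by linarith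
  rw [h3]
  field_simp

theorem large_sieve (Q N : ℕ) (hQ : 0 < Q) (P : Finset ℕ) (hP : ∀ q ∈ P, q.Prime)
    (hPQ : ∀ q ∈ P, q ≤ Q) (a : ℕ → ℝ) :
    ∑ q ∈ P, q * vr q N a ≤ (N + 2 * (Q : ℝ) ^ 2 * (1 + 2 * Real.log Q)) *
      ∑ n ∈ Finset.range N, (a n) ^ 2 := by
  have h := large_sieve_pts (P.sigma fun q => Finset.Ico 1 q)
    (fun i => (i.2 : ℝ) / i.1) (Q ^ 2) (by positivity) ?_ N a
  · rw [Finset.sum_sigma] at h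
    push_cast at h
    rw [Real.log_pow] at h
    push_cast at h
    refine le_trans (le_of_eq ?_) h
    refine Finset.sum_congr rfl fun q hq => ?_
    rw [parseval q N (hP q hq).pos]
  · rintro ⟨q, h⟩ hi ⟨r, g⟩ hj hne k
    simp only [Finset.mem_sigma, Finset.mem_Ico] at hi hj
    obtain ⟨hq, h1, h2⟩ := hi
    obtain ⟨hr, g1, g2⟩ := hj
    have hq0 : (0 : ℝ) < q := by exact_mod_cast (hP q hq).pos
    have hr0 : (0 : ℝ) < r := by exact_mod_cast (hP r hr).pos
    set z : ℤ := (h : ℤ) * r - g * q + k * (q * r) with hz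
    have hz0 : z ≠ 0 := by
      intro h0
      have hdvd : (q : ℤ) ∣ (h : ℤ) * r := ⟨g - k * r, by rw [hz] at h0; linarith⟩
      have hdvd' : q ∣ h * r := by exact_mod_cast hdvd
      rcases (hP q hq).dvd_mul.mp hdvd' with h' | h'
      · exact absurd (Nat.le_of_dvd h1 h') (by omega)
      · have hqr : q = r := (Nat.prime_dvd_prime_iff_eq (hP q hq) (hP r hr)).mp h'
        subst hqr
        have hqz : (q : ℤ) ≠ 0 := by exact_mod_cast (hP q hq).ne_zero
        have e : (q : ℤ) * (h - g + k * q) = 0 := by rw [hz] at h0; linarith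
        rcases mul_eq_zero.mp e with e | e
        · exact hqz e
        · have hk : k = 0 := by
            by_contra hk
            have : (q : ℤ) ∣ (g : ℤ) - h := ⟨k, by linarith⟩
            have h5 := Int.eq_zero_of_abs_lt_dvd this (by rw [abs_lt]; constructor <;> omega)
            have h6 : k * (q : ℤ) = 0 := by linarith
            rcases mul_eq_zero.mp h6 with h7 | h7
            · exact hk h7
            · exact hqz h7
          rw [hk] at e
          apply hne
          have : h = g := by omega
          rw [this]
    have hz1 : (1 : ℝ) ≤ |(z : ℝ)| := by
      have := Int.one_le_abs hz0
      exact_mod_cast this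
    have e : (h : ℝ) / q - (g : ℝ) / r + k = z / (q * r) := by
      rw [hz]; push_cast; field_simp
    change (1 : ℝ) / ((Q ^ 2 : ℕ) : ℝ) ≤ |(h : ℝ) / q - (g : ℝ) / r + k|
    rw [e, abs_div, abs_of_pos (by positivity : (0 : ℝ) < q * r)]
    have hqQ : (q : ℝ) ≤ Q := by exact_mod_cast hPQ q hq
    have hrQ : (r : ℝ) ≤ Q := by exact_mod_cast hPQ r hr
    push_cast
    rw [sq]
    gcongr

end CG

namespace CG

noncomputable def kap (q n : ℕ) : ℝ :=
  (if n % q = 1 then 1 else 0) - (if n % q = 0 then 0 else 1 / ((q : ℝ) - 1))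

theorem kap_mod (q n : ℕ) : kap q (n % q) = kap q n := by
  simp [kap]

theorem kap_of_dvd {q n : ℕ} (hq : 1 < q) (h : q ∣ n) : kap q n = 0 := by
  have : n % q = 0 := Nat.mod_eq_zero_of_dvd h
  simp [kap, this]

theorem sum_ite_ne (q : ℕ) (hq : 1 < q) :
    ∑ w ∈ Finset.range q, (if w % q = 0 then (0 : ℝ) else 1 / ((q : ℝ) - 1)) = 1 := by
  have hq' : (1 : ℝ) < q := by exact_mod_cast hq
  have h1 : ∀ w ∈ Finset.range q, (if w % q = 0 then (0 : ℝ) else 1 / ((q : ℝ) - 1)) =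
      1 / ((q : ℝ) - 1) - if w = 0 then 1 / ((q : ℝ) - 1) else 0 := by
    intro w hw
    rw [Nat.mod_eq_of_lt (Finset.mem_range.mp hw)]
    split_ifs <;> simp
  rw [Finset.sum_congr rfl h1, Finset.sum_sub_distrib, Finset.sum_ite_eq',
    if_pos (Finset.mem_range.mpr (by omega))]
  simp
  have : (q : ℝ) - 1 ≠ 0 := by linarith
  field_simp

theorem sum_ite_one (q : ℕ) (hq : 1 < q) :
    ∑ w ∈ Finset.range q, (if w % q = 1 then (1 : ℝ) else 0) = 1 := by
  have h1 : ∀ w ∈ Finset.range q, (if w % q = 1 then (1 : ℝ) else 0) = if w = 1 then 1 else 0 := by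
    intro w hw
    rw [Nat.mod_eq_of_lt (Finset.mem_range.mp hw)]
  rw [Finset.sum_congr rfl h1, Finset.sum_ite_eq', if_pos (Finset.mem_range.mpr hq)]

theorem sum_kap (q : ℕ) (hq : 1 < q) : ∑ w ∈ Finset.range q, kap q w = 0 := by
  simp only [kap, Finset.sum_sub_distrib]
  rw [sum_ite_ne q hq, sum_ite_one q hq, sub_self]

theorem abs_kap_le (q : ℕ) (hq : 1 < q) (w : ℕ) : |kap q w| ≤
    (if w % q = 1 then (1 : ℝ) else 0) + (if w % q = 0 then (0 : ℝ) else 1 / ((q : ℝ) - 1)) := by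
  have hq' : (1 : ℝ) < q := by exact_mod_cast hq
  have : 0 < 1 / ((q : ℝ) - 1) := by apply div_pos <;> linarith
  rw [kap, sub_eq_add_neg]
  refine (abs_add_le _ _).trans (le_of_eq ?_)
  rw [abs_neg]
  congr 1
  · split_ifs <;> simp
  · split_ifs
    · simp
    · exact abs_of_pos this

theorem sum_abs_kap (q : ℕ) (hq : 1 < q) : ∑ w ∈ Finset.range q, |kap q w| ≤ 2 := by
  refine (Finset.sum_le_sum fun w _ => abs_kap_le q hq w).trans (le_of_eq ?_)
  rw [Finset.sum_add_distrib, sum_ite_ne q hq, sum_ite_one q hq]; norm_num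

theorem sum_perm {q : ℕ} (hq : q.Prime) {u : ℕ} (hu : ¬ q ∣ u) (F : ℕ → ℝ) :
    ∑ v ∈ Finset.range q, F (u * v % q) = ∑ w ∈ Finset.range q, F w := by
  have hinj : Set.InjOn (fun v => u * v % q) (Finset.range q) := by
    intro v hv w hw h
    have hc : Nat.gcd q u = 1 := (Nat.Prime.coprime_iff_not_dvd hq).mpr hu
    have := Nat.ModEq.cancel_left_of_coprime hc h
    have hv' := Finset.mem_range.mp hv
    have hw' := Finset.mem_range.mp hw
    rwa [Nat.ModEq, Nat.mod_eq_of_lt hv', Nat.mod_eq_of_lt hw'] at this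
  have him : (Finset.range q).image (fun v => u * v % q) = Finset.range q := by
    refine Finset.eq_of_subset_of_card_le ?_ ?_
    · intro w hw
      obtain ⟨v, _, rfl⟩ := Finset.mem_image.mp hw
      exact Finset.mem_range.mpr (Nat.mod_lt _ hq.pos)
    · rw [Finset.card_image_of_injOn hinj]
  conv_rhs => rw [← him, Finset.sum_image hinj]

theorem sum_kap_mul {q : ℕ} (hq : q.Prime) (u : ℕ) :
    ∑ v ∈ Finset.range q, kap q (u * v) = 0 := by
  by_cases hu : q ∣ u
  · exact Finset.sum_eq_zero fun v _ => kap_of_dvd hq.one_lt (hu.mul_right v)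
  · have := sum_perm hq hu (fun w => kap q w)
    simp only [kap_mod] at this
    rw [this]
    exact sum_kap q hq.one_lt

theorem sum_abs_kap_mul {q : ℕ} (hq : q.Prime) (u : ℕ) :
    ∑ v ∈ Finset.range q, |kap q (u * v)| ≤ 2 := by
  by_cases hu : q ∣ u
  · rw [Finset.sum_eq_zero fun v _ => by rw [kap_of_dvd hq.one_lt (hu.mul_right v), abs_zero]]
    norm_num
  · have := sum_perm hq hu (fun w => |kap q w|)
    simp only [kap_mod] at this
    rw [this]
    exact sum_abs_kap q hq.one_lt

theorem bilin {q : ℕ} (hq : q.Prime) (M N : ℕ) (a b : ℕ → ℝ) :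
    |∑ m ∈ Finset.range M, ∑ n ∈ Finset.range N, a m * b n * kap q (m * n)| ≤
      2 * Real.sqrt (vr q M a * vr q N b) := by
  set α := (∑ n ∈ Finset.range M, a n) / q
  set β := (∑ n ∈ Finset.range N, b n) / q
  set f : ℕ → ℝ := fun u => cls q M a u - α with hf
  set g : ℕ → ℝ := fun v => cls q N b v - β with hg
  have e1 : ∑ m ∈ Finset.range M, ∑ n ∈ Finset.range N, a m * b n * kap q (m * n) =
      ∑ u ∈ Finset.range q, ∑ v ∈ Finset.range q, cls q M a u * cls q N b v * kap q (u * v) := by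
    have h1 : ∀ u v, cls q M a u * cls q N b v * kap q (u * v) =
        ∑ m ∈ Finset.range M, ∑ n ∈ Finset.range N,
          if m % q = u then (if n % q = v then a m * b n * kap q (m * n) else 0) else 0 := by
      intro u v
      rw [cls, cls, Finset.sum_mul_sum, Finset.sum_mul]
      refine Finset.sum_congr rfl fun m _ => ?_
      rw [Finset.sum_mul]
      refine Finset.sum_congr rfl fun n _ => ?_
      split_ifs with h1 h2
      · rw [← kap_mod q (m * n), Nat.mul_mod, h1, h2, kap_mod]
      all_goals simp
    simp only [h1]
    have h2 : ∀ u, ∑ v ∈ Finset.range q, ∑ m ∈ Finset.range M, ∑ n ∈ Finset.range N,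
          (if m % q = u then (if n % q = v then a m * b n * kap q (m * n) else 0) else 0) =
        ∑ m ∈ Finset.range M, ∑ n ∈ Finset.range N,
          if m % q = u then a m * b n * kap q (m * n) else 0 := by
      intro u
      rw [Finset.sum_comm]
      refine Finset.sum_congr rfl fun m _ => ?_
      rw [Finset.sum_comm]
      refine Finset.sum_congr rfl fun n _ => ?_
      split_ifs
      · rw [Finset.sum_ite_eq, if_pos (Finset.mem_range.mpr (Nat.mod_lt _ hq.pos))]
      · simp
    simp only [h2]
    symm
    rw [Finset.sum_comm]
    refine Finset.sum_congr rfl fun m _ => ?_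
    rw [Finset.sum_comm]
    refine Finset.sum_congr rfl fun n _ => ?_
    rw [Finset.sum_ite_eq, if_pos (Finset.mem_range.mpr (Nat.mod_lt _ hq.pos))]
  have e2 : ∑ u ∈ Finset.range q, ∑ v ∈ Finset.range q,
      cls q M a u * cls q N b v * kap q (u * v) =
      ∑ u ∈ Finset.range q, ∑ v ∈ Finset.range q, f u * g v * kap q (u * v) := by
    have h1 : ∀ u v, cls q M a u * cls q N b v * kap q (u * v) = f u * g v * kap q (u * v) +
        (cls q M a u * β) * kap q (u * v) + (α * g v) * kap q (v * u) := by
      intro u v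
      simp only [hf, hg]
      rw [mul_comm v u]; ring
    simp only [h1, Finset.sum_add_distrib]
    have z1 : ∑ u ∈ Finset.range q, ∑ v ∈ Finset.range q, (cls q M a u * β) * kap q (u * v) = 0 := by
      refine Finset.sum_eq_zero fun u _ => ?_
      rw [← Finset.mul_sum, sum_kap_mul hq, mul_zero]
    have z2 : ∑ u ∈ Finset.range q, ∑ v ∈ Finset.range q, (α * g v) * kap q (v * u) = 0 := by
      rw [Finset.sum_comm]
      refine Finset.sum_eq_zero fun u _ => ?_
      rw [← Finset.mul_sum, sum_kap_mul hq, mul_zero]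
    rw [z1, z2, add_zero, add_zero]
  rw [e1, e2]
  set s := Finset.range q ×ˢ Finset.range q
  have h3 : |∑ u ∈ Finset.range q, ∑ v ∈ Finset.range q, f u * g v * kap q (u * v)| ≤
      ∑ p ∈ s, (|f p.1| * Real.sqrt |kap q (p.1 * p.2)|) *
        (|g p.2| * Real.sqrt |kap q (p.1 * p.2)|) := by
    rw [← Finset.sum_product']
    refine (Finset.abs_sum_le_sum_abs _ _).trans (le_of_eq ?_)
    refine Finset.sum_congr rfl fun p _ => ?_
    rw [abs_mul, abs_mul]
    nth_rewrite 1 [← Real.mul_self_sqrt (abs_nonneg (kap q (p.1 * p.2)))]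
    ring
  have h4 := Finset.sum_mul_sq_le_sq_mul_sq s
    (fun p => |f p.1| * Real.sqrt |kap q (p.1 * p.2)|)
    (fun p => |g p.2| * Real.sqrt |kap q (p.1 * p.2)|)
  simp only [mul_pow, sq_abs, Real.sq_sqrt (abs_nonneg _)] at h4
  have h5 : ∑ p ∈ s, f p.1 ^ 2 * |kap q (p.1 * p.2)| ≤ 2 * vr q M a := by
    rw [Finset.sum_product, vr, Finset.mul_sum]
    refine Finset.sum_le_sum fun u _ => ?_
    change ∑ y ∈ Finset.range q, f u ^ 2 * |kap q (u * y)| ≤ _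
    rw [← Finset.mul_sum, mul_comm 2]
    exact mul_le_mul_of_nonneg_left (sum_abs_kap_mul hq u) (sq_nonneg _)
  have h6 : ∑ p ∈ s, g p.2 ^ 2 * |kap q (p.1 * p.2)| ≤ 2 * vr q N b := by
    rw [Finset.sum_product_right, vr, Finset.mul_sum]
    refine Finset.sum_le_sum fun v _ => ?_
    change ∑ y ∈ Finset.range q, g v ^ 2 * |kap q (y * v)| ≤ _
    rw [← Finset.mul_sum, mul_comm 2]
    refine mul_le_mul_of_nonneg_left ?_ (sq_nonneg _)
    simp only [mul_comm _ v]
    exact sum_abs_kap_mul hq v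
  have hva : 0 ≤ vr q M a := Finset.sum_nonneg fun _ _ => sq_nonneg _
  have hvb : 0 ≤ vr q N b := Finset.sum_nonneg fun _ _ => sq_nonneg _
  refine h3.trans (abs_le_of_sq_le_sq' ?_ (by positivity)).2
  refine h4.trans ?_
  rw [mul_pow, Real.sq_sqrt (by positivity)]
  calc _ ≤ (2 * vr q M a) * (2 * vr q N b) := by
        refine mul_le_mul h5 h6 ?_ (by positivity)
        exact Finset.sum_nonneg fun _ _ => by positivity
    _ = _ := by ring

/-- partial sums -/
theorem partial_kap {q : ℕ} (hq : q.Prime) (d t : ℕ) :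
    |∑ n ∈ Finset.range t, kap q (d * n)| ≤ 2 := by
  induction t using Nat.strong_induction_on with
  | _ t ih =>
    rcases lt_or_ge t q with h | h
    · calc _ ≤ ∑ n ∈ Finset.range t, |kap q (d * n)| := Finset.abs_sum_le_sum_abs _ _
        _ ≤ ∑ n ∈ Finset.range q, |kap q (d * n)| :=
            Finset.sum_le_sum_of_subset_of_nonneg (Finset.range_mono h.le)
              (fun _ _ _ => abs_nonneg _)
        _ ≤ 2 := sum_abs_kap_mul hq d
    · obtain ⟨r, rfl⟩ := Nat.exists_eq_add_of_le h
      rw [Finset.sum_range_add, sum_kap_mul hq, zero_add]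
      have e : ∀ n, kap q (d * (q + n)) = kap q (d * n) := by
        intro n
        rw [← kap_mod, ← kap_mod q (d * n)]
        congr 1
        rw [mul_add, mul_comm d q, Nat.mul_add_mod]
      simp only [e]
      exact ih r (by have := hq.pos; omega)

theorem interval_abs_kap {q : ℕ} (hq : q.Prime) (d s L : ℕ) :
    ∑ n ∈ Finset.Ico s (s + L), |kap q (d * n)| ≤ 2 * ((L : ℝ) / q + 1) := by
  set H : ℕ → ℝ := fun t => ∑ n ∈ Finset.range t, |kap q (d * n)| with hH
  have hmono : Monotone H := fun a b hab =>
    Finset.sum_le_sum_of_subset_of_nonneg (Finset.range_mono hab) (fun _ _ _ => abs_nonneg _)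
  have hstep : ∀ t, H (t + q) ≤ H t + 2 := by
    intro t
    simp only [hH]
    rw [add_comm t q, Finset.sum_range_add]
    have e : ∀ n, |kap q (d * (q + n))| = |kap q (d * n)| := by
      intro n
      rw [← kap_mod, ← kap_mod q (d * n)]
      congr 2
      rw [mul_add, mul_comm d q, Nat.mul_add_mod]
    simp only [e]
    have := sum_abs_kap_mul hq d
    linarith
  have hk : ∀ k : ℕ, H (s + q * k) ≤ H s + 2 * k := by
    intro k
    induction k with
    | zero => simp
    | succ k ih =>
      have := hstep (s + q * k)
      rw [mul_add, mul_one, ← add_assoc]; push_cast; linarith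
  have e : ∑ n ∈ Finset.Ico s (s + L), |kap q (d * n)| = H (s + L) - H s := by
    rw [Finset.sum_Ico_eq_sub _ (Nat.le_add_right s L)]
  rw [e]
  have h1 : H (s + L) ≤ H (s + q * (L / q + 1)) := hmono (by
    have := Nat.lt_mul_div_succ L hq.pos
    omega)
  have h2 := hk (L / q + 1)
  have h3 : ((L / q : ℕ) : ℝ) ≤ (L : ℝ) / q := Nat.cast_div_le
  push_cast at h2
  linarith

theorem sum_Ioc_kap (q d y : ℕ) (hq : q.Prime) (w : ℕ → ℝ) :
    ∑ n ∈ Finset.Ioc 0 y, w n * kap q (d * n) = ∑ n ∈ Finset.range (y + 1), w n * kap q (d * n) := by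
  have e : Finset.range (y + 1) = insert 0 (Finset.Ioc 0 y) := by
    ext n; simp only [Finset.mem_range, Finset.mem_insert, Finset.mem_Ioc]; omega
  rw [e, Finset.sum_insert (by simp), mul_zero, kap_of_dvd hq.one_lt (dvd_zero q), mul_zero,
    zero_add]

theorem typeI_one {q : ℕ} (hq : q.Prime) (d y : ℕ) :
    |∑ n ∈ Finset.Ioc 0 y, kap q (d * n)| ≤ 2 := by
  have := sum_Ioc_kap q d y hq (fun _ => 1)
  simp only [one_mul] at this
  rw [this]
  exact partial_kap hq d _

theorem typeI_log {q : ℕ} (hq : q.Prime) (d y : ℕ) :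
    |∑ n ∈ Finset.Ioc 0 y, Real.log n * kap q (d * n)| ≤ 4 * Real.log y := by
  rw [sum_Ioc_kap q d y hq (fun n => Real.log n)]
  have key : ∀ y : ℕ, |∑ n ∈ Finset.range (y + 1), Real.log n * kap q (d * n) -
      Real.log y * ∑ n ∈ Finset.range (y + 1), kap q (d * n)| ≤ 2 * Real.log y := by
    intro y
    induction y with
    | zero => simp
    | succ y ih =>
      rw [Finset.sum_range_succ, Finset.sum_range_succ (fun n => kap q (d * n))]
      set W := ∑ n ∈ Finset.range (y + 1), Real.log n * kap q (d * n)
      set G := ∑ n ∈ Finset.range (y + 1), kap q (d * n) with hG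
      have hG2 : |G| ≤ 2 := partial_kap hq d _
      have hl : Real.log y ≤ Real.log ((y + 1 : ℕ) : ℝ) := by
        rcases Nat.eq_zero_or_pos y with rfl | h
        · simp
        · apply Real.log_le_log
          · exact_mod_cast h
          · push_cast; linarith
      have e : W + Real.log ((y + 1 : ℕ) : ℝ) * kap q (d * (y + 1)) -
          Real.log ((y + 1 : ℕ) : ℝ) * (G + kap q (d * (y + 1))) =
          (W - Real.log y * G) - (Real.log ((y + 1 : ℕ) : ℝ) - Real.log y) * G := by ring
      rw [e]
      refine (abs_sub _ _).trans ?_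
      rw [abs_mul, abs_of_nonneg (sub_nonneg.mpr hl)]
      have : (Real.log ((y + 1 : ℕ) : ℝ) - Real.log y) * |G| ≤
          (Real.log ((y + 1 : ℕ) : ℝ) - Real.log y) * 2 :=
        mul_le_mul_of_nonneg_left hG2 (sub_nonneg.mpr hl)
      linarith
  have h1 := key y
  have h2 := partial_kap hq d (y + 1)
  have h0 : 0 ≤ Real.log y := Real.log_natCast_nonneg y
  set W := ∑ n ∈ Finset.range (y + 1), Real.log n * kap q (d * n)
  set G := ∑ n ∈ Finset.range (y + 1), kap q (d * n)
  have e : W = (W - Real.log y * G) + Real.log y * G := by ring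
  rw [e]
  refine (abs_add_le _ _).trans ?_
  rw [abs_mul, abs_of_nonneg h0]
  nlinarith

end CG

namespace CG

/-- rounding up with relative precision `2^{-r}` -/
def tau (r m : ℕ) : ℕ := (m / 2 ^ (Nat.log 2 m - r) + 1) * 2 ^ (Nat.log 2 m - r)

theorem lt_tau (r m : ℕ) : m < tau r m := by
  rw [tau, mul_comm]
  exact Nat.lt_mul_div_succ m (by positivity)

theorem tau_le (r m : ℕ) : tau r m ≤ m + 2 ^ (Nat.log 2 m - r) := by
  rw [tau, add_mul, one_mul]
  have := Nat.div_mul_le_self m (2 ^ (Nat.log 2 m - r))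
  omega

theorem pow_log_sub (r m : ℕ) (hm : 2 ^ r ≤ m) : 2 ^ (Nat.log 2 m - r) * 2 ^ r ≤ m := by
  have h0 : m ≠ 0 := by have : 0 < 2 ^ r := by positivity
                        omega
  have h1 : r ≤ Nat.log 2 m := Nat.le_log_of_pow_le (by norm_num) hm
  rw [← pow_add, Nat.sub_add_cancel h1]
  exact Nat.pow_log_le_self 2 h0

theorem tau_le_two (r m : ℕ) (hm : 2 ^ r ≤ m) : tau r m ≤ 2 * m := by
  have h1 := tau_le r m
  have h2 := pow_log_sub r m hm
  have h3 : 2 ^ (Nat.log 2 m - r) * 1 ≤ 2 ^ (Nat.log 2 m - r) * 2 ^ r :=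
    Nat.mul_le_mul_left _ Nat.one_le_two_pow
  omega

theorem card_tau (r : ℕ) (x : ℕ) (S : Finset ℕ) (hS : ∀ m ∈ S, 2 ^ r ≤ m ∧ m ≤ x) :
    (S.image (tau r)).card ≤ (Nat.log 2 x + 1) * 2 ^ (r + 1) := by
  have : S.image (tau r) ⊆ (Finset.range (Nat.log 2 x + 1) ×ˢ Finset.range (2 ^ (r + 1))).image
      (fun p => (p.2 + 1) * 2 ^ (p.1 - r)) := by
    intro t ht
    obtain ⟨m, hm, rfl⟩ := Finset.mem_image.mp ht
    obtain ⟨h1, h2⟩ := hS m hm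
    refine Finset.mem_image.mpr ⟨(Nat.log 2 m, m / 2 ^ (Nat.log 2 m - r)), ?_, rfl⟩
    rw [Finset.mem_product, Finset.mem_range, Finset.mem_range]
    refine ⟨Nat.lt_succ_of_le (Nat.log_mono_right (b := 2) h2), ?_⟩
    rw [Nat.div_lt_iff_lt_mul (by positivity), ← pow_add]
    have h3 : r ≤ Nat.log 2 m := Nat.le_log_of_pow_le (by norm_num) h1
    rw [show r + 1 + (Nat.log 2 m - r) = (Nat.log 2 m) + 1 by omega]
    exact Nat.lt_pow_succ_log_self (by norm_num) m
  refine (Finset.card_le_card this).trans (Finset.card_image_le.trans ?_)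
  rw [Finset.card_product, Finset.card_range, Finset.card_range]

/-- large sieve on a rectangle -/
theorem rect (Q M N : ℕ) (hQ : 0 < Q) (P : Finset ℕ) (hP : ∀ q ∈ P, q.Prime)
    (hPQ : ∀ q ∈ P, q ≤ Q) (a b : ℕ → ℝ) (L : ℝ) (hL : 0 ≤ L) (ha : ∀ m < M, |a m| ≤ L)
    (hb : ∀ n < N, |b n| ≤ L) :
    ∑ q ∈ P, (q : ℝ) * |∑ m ∈ Finset.range M, ∑ n ∈ Finset.range N, a m * b n * kap q (m * n)| ≤
      2 * L ^ 2 * Real.sqrt ((M * N) * ((M + 2 * (Q : ℝ) ^ 2 * (1 + 2 * Real.log Q)) *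
        (N + 2 * (Q : ℝ) ^ 2 * (1 + 2 * Real.log Q)))) := by
  set K : ℝ := 2 * (Q : ℝ) ^ 2 * (1 + 2 * Real.log Q)
  have hlogQ : 0 ≤ Real.log Q := Real.log_natCast_nonneg Q
  have hK : 0 ≤ K := by positivity
  have hv : ∀ q N a, 0 ≤ vr q N a := fun q N a => Finset.sum_nonneg fun _ _ => sq_nonneg _
  have h1 : ∑ q ∈ P, (q : ℝ) * |∑ m ∈ Finset.range M, ∑ n ∈ Finset.range N,
      a m * b n * kap q (m * n)| ≤ ∑ q ∈ P, 2 * (Real.sqrt (q * vr q M a) *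
        Real.sqrt (q * vr q N b)) := by
    refine Finset.sum_le_sum fun q hq => ?_
    refine (mul_le_mul_of_nonneg_left (bilin (hP q hq) M N a b) (by positivity)).trans
      (le_of_eq ?_)
    rw [← Real.sqrt_mul (mul_nonneg (by positivity) (hv _ _ _)),
      show (q : ℝ) * vr q M a * (q * vr q N b) = q ^ 2 * (vr q M a * vr q N b) by ring,
      Real.sqrt_mul (by positivity) (vr q M a * vr q N b), Real.sqrt_sq (by positivity)]
    ring
  have h2 : ∑ q ∈ P, Real.sqrt (q * vr q M a) * Real.sqrt (q * vr q N b) ≤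
      Real.sqrt ((∑ q ∈ P, q * vr q M a) * ∑ q ∈ P, q * vr q N b) := by
    refine Real.le_sqrt_of_sq_le ?_
    refine (Finset.sum_mul_sq_le_sq_mul_sq _ _ _).trans (le_of_eq ?_)
    congr 1 <;> refine Finset.sum_congr rfl fun q _ => ?_ <;>
      exact Real.sq_sqrt (mul_nonneg (by positivity) (hv _ _ _))
  have hs : ∀ (M : ℕ) (a : ℕ → ℝ), (∀ m < M, |a m| ≤ L) →
      ∑ q ∈ P, (q : ℝ) * vr q M a ≤ (M + K) * (L ^ 2 * M) := by
    intro M a ha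
    refine (large_sieve Q M hQ P hP hPQ a).trans ?_
    refine mul_le_mul_of_nonneg_left ?_ (by positivity)
    calc ∑ n ∈ Finset.range M, (a n) ^ 2 ≤ ∑ n ∈ Finset.range M, L ^ 2 := by
          refine Finset.sum_le_sum fun n hn => ?_
          rw [← sq_abs]
          exact pow_le_pow_left₀ (abs_nonneg _) (ha n (Finset.mem_range.mp hn)) 2
      _ = _ := by rw [Finset.sum_const, Finset.card_range, nsmul_eq_mul]; ring
  refine h1.trans ?_
  rw [← Finset.mul_sum, mul_assoc]
  refine mul_le_mul_of_nonneg_left (h2.trans ?_) (by norm_num)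
  have h3 : (∑ q ∈ P, q * vr q M a) * ∑ q ∈ P, q * vr q N b ≤
      (L ^ 2) ^ 2 * ((M * N) * ((M + K) * (N + K))) := by
    refine (mul_le_mul (hs M a ha) (hs N b hb) (Finset.sum_nonneg fun q _ =>
      mul_nonneg (by positivity) (hv _ _ _)) (by positivity)).trans (le_of_eq ?_)
    ring
  refine (Real.sqrt_le_sqrt h3).trans (le_of_eq ?_)
  rw [Real.sqrt_mul (by positivity), Real.sqrt_sq (by positivity)]

theorem type_two (x V Y r Q : ℕ) (hQ : 0 < Q) (P : Finset ℕ) (hP : ∀ q ∈ P, q.Prime)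
    (hPQ : ∀ q ∈ P, q ≤ Q) (a b : ℕ → ℝ) (L : ℝ) (hL : 0 ≤ L) (ha : ∀ m ≤ x, |a m| ≤ L)
    (hb : ∀ n ≤ x, |b n| ≤ L) (hV : 2 ^ r ≤ V) (hY : Y * Y ≤ x) :
    ∑ q ∈ P, (q : ℝ) * |∑ m ∈ Finset.Ioc V Y, ∑ n ∈ Finset.Ioc 0 (x / m),
        a m * b n * kap q (m * n)| ≤
      (Nat.log 2 x + 1) * 2 ^ (r + 1) * (2 * L ^ 2 * Real.sqrt ((2 * x) *
        (2 * x + 2 * (Q : ℝ) ^ 2 * (1 + 2 * Real.log Q) * (4 * x / V) +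
          (2 * (Q : ℝ) ^ 2 * (1 + 2 * Real.log Q)) ^ 2))) +
      2 * L ^ 2 * Q * (x * (1 + Real.log x) / 2 ^ r + Y * (1 + Q)) := by
  have hlogQ : 0 ≤ Real.log Q := Real.log_natCast_nonneg Q
  have hV0 : 0 < V := lt_of_lt_of_le (by positivity) hV
  set S := Finset.Ioc V Y with hS
  have hSm : ∀ m ∈ S, V < m ∧ m ≤ Y := fun m hm => Finset.mem_Ioc.mp hm
  have hYx : Y ≤ x := (Nat.le_mul_self Y).trans hY
  set I := S.image (tau r) with hI
  set aT : ℕ → ℕ → ℝ := fun T m => if m ∈ S ∧ tau r m = T then a m else 0 with haT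
  have hqp : ∀ q ∈ P, (0 : ℝ) < q := fun q hq => by exact_mod_cast (hP q hq).pos
  have hxm : ∀ m ∈ S, x / tau r m ≤ x / m := fun m hm =>
    Nat.div_le_div_left (lt_tau r m).le (by have := (hSm m hm).1; omega)
  -- decomposition
  have dec : ∀ q ∈ P, ∑ m ∈ S, ∑ n ∈ Finset.Ioc 0 (x / m), a m * b n * kap q (m * n) =
      (∑ T ∈ I, ∑ m ∈ Finset.range T, ∑ n ∈ Finset.range (x / T + 1),
        aT T m * b n * kap q (m * n)) +
      ∑ m ∈ S, ∑ n ∈ Finset.Ioc (x / tau r m) (x / m), a m * b n * kap q (m * n) := by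
    intro q hq
    have e1 : ∀ m ∈ S, ∑ n ∈ Finset.Ioc 0 (x / m), a m * b n * kap q (m * n) =
        ∑ n ∈ Finset.range (x / tau r m + 1), a m * b n * kap q (m * n) +
        ∑ n ∈ Finset.Ioc (x / tau r m) (x / m), a m * b n * kap q (m * n) := by
      intro m hm
      rw [← Finset.sum_Ioc_consecutive _ (Nat.zero_le _) (hxm m hm),
        sum_Ioc_kap q m (x / tau r m) (hP q hq) (fun n => a m * b n)]
    rw [Finset.sum_congr rfl e1, Finset.sum_add_distrib]
    congr 1
    rw [← Finset.sum_fiberwise_of_maps_to (t := I) (g := tau r)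
      (fun m hm => Finset.mem_image_of_mem _ hm)]
    refine Finset.sum_congr rfl fun T hT => ?_
    have e2 : ∑ m ∈ S with tau r m = T, ∑ n ∈ Finset.range (x / tau r m + 1),
        a m * b n * kap q (m * n) = ∑ m ∈ S with tau r m = T,
        ∑ n ∈ Finset.range (x / T + 1), aT T m * b n * kap q (m * n) := by
      refine Finset.sum_congr rfl fun m hm => ?_
      have hm' := Finset.mem_filter.mp hm
      rw [hm'.2]
      refine Finset.sum_congr rfl fun n _ => ?_
      simp only [haT]
      rw [if_pos hm']
    rw [e2]
    refine Finset.sum_subset ?_ ?_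
    · intro m hm
      have hm' := Finset.mem_filter.mp hm
      rw [Finset.mem_range, ← hm'.2]
      exact lt_tau r m
    · intro m _ hm
      rw [Finset.mem_filter] at hm
      refine Finset.sum_eq_zero fun n _ => ?_
      simp only [haT]
      rw [if_neg hm, zero_mul, zero_mul]
  have hrect : ∀ T ∈ I, ∑ q ∈ P, (q : ℝ) * |∑ m ∈ Finset.range T,
      ∑ n ∈ Finset.range (x / T + 1), aT T m * b n * kap q (m * n)| ≤
      2 * L ^ 2 * Real.sqrt ((2 * x) *
        (2 * x + 2 * (Q : ℝ) ^ 2 * (1 + 2 * Real.log Q) * (4 * x / V) +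
          (2 * (Q : ℝ) ^ 2 * (1 + 2 * Real.log Q)) ^ 2)) := by
    intro T hT
    obtain ⟨m, hm, hmT⟩ := Finset.mem_image.mp hT
    have hmS := hSm m hm
    have hT2 : T ≤ 2 * m := hmT ▸ tau_le_two r m (hV.trans hmS.1.le)
    have hTm : m < T := hmT ▸ lt_tau r m
    have hVm : V * m ≤ x := (Nat.mul_le_mul (hmS.1.le.trans hmS.2) hmS.2).trans hY
    have h2m : 2 * m ≤ x ∨ x < 2 * m := le_or_gt _ _
    have hmm : m * m ≤ x := (Nat.mul_le_mul hmS.2 hmS.2).trans hY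
    have hm2 : 2 ≤ m := by omega
    have hTx : T ≤ x := by nlinarith
    have hT0 : 0 < T := by omega
    refine (rect Q T (x / T + 1) hQ P hP hPQ (aT T) b L hL ?_ ?_).trans ?_
    · intro m _
      simp only [haT]
      split_ifs with h
      · exact ha m ((hSm m h.1).2.trans hYx)
      · rwa [abs_zero]
    · intro n hn
      have h1 : x / T ≤ x / 2 := Nat.div_le_div_left (by omega) (by norm_num)
      exact hb n (by omega)
    · set K : ℝ := 2 * (Q : ℝ) ^ 2 * (1 + 2 * Real.log Q) with hK
      have hK0 : 0 ≤ K := by positivity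
      have hT0' : (0 : ℝ) < T := by exact_mod_cast hT0
      have hV0' : (0 : ℝ) < V := by exact_mod_cast hV0
      have hN : (((x / T + 1 : ℕ)) : ℝ) ≤ 2 * x / T := by
        have h1 : ((x / T : ℕ) : ℝ) ≤ (x : ℝ) / T := Nat.cast_div_le
        have h2 : (1 : ℝ) ≤ (x : ℝ) / T := by
          rw [le_div_iff₀ hT0', one_mul]; exact_mod_cast hTx
        push_cast
        rw [mul_div_assoc]; linarith
      set N : ℝ := (((x / T + 1 : ℕ)) : ℝ)
      have hN0 : 0 ≤ N := by positivity
      have hTN : (T : ℝ) * N ≤ 2 * x := by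
        rw [le_div_iff₀ hT0'] at hN; linarith
      have hTV : (T : ℝ) ≤ 2 * x / V := by
        rw [le_div_iff₀ hV0']
        have : T * V ≤ 2 * x := by nlinarith
        exact_mod_cast this
      have hNV : N ≤ 2 * x / V := by
        refine hN.trans ?_
        have : (V : ℝ) ≤ T := by exact_mod_cast (hmS.1.le.trans hTm.le)
        gcongr
      refine mul_le_mul_of_nonneg_left (Real.sqrt_le_sqrt ?_) (by positivity)
      refine mul_le_mul hTN ?_ (by positivity) (by positivity)
      have e : ((T : ℝ) + K) * (N + K) = T * N + K * (T + N) + K ^ 2 := by ring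
      have e2 : (4 * x / V : ℝ) = 2 * x / V + 2 * x / V := by ring
      rw [e, e2]
      gcongr
  have hbd : ∑ q ∈ P, (q : ℝ) * |∑ m ∈ S, ∑ n ∈ Finset.Ioc (x / tau r m) (x / m),
      a m * b n * kap q (m * n)| ≤
      2 * L ^ 2 * Q * (x * (1 + Real.log x) / 2 ^ r + Y * (1 + Q)) := by
    have hlen : ∀ m ∈ S, ((x / m - x / tau r m : ℕ) : ℝ) ≤ x * (1 / m) / 2 ^ r + 1 := by
      intro m hm
      have hmS := hSm m hm
      have hm0 : (0 : ℝ) < m := by exact_mod_cast (by omega : 0 < m)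
      have hlt : (m : ℝ) < tau r m := by exact_mod_cast lt_tau r m
      have h1 : ((x / m : ℕ) : ℝ) ≤ (x : ℝ) / m := Nat.cast_div_le
      have h2 : (x : ℝ) / tau r m ≤ ((x / tau r m : ℕ) : ℝ) + 1 := by
        rw [div_le_iff₀ (hm0.trans hlt)]
        have := (Nat.lt_mul_div_succ x (show 0 < tau r m by have := lt_tau r m; omega)).le
        rw [mul_comm]
        exact_mod_cast this
      rw [Nat.cast_sub (hxm m hm)]
      have h3 : (x : ℝ) / m - x / tau r m ≤ x * (1 / m) / 2 ^ r := by
        have h4 : tau r m * 2 ^ r ≤ m * 2 ^ r + m := by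
          calc tau r m * 2 ^ r ≤ (m + 2 ^ (Nat.log 2 m - r)) * 2 ^ r :=
                Nat.mul_le_mul_right _ (tau_le r m)
            _ ≤ _ := by
              rw [add_mul]
              have := pow_log_sub r m (hV.trans hmS.1.le)
              omega
        have h4' : (tau r m : ℝ) * 2 ^ r ≤ m * 2 ^ r + m := by exact_mod_cast h4
        have ht0 := hm0.trans hlt
        have h5 : (1 : ℝ) / m - 1 / tau r m ≤ (1 / m) / 2 ^ r := by
          rw [div_sub_div _ _ hm0.ne' ht0.ne', div_div, div_le_div_iff₀ (by positivity) (by positivity)]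
          have : (tau r m - m : ℝ) * 2 ^ r ≤ tau r m := by nlinarith
          nlinarith
        calc (x : ℝ) / m - x / tau r m = x * (1 / m - 1 / tau r m) := by ring
          _ ≤ x * ((1 / m) / 2 ^ r) := mul_le_mul_of_nonneg_left h5 (by positivity)
          _ = _ := by ring
      linarith
    have hq1 : ∀ q ∈ P, (q : ℝ) * |∑ m ∈ S, ∑ n ∈ Finset.Ioc (x / tau r m) (x / m),
        a m * b n * kap q (m * n)| ≤
        ∑ m ∈ S, 2 * L ^ 2 * (x * (1 / m) / 2 ^ r + 1 + Q) := by
      intro q hq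
      rw [← abs_of_pos (hqp q hq), ← abs_mul, Finset.mul_sum]
      refine (Finset.abs_sum_le_sum_abs _ _).trans (Finset.sum_le_sum fun m hm => ?_)
      rw [abs_mul, abs_of_pos (hqp q hq)]
      have hmS := hSm m hm
      have h1 : |∑ n ∈ Finset.Ioc (x / tau r m) (x / m), a m * b n * kap q (m * n)| ≤
          L ^ 2 * (2 * (((x / m - x / tau r m : ℕ) : ℝ) / q + 1)) := by
        have h2 := interval_abs_kap (hP q hq) m (x / tau r m + 1) (x / m - x / tau r m)
        have h3 : Finset.Ico (x / tau r m + 1) (x / tau r m + 1 + (x / m - x / tau r m)) =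
            Finset.Ioc (x / tau r m) (x / m) := by
          have := hxm m hm
          ext n; rw [Finset.mem_Ico, Finset.mem_Ioc]; omega
        rw [h3] at h2
        refine (Finset.abs_sum_le_sum_abs _ _).trans ?_
        refine le_trans ?_ (mul_le_mul_of_nonneg_left h2 (sq_nonneg L))
        rw [Finset.mul_sum]
        refine Finset.sum_le_sum fun n hn => ?_
        have hn' := (Finset.mem_Ioc.mp hn).2
        rw [abs_mul, abs_mul, sq]
        refine mul_le_mul_of_nonneg_right ?_ (abs_nonneg _)
        exact mul_le_mul (ha m (hmS.2.trans hYx)) (hb n (hn'.trans (Nat.div_le_self _ _)))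
          (abs_nonneg _) hL
      refine (mul_le_mul_of_nonneg_left h1 (hqp q hq).le).trans ?_
      have hl := hlen m hm
      have hqQ : (q : ℝ) ≤ Q := by exact_mod_cast hPQ q hq
      have hq0 := hqp q hq
      have e : (q : ℝ) * (L ^ 2 * (2 * (((x / m - x / tau r m : ℕ) : ℝ) / q + 1))) =
          2 * L ^ 2 * (((x / m - x / tau r m : ℕ) : ℝ) + q) := by
        field_simp
      rw [e]
      gcongr
    have hcard : (P.card : ℝ) ≤ Q := by
      have : P ⊆ Finset.Icc 1 Q := fun q hq =>
        Finset.mem_Icc.mpr ⟨(hP q hq).one_le, hPQ q hq⟩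
      have := Finset.card_le_card this
      rw [Nat.card_Icc] at this
      exact_mod_cast (by omega : P.card ≤ Q)
    refine (Finset.sum_le_card_nsmul _ _ _ hq1).trans ?_
    have hlogx : 0 ≤ Real.log x := Real.log_natCast_nonneg x
    rw [nsmul_eq_mul, ← Finset.mul_sum]
    have hsum : ∑ m ∈ S, ((x : ℝ) * (1 / m) / 2 ^ r + 1 + Q) ≤
        x * (1 + Real.log x) / 2 ^ r + Y * (1 + Q) := by
      simp only [add_assoc]
      rw [Finset.sum_add_distrib]
      refine add_le_add ?_ ?_
      · rw [← Finset.sum_div, ← Finset.mul_sum]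
        have h1 : ∑ m ∈ S, (1 : ℝ) / m ≤ 1 + Real.log x := by
          have h2 := harmonic_le_one_add_log x
          refine le_trans ?_ h2
          rw [harmonic_eq_sum_Icc]
          push_cast
          simp only [one_div]
          refine Finset.sum_le_sum_of_subset_of_nonneg ?_ (fun _ _ _ => by positivity)
          intro m hm
          have := hSm m hm
          exact Finset.mem_Icc.mpr (by omega)
        gcongr
      · rw [Finset.sum_const, nsmul_eq_mul]
        refine mul_le_mul_of_nonneg_right ?_ (by positivity)
        rw [hS, Nat.card_Ioc]
        exact_mod_cast Nat.sub_le _ _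
    calc (P.card : ℝ) * (2 * L ^ 2 * ∑ m ∈ S, ((x : ℝ) * (1 / m) / 2 ^ r + 1 + Q))
        ≤ Q * (2 * L ^ 2 * (x * (1 + Real.log x) / 2 ^ r + Y * (1 + Q))) := by
          gcongr
      _ = _ := by ring
  calc _ ≤ ∑ q ∈ P, ((∑ T ∈ I, (q : ℝ) * |∑ m ∈ Finset.range T,
        ∑ n ∈ Finset.range (x / T + 1), aT T m * b n * kap q (m * n)|) +
        (q : ℝ) * |∑ m ∈ S, ∑ n ∈ Finset.Ioc (x / tau r m) (x / m),
          a m * b n * kap q (m * n)|) := by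
        refine Finset.sum_le_sum fun q hq => ?_
        rw [dec q hq, ← Finset.mul_sum, ← mul_add]
        refine mul_le_mul_of_nonneg_left ?_ (hqp q hq).le
        exact (abs_add_le _ _).trans (by gcongr; exact Finset.abs_sum_le_sum_abs _ _)
    _ ≤ _ := by
        rw [Finset.sum_add_distrib, Finset.sum_comm]
        refine add_le_add ((Finset.sum_le_card_nsmul _ _ _ hrect).trans ?_) hbd
        rw [nsmul_eq_mul]
        refine mul_le_mul_of_nonneg_right ?_ (by positivity)
        have := card_tau r x S (fun m hm => ⟨hV.trans (hSm m hm).1.le, (hSm m hm).2.trans hYx⟩)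
        exact_mod_cast this

end CG

namespace CG

theorem sum_hyp (N : ℕ) (F : ℕ → ℕ → ℝ) :
    ∑ m ∈ Finset.Ioc 0 N, ∑ n ∈ Finset.Ioc 0 (N / m), F m n =
      ∑ m ∈ Finset.Ioc 0 N, ∑ n ∈ Finset.Ioc 0 N, if m * n ≤ N then F m n else 0 := by
  refine Finset.sum_congr rfl fun m hm => ?_
  have hm' := Finset.mem_Ioc.mp hm
  rw [← Finset.sum_filter]
  refine Finset.sum_congr ?_ fun _ _ => rfl
  ext n
  rw [Finset.mem_filter, Finset.mem_Ioc, Finset.mem_Ioc, Nat.le_div_iff_mul_le hm'.1, mul_comm n m]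
  constructor
  · intro h
    refine ⟨⟨h.1, ?_⟩, h.2⟩
    nlinarith
  · intro h; exact ⟨h.1.1, h.2⟩

theorem conv_sum (f g : ArithmeticFunction ℝ) (k : ℕ → ℝ) (N : ℕ) :
    ∑ n ∈ Finset.Ioc 0 N, (f * g) n * k n =
      ∑ m ∈ Finset.Ioc 0 N, ∑ n ∈ Finset.Ioc 0 (N / m), f m * (g n * k (m * n)) := by
  rw [sum_hyp]
  simp only [ArithmeticFunction.mul_apply]
  have h1 : ∀ n ∈ Finset.Ioc 0 N, (∑ x ∈ n.divisorsAntidiagonal, f x.1 * g x.2) * k n =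
      ∑ m ∈ Finset.Ioc 0 N, ∑ l ∈ Finset.Ioc 0 N,
        if m * l = n then f m * (g l * k (m * l)) else 0 := by
    intro n hn
    have hn' := Finset.mem_Ioc.mp hn
    rw [Nat.divisorsAntidiagonal_eq_prod_filter_of_le hn'.1.ne' hn'.2, Finset.sum_mul,
      Finset.sum_filter, Finset.sum_product]
    refine Finset.sum_congr rfl fun m _ => Finset.sum_congr rfl fun l _ => ?_
    split_ifs with h
    · simp only at h
      rw [← h]; ring
    · rfl
  rw [Finset.sum_congr rfl h1, Finset.sum_comm]
  refine Finset.sum_congr rfl fun m hm => ?_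
  rw [Finset.sum_comm]
  refine Finset.sum_congr rfl fun l hl => ?_
  rw [Finset.sum_ite_eq]
  have hm' := Finset.mem_Ioc.mp hm
  have hl' := Finset.mem_Ioc.mp hl
  have : 0 < m * l := Nat.mul_pos hm'.1 hl'.1
  simp [Finset.mem_Ioc, this]

/-- truncation -/
noncomputable def lo (V : ℕ) (f : ArithmeticFunction ℝ) : ArithmeticFunction ℝ :=
  ⟨fun n => if n ≤ V then f n else 0, by simp⟩

theorem lo_apply (V : ℕ) (f : ArithmeticFunction ℝ) (n : ℕ) :
    lo V f n = if n ≤ V then f n else 0 := rfl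

noncomputable def hi (V : ℕ) (f : ArithmeticFunction ℝ) : ArithmeticFunction ℝ :=
  ⟨fun n => if n ≤ V then 0 else f n, by simp⟩

theorem hi_apply (V : ℕ) (f : ArithmeticFunction ℝ) (n : ℕ) :
    hi V f n = if n ≤ V then 0 else f n := rfl

theorem lo_add_hi (V : ℕ) (f : ArithmeticFunction ℝ) : lo V f + hi V f = f := by
  ext n
  rw [ArithmeticFunction.add_apply, lo_apply, hi_apply]
  split_ifs <;> simp

noncomputable def mu : ArithmeticFunction ℝ := (ArithmeticFunction.moebius : ArithmeticFunction ℝ)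

noncomputable def zt : ArithmeticFunction ℝ := (ArithmeticFunction.zeta : ArithmeticFunction ℝ)

noncomputable abbrev vM : ArithmeticFunction ℝ := ArithmeticFunction.vonMangoldt

theorem vaughan (V : ℕ) : vM = lo V vM + lo V mu * ArithmeticFunction.log -
    lo V vM * (lo V mu * zt) + hi V mu * (hi V vM * zt) := by
  have h1 : mu * zt = 1 := ArithmeticFunction.coe_moebius_mul_coe_zeta
  have h2 : vM * zt = ArithmeticFunction.log := ArithmeticFunction.vonMangoldt_mul_zeta
  have h3 := lo_add_hi V mu
  have h4 := lo_add_hi V vM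
  rw [← h2]
  generalize lo V mu = M1 at *
  generalize hi V mu = M2 at *
  generalize lo V vM = L1 at *
  generalize hi V vM = L2 at *
  rw [← h3] at h1
  rw [← h4]
  linear_combination (-L2) * h1

theorem abs_mu_le (n : ℕ) : |mu n| ≤ 1 := by
  have := ArithmeticFunction.abs_moebius_le_one (n := n)
  rw [mu, ArithmeticFunction.intCoe_apply]
  exact_mod_cast this

theorem hi_zt_apply (V n : ℕ) : (hi V vM * zt) n = ∑ d ∈ n.divisors, hi V vM d := by
  rw [zt, ArithmeticFunction.coe_mul_zeta_apply]

theorem hi_zt_zero (V n : ℕ) (h : n ≤ V) : (hi V vM * zt) n = 0 := by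
  rw [hi_zt_apply]
  refine Finset.sum_eq_zero fun d hd => ?_
  rw [hi_apply, if_pos ((Nat.divisor_le hd).trans h)]

theorem abs_hi_zt (V n : ℕ) : |(hi V vM * zt) n| ≤ Real.log n := by
  have h0 : ∀ d, 0 ≤ hi V vM d := by
    intro d; rw [hi_apply]; split_ifs
    · rfl
    · exact ArithmeticFunction.vonMangoldt_nonneg
  rw [hi_zt_apply, abs_of_nonneg (Finset.sum_nonneg fun d _ => h0 d),
    ← ArithmeticFunction.vonMangoldt_sum]
  refine Finset.sum_le_sum fun d _ => ?_
  rw [hi_apply]; split_ifs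
  · exact ArithmeticFunction.vonMangoldt_nonneg
  · rfl

theorem trunc_sum (N V : ℕ) (F : ℕ → ℝ) (c : ℝ) (hc : 0 ≤ c) (h1 : ∀ m ∈ Finset.Ioc 0 N, m ≤ V → |F m| ≤ c)
    (h2 : ∀ m, V < m → F m = 0) : |∑ m ∈ Finset.Ioc 0 N, F m| ≤ V * c := by
  refine (Finset.abs_sum_le_sum_abs _ _).trans ?_
  calc ∑ m ∈ Finset.Ioc 0 N, |F m| ≤ ∑ m ∈ Finset.Ioc 0 N, (if m ≤ V then c else 0) := by
        refine Finset.sum_le_sum fun m hm => ?_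
        split_ifs with h
        · exact h1 m hm h
        · rw [h2 m (not_le.mp h), abs_zero]
    _ ≤ _ := by
        rw [← Finset.sum_filter, Finset.sum_const, nsmul_eq_mul]
        refine mul_le_mul_of_nonneg_right ?_ hc
        have : (Finset.Ioc 0 N).filter (fun m => m ≤ V) ⊆ Finset.Ioc 0 V := by
          intro m hm
          have := Finset.mem_filter.mp hm
          exact Finset.mem_Ioc.mpr ⟨(Finset.mem_Ioc.mp this.1).1, this.2⟩
        have := Finset.card_le_card this
        rw [Nat.card_Ioc] at this
        exact_mod_cast this

theorem abs_kap_le_one {q : ℕ} (hq : q.Prime) (n : ℕ) : |kap q n| ≤ 1 := by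
  have h1 := interval_abs_kap hq 1 n 0
  have h2 : (2:ℝ) ≤ q := by exact_mod_cast hq.two_le
  have h3 : (1 : ℝ) / (q - 1) ≤ 1 := by rw [div_le_one (by linarith)]; linarith
  have h4 : (0 : ℝ) ≤ 1 / (q - 1) := div_nonneg (by norm_num) (by linarith)
  rw [kap, abs_le]
  split_ifs <;> constructor <;> linarith

theorem type_one_total {q : ℕ} (hq : q.Prime) (x V : ℕ) :
    |∑ n ∈ Finset.Ioc 0 x, (lo V vM + lo V mu * ArithmeticFunction.log -
      lo V vM * (lo V mu * zt)) n * kap q n| ≤ 7 * V ^ 2 * Real.log x := by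
  have hlx : 0 ≤ Real.log x := Real.log_natCast_nonneg x
  have hlog : ∀ m ∈ Finset.Ioc 0 x, Real.log m ≤ Real.log x := fun m hm => by
    have := Finset.mem_Ioc.mp hm
    exact Real.log_le_log (by exact_mod_cast this.1) (by exact_mod_cast this.2)
  have hlov : ∀ m ∈ Finset.Ioc 0 x, |lo V vM m| ≤ Real.log x := fun m hm => by
    rw [lo_apply]; split_ifs
    · rw [abs_of_nonneg ArithmeticFunction.vonMangoldt_nonneg]
      exact ArithmeticFunction.vonMangoldt_le_log.trans (hlog m hm)
    · rwa [abs_zero]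
  have hmu : ∀ m, |lo V mu m| ≤ 1 := fun m => by
    rw [lo_apply]; split_ifs
    · exact abs_mu_le m
    · rw [abs_zero]; norm_num
  have hz : ∀ f : ArithmeticFunction ℝ, ∀ m, V < m → lo V f m = 0 := fun f m hm => by
    rw [lo_apply, if_neg (not_le.mpr hm)]
  have t1 : |∑ n ∈ Finset.Ioc 0 x, lo V vM n * kap q n| ≤ V * Real.log x := by
    refine trunc_sum x V _ _ hlx ?_ ?_
    · intro m hm _
      rw [abs_mul, ← mul_one (Real.log x)]
      exact mul_le_mul (hlov m hm) (abs_kap_le_one hq m) (abs_nonneg _) hlx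
    · intro m hm; rw [hz _ m hm, zero_mul]
  have t2 : |∑ n ∈ Finset.Ioc 0 x, (lo V mu * ArithmeticFunction.log) n * kap q n| ≤
      V * (4 * Real.log x) := by
    rw [conv_sum]
    simp only [← Finset.mul_sum]
    refine trunc_sum x V _ _ (by positivity) ?_ ?_
    · intro m hm _
      rw [abs_mul, ← one_mul (4 * Real.log x)]
      refine mul_le_mul (hmu m) ?_ (abs_nonneg _) (by norm_num)
      refine (typeI_log hq m (x / m)).trans ?_
      rcases Nat.eq_zero_or_pos (x / m) with h | h
      · rw [h]; simpa using hlx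
      · have : ((x / m : ℕ) : ℝ) ≤ x := by exact_mod_cast Nat.div_le_self x m
        have := Real.log_le_log (by exact_mod_cast h) this
        linarith
    · intro m hm; rw [hz _ m hm, zero_mul]
  have t3 : |∑ n ∈ Finset.Ioc 0 x, (lo V vM * (lo V mu * zt)) n * kap q n| ≤
      V * (Real.log x * (V * 2)) := by
    rw [conv_sum]
    simp only [← Finset.mul_sum]
    refine trunc_sum x V _ _ (by positivity) ?_ ?_
    · intro m hm _
      rw [abs_mul]
      refine mul_le_mul (hlov m hm) ?_ (abs_nonneg _) hlx
      rw [conv_sum (lo V mu) zt (fun n => kap q (m * n))]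
      simp only [← Finset.mul_sum]
      refine trunc_sum _ V _ _ (by positivity) ?_ ?_
      · intro l hl _
        rw [abs_mul, ← one_mul (2 : ℝ)]
        refine mul_le_mul (hmu l) ?_ (abs_nonneg _) (by norm_num)
        have e : ∀ n ∈ Finset.Ioc 0 (x / m / l), zt n * kap q (m * (l * n)) = kap q ((m * l) * n) := by
          intro n hn
          have := (Finset.mem_Ioc.mp hn).1
          rw [zt, ArithmeticFunction.natCoe_apply, ArithmeticFunction.zeta_apply_ne this.ne',
            Nat.cast_one, one_mul, mul_assoc]
        rw [Finset.sum_congr rfl e]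
        exact typeI_one hq (m * l) _
      · intro m hm; rw [hz _ m hm, zero_mul]
    · intro m hm; rw [hz _ m hm, zero_mul]
  have e : ∑ n ∈ Finset.Ioc 0 x, (lo V vM + lo V mu * ArithmeticFunction.log -
      lo V vM * (lo V mu * zt)) n * kap q n =
      ∑ n ∈ Finset.Ioc 0 x, lo V vM n * kap q n +
      ∑ n ∈ Finset.Ioc 0 x, (lo V mu * ArithmeticFunction.log) n * kap q n -
      ∑ n ∈ Finset.Ioc 0 x, (lo V vM * (lo V mu * zt)) n * kap q n := by
    rw [← Finset.sum_add_distrib, ← Finset.sum_sub_distrib]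
    refine Finset.sum_congr rfl fun n _ => ?_
    rw [sub_eq_add_neg, ArithmeticFunction.add_apply, ArithmeticFunction.add_apply,
      ArithmeticFunction.neg_apply]
    ring
  rw [e]
  refine (abs_sub _ _).trans ((add_le_add ((abs_add_le _ _).trans (add_le_add t1 t2)) t3).trans ?_)
  have hV : (V : ℝ) ≤ V ^ 2 := by exact_mod_cast Nat.le_self_pow (by norm_num) V
  nlinarith [mul_le_mul_of_nonneg_right hV hlx]

theorem split_two (q x V Y : ℕ) (hY : Y * Y ≤ x) (hxY : x < (Y + 1) * (Y + 1)) (f g : ℕ → ℝ)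
    (hf : ∀ m ≤ V, f m = 0) (hg : ∀ m ≤ V, g m = 0) :
    ∑ m ∈ Finset.Ioc 0 x, ∑ n ∈ Finset.Ioc 0 (x / m), f m * g n * kap q (m * n) =
      ∑ m ∈ Finset.Ioc V Y, ∑ n ∈ Finset.Ioc 0 (x / m), f m * g n * kap q (m * n) +
      ∑ n ∈ Finset.Ioc V Y, ∑ m ∈ Finset.Ioc 0 (x / n),
        g n * (if Y < m then f m else 0) * kap q (n * m) := by
  have hYx : Y ≤ x := (Nat.le_mul_self Y).trans hY
  have hsub : Finset.Ioc V Y ⊆ Finset.Ioc 0 x := by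
    intro m hm
    have := Finset.mem_Ioc.mp hm
    exact Finset.mem_Ioc.mpr (by omega)
  have e1 : ∑ m ∈ Finset.Ioc V Y, ∑ n ∈ Finset.Ioc 0 (x / m), f m * g n * kap q (m * n) =
      ∑ m ∈ Finset.Ioc 0 x, ∑ n ∈ Finset.Ioc 0 (x / m),
        (if m ≤ Y then f m else 0) * g n * kap q (m * n) := by
    rw [← Finset.sum_subset hsub]
    · refine Finset.sum_congr rfl fun m hm => ?_
      rw [if_pos (Finset.mem_Ioc.mp hm).2]
    · intro m _ hm
      have : m ≤ V ∨ Y < m := by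
        by_contra h
        push Not at h
        exact hm (Finset.mem_Ioc.mpr h)
      refine Finset.sum_eq_zero fun n _ => ?_
      rcases this with h | h
      · rw [hf m h]; simp
      · rw [if_neg (not_le.mpr h)]; simp
  have e2 : ∑ n ∈ Finset.Ioc V Y, ∑ m ∈ Finset.Ioc 0 (x / n),
        g n * (if Y < m then f m else 0) * kap q (n * m) =
      ∑ m ∈ Finset.Ioc 0 x, ∑ n ∈ Finset.Ioc 0 (x / m),
        (if Y < m then f m else 0) * g n * kap q (m * n) := by
    have : ∑ n ∈ Finset.Ioc V Y, ∑ m ∈ Finset.Ioc 0 (x / n),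
        g n * (if Y < m then f m else 0) * kap q (n * m) =
      ∑ n ∈ Finset.Ioc 0 x, ∑ m ∈ Finset.Ioc 0 (x / n),
        g n * (if Y < m then f m else 0) * kap q (n * m) := by
      refine Finset.sum_subset hsub ?_
      intro n hn0 hn
      have : n ≤ V ∨ Y < n := by
        by_contra h
        push Not at h
        exact hn (Finset.mem_Ioc.mpr h)
      refine Finset.sum_eq_zero fun m hm => ?_
      rcases this with h | h
      · rw [hg n h]; simp
      · have hm' := (Finset.mem_Ioc.mp hm).2
        rw [Nat.le_div_iff_mul_le (Finset.mem_Ioc.mp hn0).1] at hm'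
        rw [if_neg]
        · simp
        · intro hlt
          have := Nat.mul_le_mul hlt h
          simp only [Nat.succ_eq_add_one] at this
          omega
    rw [this, sum_hyp, sum_hyp, Finset.sum_comm]
    refine Finset.sum_congr rfl fun m _ => Finset.sum_congr rfl fun n _ => ?_
    rw [mul_comm n m, mul_comm (g n)]
  rw [e1, e2, ← Finset.sum_add_distrib]
  refine Finset.sum_congr rfl fun m _ => ?_
  rw [← Finset.sum_add_distrib]
  refine Finset.sum_congr rfl fun n _ => ?_
  rcases le_or_gt m Y with h | h
  · rw [if_pos h, if_neg (not_lt.mpr h)]; ring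
  · rw [if_neg (not_le.mpr h), if_pos h]; ring

theorem vaughan_bound (x V Y r Q : ℕ) (hx : 0 < x) (hQ : 0 < Q) (P : Finset ℕ)
    (hP : ∀ q ∈ P, q.Prime)
    (hPQ : ∀ q ∈ P, q ≤ Q) (hV : 2 ^ r ≤ V) (hY : Y * Y ≤ x) (hxY : x < (Y + 1) * (Y + 1)) :
    ∑ q ∈ P, (q : ℝ) * |∑ n ∈ Finset.Ioc 0 x, vM n * kap q n| ≤
      Q * (Q * (7 * V ^ 2 * Real.log x)) + 2 * (
      (Nat.log 2 x + 1) * 2 ^ (r + 1) * (2 * (1 + Real.log x) ^ 2 * Real.sqrt ((2 * x) *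
        (2 * x + 2 * (Q : ℝ) ^ 2 * (1 + 2 * Real.log Q) * (4 * x / V) +
          (2 * (Q : ℝ) ^ 2 * (1 + 2 * Real.log Q)) ^ 2))) +
      2 * (1 + Real.log x) ^ 2 * Q * (x * (1 + Real.log x) / 2 ^ r + Y * (1 + Q))) := by
  have hlx : 0 ≤ Real.log x := Real.log_natCast_nonneg x
  set f : ℕ → ℝ := fun m => hi V mu m with hf
  set g : ℕ → ℝ := fun m => (hi V vM * zt) m with hg
  have hfz : ∀ m ≤ V, f m = 0 := fun m hm => by rw [hf]; simp only []; rw [hi_apply, if_pos hm]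
  have hgz : ∀ m ≤ V, g m = 0 := fun m hm => hi_zt_zero V m hm
  have hfb : ∀ m, |f m| ≤ 1 + Real.log x := fun m => by
    have : |f m| ≤ 1 := by
      simp only [hf]
      rw [hi_apply]; split_ifs
      · rw [abs_zero]; norm_num
      · exact abs_mu_le m
    linarith
  have hgb : ∀ m ≤ x, |g m| ≤ 1 + Real.log x := fun m hm => by
    have h1 := abs_hi_zt V m
    have h2 : Real.log m ≤ Real.log x := by
      rcases Nat.eq_zero_or_pos m with h | h
      · rw [h]; simpa using hlx
      · exact Real.log_le_log (by exact_mod_cast h) (by exact_mod_cast hm)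
    simp only [hg]
    linarith
  have hfb' : ∀ m ≤ x, |(if Y < m then f m else 0)| ≤ 1 + Real.log x := fun m _ => by
    split_ifs
    · exact hfb m
    · rw [abs_zero]; linarith
  have T1 := type_two x V Y r Q hQ P hP hPQ f g (1 + Real.log x) (by linarith)
    (fun m _ => hfb m) hgb hV hY
  have T2 := type_two x V Y r Q hQ P hP hPQ g (fun m => if Y < m then f m else 0)
    (1 + Real.log x) (by linarith) hgb hfb' hV hY
  have hq : ∀ q ∈ P, (q : ℝ) * |∑ n ∈ Finset.Ioc 0 x, vM n * kap q n| ≤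
      Q * (7 * V ^ 2 * Real.log x) + ((q : ℝ) * |∑ m ∈ Finset.Ioc V Y,
        ∑ n ∈ Finset.Ioc 0 (x / m), f m * g n * kap q (m * n)| +
      (q : ℝ) * |∑ n ∈ Finset.Ioc V Y, ∑ m ∈ Finset.Ioc 0 (x / n),
        g n * (if Y < m then f m else 0) * kap q (n * m)|) := by
    intro q hq
    have e : ∑ n ∈ Finset.Ioc 0 x, vM n * kap q n =
        ∑ n ∈ Finset.Ioc 0 x, (lo V vM + lo V mu * ArithmeticFunction.log -
          lo V vM * (lo V mu * zt)) n * kap q n +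
        ∑ n ∈ Finset.Ioc 0 x, (hi V mu * (hi V vM * zt)) n * kap q n := by
      rw [← Finset.sum_add_distrib]
      refine Finset.sum_congr rfl fun n _ => ?_
      rw [← add_mul, ← ArithmeticFunction.add_apply, ← vaughan V]
    have e2 : ∑ n ∈ Finset.Ioc 0 x, (hi V mu * (hi V vM * zt)) n * kap q n =
        ∑ m ∈ Finset.Ioc 0 x, ∑ n ∈ Finset.Ioc 0 (x / m), f m * g n * kap q (m * n) := by
      rw [conv_sum]
      simp only [hf, hg, mul_assoc]
    rw [e, e2, split_two q x V Y hY hxY f g hfz hgz, ← mul_add]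
    have hqQ : (q : ℝ) ≤ Q := by exact_mod_cast hPQ q hq
    have t := type_one_total (hP q hq) x V
    refine (mul_le_mul_of_nonneg_left ((abs_add_le _ _).trans
      (add_le_add t (abs_add_le _ _))) (Nat.cast_nonneg q)).trans ?_
    rw [mul_add]
    gcongr
  refine (Finset.sum_le_sum hq).trans ?_
  rw [Finset.sum_add_distrib, Finset.sum_add_distrib, Finset.sum_const, nsmul_eq_mul, two_mul (_ + _)]
  have hcard : (P.card : ℝ) ≤ Q := by
    have : P ⊆ Finset.Icc 1 Q := fun q hq =>
      Finset.mem_Icc.mpr ⟨(hP q hq).one_le, hPQ q hq⟩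
    have := Finset.card_le_card this
    rw [Nat.card_Icc] at this
    exact_mod_cast (by omega : P.card ≤ Q)
  refine add_le_add (mul_le_mul_of_nonneg_right hcard (by positivity)) (add_le_add T1 T2)

end CG

namespace CG

theorem natlog_le (x : ℕ) (hx : 0 < x) : (Nat.log 2 x : ℝ) + 1 ≤ 2 * (1 + Real.log x) := by
  have h1 : (Nat.log 2 x : ℝ) ≤ Real.logb 2 x := Real.natLog_le_logb x 2
  rw [Real.logb, le_div_iff₀ (Real.log_pos (by norm_num))] at h1
  have h2 := Real.log_two_gt_d9
  have h3 : 0 ≤ Real.log x := Real.log_natCast_nonneg x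
  have h4 : (0 : ℝ) ≤ Nat.log 2 x := Nat.cast_nonneg _
  nlinarith

theorem alg_two (ℓ Q R s S : ℝ) (hℓ1 : 1 ≤ ℓ) (hQ : 0 < Q) (hR1 : 1 ≤ R) (hs0 : 0 ≤ s)
    (hS : S = 2 * s ^ 2 + 6 * s ^ 2 * ℓ * Q / R ^ 2 + 8 * ℓ * s * Q ^ 2) :
    Q * (Q * (7 * (R ^ 4) ^ 2 * ℓ)) + 2 * ((2 * ℓ) * (R * 2) * (2 * ℓ ^ 2 * S) +
        2 * ℓ ^ 2 * Q * (s ^ 2 * ℓ / R + s * (Q + Q))) ≤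
      200 * ℓ ^ 4 * (Q ^ 2 * R ^ 8 + R * s ^ 2 + s ^ 2 * Q / R + R * s * Q ^ 2) := by
  have hR0 : 0 < R := by linarith
  calc _ = 7 * ℓ * (Q ^ 2 * R ^ 8) + 32 * ℓ ^ 3 * (R * s ^ 2) + 96 * ℓ ^ 4 * (s ^ 2 * Q / R) +
        128 * ℓ ^ 4 * (R * s * Q ^ 2) + 4 * ℓ ^ 3 * (s ^ 2 * Q / R) + 8 * ℓ ^ 2 * (s * Q ^ 2) := by
        rw [hS]; field_simp; ring
    _ ≤ 7 * ℓ ^ 4 * (Q ^ 2 * R ^ 8) + 32 * ℓ ^ 4 * (R * s ^ 2) + 96 * ℓ ^ 4 * (s ^ 2 * Q / R) +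
        128 * ℓ ^ 4 * (R * s * Q ^ 2) + 4 * ℓ ^ 4 * (s ^ 2 * Q / R) +
        8 * ℓ ^ 4 * (R * s * Q ^ 2) := by
        have l1 : ℓ ≤ ℓ ^ 4 := le_self_pow₀ hℓ1 (by norm_num)
        have l2 : ℓ ^ 2 ≤ ℓ ^ 4 := pow_le_pow_right₀ hℓ1 (by norm_num)
        have l3 : ℓ ^ 3 ≤ ℓ ^ 4 := pow_le_pow_right₀ hℓ1 (by norm_num)
        have l4 : s * Q ^ 2 ≤ R * s * Q ^ 2 := by
          rw [mul_assoc]; exact le_mul_of_one_le_left (by positivity) hR1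
        gcongr
    _ ≤ _ := by
        have p1 : 0 ≤ ℓ ^ 4 * (Q ^ 2 * R ^ 8) := by positivity
        have p2 : 0 ≤ ℓ ^ 4 * (R * s ^ 2) := by positivity
        have p3 : 0 ≤ ℓ ^ 4 * (s ^ 2 * Q / R) := by positivity
        have p4 : 0 ≤ ℓ ^ 4 * (R * s * Q ^ 2) := by positivity
        linarith

set_option maxHeartbeats 1000000 in
theorem simple_bound (x r Q : ℕ) (hQ : 0 < Q) (hQx : Q ≤ x) (P : Finset ℕ)
    (hP : ∀ q ∈ P, q.Prime) (hPQ : ∀ q ∈ P, q ≤ Q) :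
    ∑ q ∈ P, (q : ℝ) * |∑ n ∈ Finset.Ioc 0 x, vM n * kap q n| ≤
      200 * (1 + Real.log x) ^ 4 * ((Q : ℝ) ^ 2 * (2 ^ r) ^ 8 + 2 ^ r * x + x * Q / 2 ^ r +
        2 ^ r * Real.sqrt x * Q ^ 2) := by
  have hx : 0 < x := by omega
  have h1 := vaughan_bound x (2 ^ (4 * r)) (Nat.sqrt x) r Q hx hQ P hP hPQ
    (Nat.pow_le_pow_right (by norm_num) (by omega)) (Nat.sqrt_le x) (Nat.lt_succ_sqrt x)
  refine h1.trans ?_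
  have hlQ : Real.log Q ≤ Real.log x :=
    Real.log_le_log (by exact_mod_cast hQ) (by exact_mod_cast hQx)
  have hlQ0 : 0 ≤ Real.log Q := Real.log_natCast_nonneg Q
  have hsq : ((Nat.sqrt x : ℕ) : ℝ) ≤ Real.sqrt x := Real.nat_sqrt_le_real_sqrt
  have hs2 : Real.sqrt x ^ 2 = x := Real.sq_sqrt (Nat.cast_nonneg x)
  have hQ1 : (1 : ℝ) ≤ Q := by exact_mod_cast hQ
  have hx1 : (1 : ℝ) ≤ x := by exact_mod_cast hx
  have hlog2 := natlog_le x hx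
  have hR1 : (1 : ℝ) ≤ 2 ^ r := one_le_pow₀ (by norm_num)
  push_cast
  rw [pow_mul', pow_succ (2 : ℝ) r]
  set ℓ : ℝ := 1 + Real.log x with hℓ
  have hℓ1 : 1 ≤ ℓ := by linarith
  have hlx : Real.log x ≤ ℓ := by linarith
  set R : ℝ := 2 ^ r
  set s := Real.sqrt x
  set K : ℝ := 2 * (Q : ℝ) ^ 2 * (1 + 2 * Real.log Q) with hK
  have hK0 : 0 ≤ K := by positivity
  have hKl : K ≤ 4 * ℓ * Q ^ 2 := by
    rw [hK]
    nlinarith [sq_nonneg (Q : ℝ)]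
  have hs0 : 0 ≤ s := Real.sqrt_nonneg _
  rw [← hs2]
  set S : ℝ := 2 * s ^ 2 + 6 * s ^ 2 * ℓ * Q / R ^ 2 + 8 * ℓ * s * Q ^ 2 with hS
  have hsqrt : Real.sqrt ((2 * s ^ 2) * (2 * s ^ 2 + K * (4 * s ^ 2 / R ^ 4) + K ^ 2)) ≤ S := by
    refine Real.sqrt_le_iff.mpr ⟨by positivity, ?_⟩
    have e1 : S ^ 2 ≥ (2 * s ^ 2) ^ 2 + (6 * s ^ 2 * ℓ * Q / R ^ 2) ^ 2 +
        (8 * ℓ * s * Q ^ 2) ^ 2 := by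
      have p1 : 0 ≤ 2 * s ^ 2 := by positivity
      have p2 : 0 ≤ 6 * s ^ 2 * ℓ * Q / R ^ 2 := by positivity
      have p3 : 0 ≤ 8 * ℓ * s * Q ^ 2 := by positivity
      nlinarith [mul_nonneg p1 p2, mul_nonneg p1 p3, mul_nonneg p2 p3]
    refine le_trans ?_ e1
    have e2 : 2 * s ^ 2 * (K * (4 * s ^ 2 / R ^ 4)) ≤ (6 * s ^ 2 * ℓ * Q / R ^ 2) ^ 2 := by
      calc 2 * s ^ 2 * (K * (4 * s ^ 2 / R ^ 4)) ≤
          2 * s ^ 2 * ((4 * ℓ * Q ^ 2) * (4 * s ^ 2 / R ^ 4)) := by gcongr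
        _ = 32 * (s ^ 4 * Q ^ 2 / R ^ 4) * ℓ := by ring
        _ ≤ 36 * (s ^ 4 * Q ^ 2 / R ^ 4) * ℓ ^ 2 := by
            have : ℓ ≤ ℓ ^ 2 := by nlinarith
            gcongr; norm_num
        _ = _ := by ring
    have e3 : 2 * s ^ 2 * K ^ 2 ≤ (8 * ℓ * s * Q ^ 2) ^ 2 := by
      calc 2 * s ^ 2 * K ^ 2 ≤ 2 * s ^ 2 * (4 * ℓ * Q ^ 2) ^ 2 := by gcongr
        _ = 32 * (s ^ 2 * ℓ ^ 2 * Q ^ 4) := by ring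
        _ ≤ 64 * (s ^ 2 * ℓ ^ 2 * Q ^ 4) := by gcongr; norm_num
        _ = _ := by ring
    have e4 : 2 * s ^ 2 * (2 * s ^ 2 + K * (4 * s ^ 2 / R ^ 4) + K ^ 2) = (2 * s ^ 2) ^ 2 +
        2 * s ^ 2 * (K * (4 * s ^ 2 / R ^ 4)) + 2 * s ^ 2 * K ^ 2 := by ring
    rw [e4]
    exact add_le_add (add_le_add le_rfl e2) e3
  have hQp : (0 : ℝ) < Q := by linarith
  refine le_trans ?_ (alg_two ℓ (Q : ℝ) R s S hℓ1 hQp hR1 hs0 hS)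
  gcongr
  rw [hs2]
  exact hlx

theorem ev_log_pow (C : ℝ) (k : ℕ) {δ : ℝ} (hδ : 0 < δ) :
    ∀ᶠ x : ℕ in atTop, C * (1 + Real.log x) ^ k ≤ (x : ℝ) ^ δ := by
  have h1 := Real.tendsto_mul_exp_add_div_pow_atTop 1 0 k (by norm_num : (0:ℝ) < 1)
  have h2 : Tendsto (fun x : ℕ => δ * (1 + Real.log x)) atTop atTop :=
    (tendsto_atTop_add_const_left _ 1
      (Real.tendsto_log_atTop.comp tendsto_natCast_atTop_atTop)).const_mul_atTop hδ
  have h3 := (h1.comp h2).eventually_ge_atTop (C * Real.exp δ / δ ^ k)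
  filter_upwards [h3, h2.eventually_gt_atTop 0, eventually_gt_atTop 0] with x hx hp hx0
  simp only [Function.comp, one_mul, add_zero] at hx
  rw [le_div_iff₀ (by positivity), mul_pow] at hx
  have hx0' : (0 : ℝ) < x := by exact_mod_cast hx0
  have e : Real.exp (δ * (1 + Real.log x)) = Real.exp δ * (x : ℝ) ^ δ := by
    rw [Real.rpow_def_of_pos hx0', mul_add, mul_one, Real.exp_add, mul_comm (Real.log _)]
  rw [e] at hx
  have : C * Real.exp δ / δ ^ k * (δ ^ k * (1 + Real.log x) ^ k) =
      Real.exp δ * (C * (1 + Real.log x) ^ k) := by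
    field_simp
  rw [this] at hx
  exact le_of_mul_le_mul_left hx (Real.exp_pos δ)

end CG

namespace CG

theorem err_small {ρ : ℝ} (hρ : 0 < ρ) (hρ2 : ρ < 1 / 2) :
    ∀ᶠ x : ℕ in atTop, ∀ P : Finset ℕ, (∀ q ∈ P, q.Prime) → (∀ q ∈ P, (q : ℝ) ≤ (x : ℝ) ^ ρ) →
      ∑ q ∈ P, (q : ℝ) * |∑ n ∈ Finset.Ioc 0 x, vM n * kap q n| ≤
        x * (x : ℝ) ^ ρ / (100 * (1 + Real.log x)) := by
  set δ : ℝ := min ρ (1 / 2 - ρ) / 16 with hδ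
  have hm1 : min ρ (1 / 2 - ρ) ≤ ρ := min_le_left _ _
  have hm2 : min ρ (1 / 2 - ρ) ≤ 1 / 2 - ρ := min_le_right _ _
  have hm0 : 0 < min ρ (1 / 2 - ρ) := lt_min hρ (by linarith)
  have hδ0 : 0 < δ := by positivity
  filter_upwards [ev_log_pow 100000 5 hδ0, eventually_ge_atTop 1] with x hx hx1 P hP hPQ
  have hx1' : (1 : ℝ) ≤ x := by exact_mod_cast hx1
  have hx0 : (0 : ℝ) < x := by linarith
  set X : ℝ := (x : ℝ) ^ ρ with hX
  have hX1 : 1 ≤ X := Real.one_le_rpow hx1' hρ.le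
  have hXx : X ≤ x := by
    calc X ≤ (x : ℝ) ^ (1 : ℝ) := Real.rpow_le_rpow_of_exponent_le hx1' (by linarith)
      _ = x := Real.rpow_one _
  set Q := ⌊X⌋₊ with hQ
  have hQ0 : 0 < Q := Nat.floor_pos.mpr hX1
  have hQX : (Q : ℝ) ≤ X := Nat.floor_le (by linarith)
  have hQx : Q ≤ x := by exact_mod_cast hQX.trans hXx
  have hD1 : 1 ≤ (x : ℝ) ^ δ := Real.one_le_rpow hx1' hδ0.le
  set r := Nat.log 2 ⌊(x : ℝ) ^ δ⌋₊ with hr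
  have hD0 : ⌊(x : ℝ) ^ δ⌋₊ ≠ 0 := (Nat.floor_pos.mpr hD1).ne'
  have hR1 : (2 : ℝ) ^ r ≤ (x : ℝ) ^ δ := by
    refine le_trans ?_ (Nat.floor_le (by linarith))
    exact_mod_cast Nat.pow_log_le_self 2 hD0
  have hR2 : (x : ℝ) ^ δ ≤ 2 * 2 ^ r := by
    refine (Nat.lt_floor_add_one _).le.trans ?_
    have := Nat.lt_pow_succ_log_self (b := 2) (by norm_num) ⌊(x : ℝ) ^ δ⌋₊
    rw [← hr, pow_succ] at this
    have h2 : ⌊(x : ℝ) ^ δ⌋₊ + 1 ≤ 2 * 2 ^ r := by omega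
    exact_mod_cast h2
  refine (simple_bound x r Q hQ0 hQx P hP (fun q hq => Nat.le_floor (hPQ q hq))).trans ?_
  set ℓ : ℝ := 1 + Real.log x with hℓ
  have hℓ1 : 1 ≤ ℓ := by have := Real.log_natCast_nonneg x; linarith
  set E : ℝ := (x : ℝ) ^ (1 + ρ - δ) with hE
  have hmono : ∀ s : ℝ, s ≤ 1 + ρ - δ → (x : ℝ) ^ s ≤ E := fun s hs =>
    Real.rpow_le_rpow_of_exponent_le hx1' hs
  have b1 : (Q : ℝ) ^ 2 * (2 ^ r) ^ 8 ≤ E := by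
    calc (Q : ℝ) ^ 2 * (2 ^ r) ^ 8 ≤ X ^ 2 * ((x : ℝ) ^ δ) ^ 8 := by gcongr
      _ = (x : ℝ) ^ (ρ * (2 : ℕ) + δ * (8 : ℕ)) := by
          rw [Real.rpow_add hx0, Real.rpow_mul_natCast hx0.le, Real.rpow_mul_natCast hx0.le]
      _ ≤ E := hmono _ (by push_cast; linarith)
  have b2 : (2 : ℝ) ^ r * x ≤ E := by
    calc (2 : ℝ) ^ r * x ≤ (x : ℝ) ^ δ * (x : ℝ) ^ (1 : ℝ) := by rw [Real.rpow_one]; gcongr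
      _ = (x : ℝ) ^ (δ + 1) := by rw [Real.rpow_add hx0]
      _ ≤ E := hmono _ (by linarith)
  have b3 : (x : ℝ) * Q / 2 ^ r ≤ 2 * E := by
    have : E * (x : ℝ) ^ δ = x * X := by
      rw [hE, ← Real.rpow_add hx0, show 1 + ρ - δ + δ = 1 + ρ by ring, Real.rpow_add hx0,
        Real.rpow_one]
    rw [div_le_iff₀ (by positivity)]
    have hE0 : 0 ≤ E := by positivity
    calc (x : ℝ) * Q ≤ x * X := by gcongr
      _ = E * (x : ℝ) ^ δ := this.symm
      _ ≤ E * (2 * 2 ^ r) := by gcongr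
      _ = _ := by ring
  have b4 : (2 : ℝ) ^ r * Real.sqrt x * Q ^ 2 ≤ E := by
    calc (2 : ℝ) ^ r * Real.sqrt x * Q ^ 2 ≤ (x : ℝ) ^ δ * (x : ℝ) ^ (1 / 2 : ℝ) * X ^ 2 := by
          rw [← Real.sqrt_eq_rpow]; gcongr
      _ = (x : ℝ) ^ (δ + 1 / 2 + ρ * (2 : ℕ)) := by
          rw [Real.rpow_add hx0, Real.rpow_add hx0, Real.rpow_mul_natCast hx0.le]
      _ ≤ E := hmono _ (by push_cast; linarith)
  have hEx : E * (x : ℝ) ^ δ = x * X := by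
    rw [hE, ← Real.rpow_add hx0, show 1 + ρ - δ + δ = 1 + ρ by ring, Real.rpow_add hx0,
      Real.rpow_one]
  have hE0 : 0 ≤ E := by positivity
  rw [le_div_iff₀ (by positivity), ← hEx]
  calc 200 * ℓ ^ 4 * ((Q : ℝ) ^ 2 * (2 ^ r) ^ 8 + 2 ^ r * x + x * Q / 2 ^ r +
        2 ^ r * Real.sqrt x * Q ^ 2) * (100 * ℓ) ≤
        200 * ℓ ^ 4 * (E + E + 2 * E + E) * (100 * ℓ) := by gcongr
    _ = E * (100000 * ℓ ^ 5) := by ring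
    _ ≤ _ := by gcongr

theorem many_q {ρ ε : ℝ} (hρ : 0 < ρ) (hρ2 : ρ < 1 / 2) (hε : 0 < ε) :
    ∀ᶠ x : ℕ in atTop, (x : ℝ) ^ ρ / (4 * (1 + Real.log x)) ≤
      ((Finset.Ioc ⌊(x : ℝ) ^ (ρ - ε)⌋₊ ⌊(x : ℝ) ^ ρ⌋₊).filter Nat.Prime).card := by
  filter_upwards [ev_log_pow 10 1 hρ, ev_log_pow 4 1 hε, eventually_ge_atTop 2] with x h1 h2 hx2
  rw [pow_one] at h1 h2
  have hx2' : (2 : ℝ) ≤ x := by exact_mod_cast hx2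
  have hx0 : (0 : ℝ) < x := by linarith
  have hlx : 0 < Real.log x := Real.log_pos (by linarith)
  set ℓ : ℝ := 1 + Real.log x with hℓ
  set X : ℝ := (x : ℝ) ^ ρ with hX
  have hX10 : 10 ≤ X := by linarith
  have hXx : X ≤ x := by
    calc X ≤ (x : ℝ) ^ (1 : ℝ) := Real.rpow_le_rpow_of_exponent_le (by linarith) (by linarith)
      _ = x := Real.rpow_one _
  have hpi := Chebyshev.pi_ge' (x := X) (by linarith)
  have hlX : Real.log X = ρ * Real.log x := Real.log_rpow hx0 ρ
  have hlX0 : 0 < Real.log X := Real.log_pos (by linarith)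
  have hl2 : Real.log (X + 2) ≤ ℓ := by
    have e : ℓ = Real.log (Real.exp 1 * x) := by
      rw [Real.log_mul (Real.exp_pos 1).ne' hx0.ne', Real.log_exp]
    rw [e]
    refine Real.log_le_log (by linarith) ?_
    have := Real.exp_one_gt_d9
    nlinarith
  rw [div_le_iff₀ hlX0] at hpi
  have hlog2 := Real.log_two_gt_d9
  have hpi0 : (0 : ℝ) ≤ (Nat.primeCounting ⌊X⌋₊ : ℝ) := Nat.cast_nonneg _
  have hpi2 : X ≤ (Nat.primeCounting ⌊X⌋₊ : ℝ) * ℓ := by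
    have h3 : Real.log X ≤ ℓ / 2 := by rw [hlX]; nlinarith
    have h4 : (Nat.primeCounting ⌊X⌋₊ : ℝ) * Real.log X ≤
        (Nat.primeCounting ⌊X⌋₊ : ℝ) * (ℓ / 2) := by gcongr
    nlinarith
  set P := (Finset.Ioc ⌊(x : ℝ) ^ (ρ - ε)⌋₊ ⌊X⌋₊).filter Nat.Prime with hP
  have hcard : Nat.primeCounting ⌊X⌋₊ ≤ P.card + ⌊(x : ℝ) ^ (ρ - ε)⌋₊ := by
    rw [Nat.primeCounting, Nat.primeCounting', Nat.count_eq_card_filter_range]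
    have hsub : (Finset.range (⌊X⌋₊ + 1)).filter Nat.Prime ⊆
        P ∪ Finset.Ioc 0 ⌊(x : ℝ) ^ (ρ - ε)⌋₊ := by
      intro p hp
      obtain ⟨hp1, hp2⟩ := Finset.mem_filter.mp hp
      have hp1 := Finset.mem_range.mp hp1
      have := hp2.pos
      rw [Finset.mem_union, hP, Finset.mem_filter, Finset.mem_Ioc, Finset.mem_Ioc]
      by_cases h : p ≤ ⌊(x : ℝ) ^ (ρ - ε)⌋₊
      · right; exact ⟨this, h⟩
      · left; exact ⟨⟨by omega, by omega⟩, hp2⟩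
    refine (Finset.card_le_card hsub).trans ((Finset.card_union_le _ _).trans ?_)
    rw [Nat.card_Ioc, Nat.sub_zero]
  have hcard' : (Nat.primeCounting ⌊X⌋₊ : ℝ) ≤ P.card + (x : ℝ) ^ (ρ - ε) := by
    have h5 : (⌊(x : ℝ) ^ (ρ - ε)⌋₊ : ℝ) ≤ (x : ℝ) ^ (ρ - ε) := Nat.floor_le (by positivity)
    have h6 : (Nat.primeCounting ⌊X⌋₊ : ℝ) ≤ P.card + ⌊(x : ℝ) ^ (ρ - ε)⌋₊ := by
      exact_mod_cast hcard
    linarith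
  have hsplit : (x : ℝ) ^ (ρ - ε) * (4 * ℓ) ≤ X := by
    calc (x : ℝ) ^ (ρ - ε) * (4 * ℓ) ≤ (x : ℝ) ^ (ρ - ε) * (x : ℝ) ^ ε := by gcongr
      _ = X := by rw [← Real.rpow_add hx0, sub_add_cancel]
  have hℓ0 : 0 < ℓ := by linarith
  rw [div_le_iff₀ (by positivity)]
  nlinarith

end CG

namespace CG

theorem ap_count {q x : ℕ} (hq : q.Prime) (hx : 1 ≤ x)
    (hW : (q : ℝ) * |∑ n ∈ Finset.Ioc 0 x, vM n * kap q n| ≤ x / 8)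
    (hψ : (x : ℝ) / 2 ≤ Chebyshev.psi x) (hql : 100 * Real.log x ≤ q) :
    (x : ℝ) / (4 * q) - 2 * Real.sqrt x * Real.log x ≤
      ((Finset.Ioc 0 x).filter (fun p => p.Prime ∧ q ∣ p - 1)).card * Real.log x := by
  have hq2 : (2 : ℝ) ≤ q := by exact_mod_cast hq.two_le
  have hx0 : (0 : ℝ) < x := by exact_mod_cast hx
  have hΛ : ∀ n, 0 ≤ vM n := fun n => ArithmeticFunction.vonMangoldt_nonneg
  have hlx : 0 ≤ Real.log x := Real.log_natCast_nonneg x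
  have hle : ∀ n ∈ Finset.Ioc 0 x, vM n ≤ Real.log x := fun n hn => by
    have := Finset.mem_Ioc.mp hn
    exact ArithmeticFunction.vonMangoldt_le_log.trans
      (Real.log_le_log (by exact_mod_cast this.1) (by exact_mod_cast this.2))
  set A := ∑ n ∈ Finset.Ioc 0 x, if n % q = 1 then vM n else 0 with hA
  set B := ∑ n ∈ Finset.Ioc 0 x, if n % q = 0 then vM n else 0 with hB
  have hpsi : Chebyshev.psi x = ∑ n ∈ Finset.Ioc 0 x, vM n := by
    rw [Chebyshev.psi, Nat.floor_natCast]
  have hth : Chebyshev.theta x = ∑ n ∈ Finset.Ioc 0 x, if n.Prime then vM n else 0 := by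
    rw [Chebyshev.theta, Nat.floor_natCast, Finset.sum_filter]
    refine Finset.sum_congr rfl fun n _ => ?_
    split_ifs with h
    · exact (ArithmeticFunction.vonMangoldt_apply_prime h).symm
    · rfl
  have e : ∑ n ∈ Finset.Ioc 0 x, vM n * kap q n = A - (Chebyshev.psi x - B) / (q - 1) := by
    rw [hpsi, hA, hB, ← Finset.sum_sub_distrib, Finset.sum_div, ← Finset.sum_sub_distrib]
    refine Finset.sum_congr rfl fun n _ => ?_
    rw [kap]
    split_ifs <;> ring
  have hB2 : B ≤ x / 100 := by
    have h1 : B ≤ ((x / q : ℕ) : ℝ) * Real.log x := by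
      rw [hB, ← Nat.Ioc_filter_dvd_card_eq_div, ← Finset.sum_filter, ← nsmul_eq_mul]
      simp only [Nat.dvd_iff_mod_eq_zero]
      exact Finset.sum_le_card_nsmul _ _ _ fun n hn => hle n (Finset.mem_filter.mp hn).1
    have h2 : ((x / q : ℕ) : ℝ) ≤ (x : ℝ) / q := Nat.cast_div_le
    calc B ≤ (x : ℝ) / q * Real.log x := h1.trans (by gcongr)
      _ ≤ (x : ℝ) / q * (q / 100) := by gcongr; linarith
      _ = x / 100 := by field_simp
  have hA2 : (x : ℝ) / (4 * q) ≤ A := by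
    rw [e] at hW
    have h1 := neg_abs_le (A - (Chebyshev.psi x - B) / (q - 1))
    have h2 : |A - (Chebyshev.psi x - B) / (q - 1)| ≤ x / 8 / q := by
      rw [le_div_iff₀ (by linarith), mul_comm]; exact hW
    have h3 : (x : ℝ) * (49 / 100) / q ≤ (Chebyshev.psi x - B) / (q - 1) := by
      have : (x : ℝ) * (49 / 100) ≤ Chebyshev.psi x - B := by linarith
      have hq1 : (0 : ℝ) < q - 1 := by linarith
      have hq3 : (q : ℝ) - 1 ≤ q := by linarith
      gcongr
      linarith
    have h4 : (x : ℝ) / (4 * q) = x * (1 / 4) / q := by ring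
    have h5 : (x : ℝ) / 8 / q = x * (1 / 8) / q := by ring
    have h6 : (x : ℝ) * (1 / 4) / q + x * (1 / 8) / q ≤ x * (49 / 100) / q := by
      rw [← add_div]
      gcongr
      linarith
    linarith
  have hA3 : A ≤ (((Finset.Ioc 0 x).filter (fun p => p.Prime ∧ q ∣ p - 1)).card : ℝ) * Real.log x +
      (Chebyshev.psi x - Chebyshev.theta x) := by
    rw [hpsi, hth, ← nsmul_eq_mul, ← Finset.sum_const, Finset.sum_filter,
      ← Finset.sum_sub_distrib, ← Finset.sum_add_distrib]
    refine Finset.sum_le_sum fun n hn => ?_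
    have h1 := hle n hn
    have h0 := hΛ n
    have hd : n % q = 1 → q ∣ n - 1 := fun h => by
      have := Nat.div_add_mod n q
      rw [h] at this
      exact ⟨n / q, by omega⟩
    by_cases hp : n.Prime
    · by_cases hm : n % q = 1
      · rw [if_pos hm, if_pos ⟨hp, hd hm⟩, if_pos hp]; linarith
      · rw [if_neg hm, if_pos hp]; split_ifs <;> linarith
    · rw [if_neg hp, if_neg (fun h : n.Prime ∧ q ∣ n - 1 => hp h.1)]
      split_ifs <;> linarith
  have h7 := Chebyshev.psi_sub_theta_le (x := (x : ℝ)) (by exact_mod_cast hx)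
  linarith

theorem log_succ_le (y : ℝ) (hy : 2 ≤ y) : Real.log (y + 1) ≤ 1 + Real.log y := by
  have e : 1 + Real.log y = Real.log (Real.exp 1 * y) := by
    rw [Real.log_mul (Real.exp_pos 1).ne' (by linarith), Real.log_exp]
  rw [e]
  refine Real.log_le_log (by linarith) ?_
  have := Real.exp_one_gt_d9
  nlinarith

theorem prime_lemma {ρ ε : ℝ} (hρ : 0 < ρ) (hρ2 : ρ < 1 / 2) (hε : 0 < ε) (hερ : ε < ρ) :
    ∀ᶠ x : ℕ in atTop, ∃ q : ℕ, q.Prime ∧ (x : ℝ) ^ (ρ - ε) ≤ q ∧ (q : ℝ) ≤ (x : ℝ) ^ ρ ∧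
      ∃ P : Finset ℕ, (∀ p ∈ P, p.Prime ∧ p ≤ x ∧ q ∣ p - 1) ∧
        (x : ℝ) ^ (1 - ρ - ε) ≤ P.card := by
  have hh : 0 < 1 / 2 - ρ := by linarith
  filter_upwards [err_small hρ hρ2, many_q hρ hρ2 hε, ev_log_pow 100 1 (sub_pos.mpr hερ),
    ev_log_pow 100 1 hh, ev_log_pow 100 1 hε, ev_log_pow 100 1 (by norm_num : (0:ℝ) < 1),
    eventually_ge_atTop 2] with x h1 h2 h3 h4 h5 h6 hx2
  rw [pow_one] at h3 h4 h5 h6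
  have hx2' : (2 : ℝ) ≤ x := by exact_mod_cast hx2
  have hx0 : (0 : ℝ) < x := by linarith
  have hlx : 0 < Real.log x := Real.log_pos (by linarith)
  set ℓ : ℝ := 1 + Real.log x with hℓ
  set X : ℝ := (x : ℝ) ^ ρ with hX
  have hX0 : 0 < X := by positivity
  set P := (Finset.Ioc ⌊(x : ℝ) ^ (ρ - ε)⌋₊ ⌊X⌋₊).filter Nat.Prime with hP
  have hPm : ∀ q ∈ P, q.Prime ∧ (x : ℝ) ^ (ρ - ε) ≤ q ∧ (q : ℝ) ≤ X := by
    intro q hq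
    obtain ⟨ha, hb⟩ := Finset.mem_filter.mp hq
    obtain ⟨ha1, ha2⟩ := Finset.mem_Ioc.mp ha
    exact ⟨hb, ((Nat.floor_lt (by positivity)).mp ha1).le, (Nat.le_floor_iff hX0.le).mp ha2⟩
  have h7 := h1 P (fun q hq => (hPm q hq).1) (fun q hq => (hPm q hq).2.2)
  have hℓ0 : 0 < ℓ := by linarith
  obtain ⟨q, hq, hqW⟩ : ∃ q ∈ P, (q : ℝ) * |∑ n ∈ Finset.Ioc 0 x, vM n * kap q n| ≤ x / 8 := by
    by_contra hcon
    push Not at hcon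
    have h8 := Finset.card_nsmul_le_sum P _ _ (fun q hq => (hcon q hq).le)
    rw [nsmul_eq_mul] at h8
    have h9 : X / (4 * ℓ) * (x / 8) ≤ x * X / (100 * ℓ) :=
      (mul_le_mul_of_nonneg_right h2 (by positivity)).trans (h8.trans h7)
    have h10 : X / (4 * ℓ) * (x / 8) = (x * X / ℓ) * (1 / 32) := by field_simp; norm_num
    have h11 : x * X / (100 * ℓ) = (x * X / ℓ) * (1 / 100) := by field_simp
    have h12 : 0 < x * X / ℓ := by positivity
    rw [h10, h11] at h9
    linarith
  obtain ⟨hqp, hq1, hq2⟩ := hPm q hq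
  refine ⟨q, hqp, hq1, hq2, (Finset.Ioc 0 x).filter (fun p => p.Prime ∧ q ∣ p - 1), ?_, ?_⟩
  · intro p hp
    obtain ⟨ha, hb⟩ := Finset.mem_filter.mp hp
    exact ⟨hb.1, (Finset.mem_Ioc.mp ha).2, hb.2⟩
  · have hψ : (x : ℝ) / 2 ≤ Chebyshev.psi x := by
      refine le_trans ?_ (Chebyshev.psi_ge x)
      have hlog2 := Real.log_two_gt_d9
      have hl1 : Real.log ((x : ℝ) + 1) ≤ ℓ := log_succ_le x hx2'
      rw [Real.rpow_one] at h6
      nlinarith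
    have h8 := ap_count hqp (by omega) hqW hψ (by linarith)
    have hq0 : (0 : ℝ) < q := by exact_mod_cast hqp.pos
    set c : ℝ := (((Finset.Ioc 0 x).filter (fun p => p.Prime ∧ q ∣ p - 1)).card : ℝ)
    set Z : ℝ := (x : ℝ) ^ (1 - ρ) with hZ
    have hZ1 : Z / 4 ≤ x / (4 * q) := by
      have : Z * X = x := by
        rw [hZ, hX, ← Real.rpow_add hx0, sub_add_cancel, Real.rpow_one]
      rw [div_le_div_iff₀ (by norm_num) (by positivity)]
      have hZ0 : 0 ≤ Z := by positivity
      nlinarith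
    have hZ2 : Real.sqrt x * (100 * ℓ) ≤ Z := by
      calc Real.sqrt x * (100 * ℓ) ≤ (x : ℝ) ^ (1 / 2 : ℝ) * (x : ℝ) ^ (1 / 2 - ρ) := by
            rw [← Real.sqrt_eq_rpow]; gcongr
        _ = Z := by rw [← Real.rpow_add hx0, hZ]; congr 1; ring
    have hZ3 : (x : ℝ) ^ (1 - ρ - ε) * (100 * ℓ) ≤ Z := by
      calc (x : ℝ) ^ (1 - ρ - ε) * (100 * ℓ) ≤ (x : ℝ) ^ (1 - ρ - ε) * (x : ℝ) ^ ε := by gcongr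
        _ = Z := by rw [← Real.rpow_add hx0, hZ]; congr 1; ring
    have hs : Real.sqrt x * Real.log x ≤ Real.sqrt x * ℓ := by gcongr; linarith
    have hw : 0 ≤ (x : ℝ) ^ (1 - ρ - ε) := by positivity
    have hw2 : (x : ℝ) ^ (1 - ρ - ε) * Real.log x ≤ (x : ℝ) ^ (1 - ρ - ε) * ℓ := by gcongr; linarith
    have : (x : ℝ) ^ (1 - ρ - ε) * Real.log x ≤ c * Real.log x := by nlinarith
    exact le_of_mul_le_mul_right this hlx

end CG

namespace CG

set_option maxHeartbeats 4000000 in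
theorem lower_one {d : ℕ} (hd : 2 ≤ d) {r ε κ A : ℝ} (hr : 0 < r) (hr2 : r < 1 / 2) (hε : 0 < ε)
    (hεr : ε < r) (hκ0 : 0 < κ) (hκ : κ = 1 - r - 2 * ε) (hA : A = (d : ℝ) / 2 + r ^ 2 + ε) :
    ∀ᶠ n : ℕ in atTop, 0 ≤ 1 / A - d * ((Real.log (Real.log n) / κ + 1) / Real.log n) →
      0 ≤ r * (1 / A - d * ((Real.log (Real.log n) / κ + 1) / Real.log n)) -
        (Real.log (Real.log n) / κ + 1) / Real.log n →
      (r * (1 / A - d * ((Real.log (Real.log n) / κ + 1) / Real.log n)) -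
        (Real.log (Real.log n) / κ + 1) / Real.log n) *
      ((1 - r) * (1 / A - d * ((Real.log (Real.log n) / κ + 1) / Real.log n))) *
      ((r - ε) * (Real.log (Real.log n) / (Real.log (Real.log n) / κ + 1))) ≤
      Real.log (congCount d n) / ((Real.log n) ^ 2 / Real.log (Real.log n)) := by
  have hlog : Tendsto (fun n : ℕ => Real.log n) atTop atTop :=
    Real.tendsto_log_atTop.comp tendsto_natCast_atTop_atTop
  have hloglog : Tendsto (fun n : ℕ => Real.log (Real.log n)) atTop atTop :=
    Real.tendsto_log_atTop.comp hlog
  have hpow : Tendsto (fun n : ℕ => (Real.log n) ^ (1 / κ)) atTop atTop :=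
    (tendsto_rpow_atTop (by positivity)).comp hlog
  have hxt : Tendsto (fun n : ℕ => ⌈(Real.log n) ^ (1 / κ)⌉₊) atTop atTop :=
    tendsto_nat_ceil_atTop.comp hpow
  have hlx : Tendsto (fun n : ℕ => Real.log (⌈(Real.log n) ^ (1 / κ)⌉₊ : ℕ)) atTop atTop :=
    hlog.comp hxt
  filter_upwards [hxt.eventually (prime_lemma hr hr2 hε hεr), hlx.eventually_ge_atTop 1,
    hlx.eventually_ge_atTop (d * Real.log 2 / ε), hlog.eventually_ge_atTop 2,
    hloglog.eventually_ge_atTop 1, hpow.eventually_ge_atTop 2, eventually_ge_atTop 1]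
    with n h1 h2 h3 h4 h5 h6 hn1 hu hruv
  set lam := Real.log n with hlam
  set L2 := Real.log lam with hL2
  set x := ⌈lam ^ (1 / κ)⌉₊ with hx
  set y := Real.log (x : ℝ) with hy
  set v := (L2 / κ + 1) / lam with hv
  set u := 1 / A - d * v with hu'
  have hlam0 : 0 < lam := by linarith
  have hd2 : (2 : ℝ) ≤ d := by exact_mod_cast hd
  have hA1 : 1 ≤ A := by rw [hA]; nlinarith [sq_nonneg r]
  have hx2 : (2 : ℝ) ≤ x := h6.trans (Nat.le_ceil _)
  have hx0 : (0 : ℝ) < x := by linarith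
  have hylow : y * κ ≥ L2 := by
    have : Real.log (lam ^ (1 / κ)) ≤ y := Real.log_le_log (by positivity) (Nat.le_ceil _)
    rw [Real.log_rpow hlam0] at this
    have h7 : 1 / κ * L2 * κ = L2 := by field_simp
    nlinarith
  have hyup : y ≤ L2 / κ + 1 := by
    have h7 : (x : ℝ) ≤ lam ^ (1 / κ) + 1 := (Nat.ceil_lt_add_one (by positivity)).le
    have h8 := (Real.log_le_log hx0 h7).trans (log_succ_le _ h6)
    rw [Real.log_rpow hlam0] at h8
    rw [div_eq_mul_one_div, mul_comm L2]; linarith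
  have hlamx : lam ≤ (x : ℝ) ^ (1 - r - ε) := by
    calc lam = (lam ^ (1 / κ)) ^ κ := by
          rw [← Real.rpow_mul hlam0.le, one_div, inv_mul_cancel₀ hκ0.ne', Real.rpow_one]
      _ ≤ (x : ℝ) ^ κ := Real.rpow_le_rpow (by positivity) (Nat.le_ceil _) hκ0.le
      _ ≤ _ := Real.rpow_le_rpow_of_exponent_le (by linarith) (by rw [hκ]; linarith)
  obtain ⟨q, hq, hq1, hq2, P0, hP0, hP0c⟩ := h1
  have hdm : (((d - 1 : ℕ)) : ℝ) = (d : ℝ) - 1 := by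
    rw [Nat.cast_sub (by omega), Nat.cast_one]
  set N0 := ⌊lam / (((d : ℝ) - 1) * y * A)⌋₊ with hN0
  have hden : 1 ≤ ((d : ℝ) - 1) * y * A := by
    have : 1 ≤ ((d : ℝ) - 1) * y := by nlinarith
    nlinarith
  have hN0le : (N0 : ℝ) ≤ lam / (((d : ℝ) - 1) * y * A) := Nat.floor_le (by positivity)
  have hN0P : N0 ≤ P0.card := by
    have : (N0 : ℝ) ≤ P0.card := by
      refine (hN0le.trans (div_le_self hlam0.le hden)).trans (hlamx.trans hP0c)
    exact_mod_cast this
  obtain ⟨P, hPs, hPc⟩ := Finset.exists_subset_card_eq hN0P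
  set N := (d - 1) * N0 with hN
  set l := ⌊r * (N : ℝ)⌋₊ with hl
  have hlN : (l : ℝ) ≤ r * N := Nat.floor_le (by positivity)
  have hlN' : l ≤ N := by
    have : (l : ℝ) ≤ N := hlN.trans (by nlinarith [(Nat.cast_nonneg N : (0:ℝ) ≤ N)])
    exact_mod_cast this
  set k := N - l with hk
  have hkr : (k : ℝ) = N - l := by rw [hk, Nat.cast_sub hlN']
  have hNr : (N : ℝ) = ((d : ℝ) - 1) * N0 := by rw [hN]; push_cast; rw [hdm]
  have hq0 : (0 : ℝ) < q := by exact_mod_cast hq.pos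
  have hlq_up : Real.log q ≤ r * y := by
    have := Real.log_le_log hq0 hq2
    rwa [Real.log_rpow hx0] at this
  have hlq_lo : (r - ε) * y ≤ Real.log q := by
    have := Real.log_le_log (by positivity) hq1
    rwa [Real.log_rpow hx0] at this
  have ht : 2 * (Nat.card (UpT d) : ℝ) = d * (d - 1) := by
    have : 2 * (Nat.card (UpT d) : ℝ) + d = d ^ 2 := by exact_mod_cast card_UpT d
    linarith
  have hmain : (∏ p ∈ P, (2 ^ d * p ^ Nat.card (UpT d))) * q ^ l ≤ n := by
    have hb : ∏ p ∈ P, (2 ^ d * p ^ Nat.card (UpT d)) ≤ (2 ^ d * x ^ Nat.card (UpT d)) ^ N0 := by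
      rw [← hPc]
      refine Finset.prod_le_pow_card _ _ _ fun p hp => ?_
      have := (hP0 p (hPs hp)).2.1
      gcongr
    have hb2 : (2 ^ d * x ^ Nat.card (UpT d)) ^ N0 * q ^ l ≤ n := by
      have hn0 : (0 : ℝ) < n := by exact_mod_cast hn1
      have : (((2 : ℝ) ^ d * (x : ℝ) ^ Nat.card (UpT d)) ^ N0 * (q : ℝ) ^ l) ≤ n := by
        rw [← Real.log_le_log_iff (by positivity) hn0, Real.log_mul (by positivity) (by positivity),
          Real.log_pow, Real.log_mul (by positivity) (by positivity), Real.log_pow, Real.log_pow,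
          Real.log_pow, ← hy]
        have a1 : (d : ℝ) * Real.log 2 ≤ ε * y := by
          rw [div_le_iff₀ hε] at h3; linarith
        have a2 : (l : ℝ) * Real.log q ≤ r * N * (r * y) := by gcongr
        have a3 : (N0 : ℝ) * (((d : ℝ) - 1) * y * A) ≤ lam := by
          rwa [le_div_iff₀ (by linarith)] at hN0le
        have a4 : (N0 : ℝ) * (d * Real.log 2) ≤ N0 * (((d : ℝ) - 1) * (ε * y)) := by
          have : ε * y ≤ ((d : ℝ) - 1) * (ε * y) :=
            le_mul_of_one_le_left (by positivity) (by linarith)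
          exact mul_le_mul_of_nonneg_left (by linarith) (Nat.cast_nonneg _)
        have e1 : (N0 : ℝ) * (d * Real.log 2 + Nat.card (UpT d) * y) + r * N * (r * y) =
            N0 * (d * Real.log 2) + N0 * (((d : ℝ) - 1) * y * ((d : ℝ) / 2 + r ^ 2)) := by
          have : (Nat.card (UpT d) : ℝ) = d * (d - 1) / 2 := by linarith
          rw [this, hNr]; ring
        have e2 : (N0 : ℝ) * (((d : ℝ) - 1) * y * A) = N0 * (((d : ℝ) - 1) * (ε * y)) +
            N0 * (((d : ℝ) - 1) * y * ((d : ℝ) / 2 + r ^ 2)) := by rw [hA]; ring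
        linarith
      exact_mod_cast this
    exact (Nat.mul_le_mul_right _ hb).trans hb2
  have hcount := lower_count hd hq P (fun p hp => (hP0 p (hPs hp)).1)
    (fun p hp => (hP0 p (hPs hp)).2.2) k l (by rw [hPc]; omega) n hmain
  have hlogc : (l : ℝ) * k * ((r - ε) * y) ≤ Real.log (congCount d n) := by
    have c1 : ((q : ℝ) ^ (l * k)) ≤ congCount d n := by exact_mod_cast hcount
    have c2 := Real.log_le_log (by positivity) c1
    rw [Real.log_pow] at c2
    refine le_trans ?_ c2
    push_cast
    gcongr
  -- lower bounds
  have hy0 : 0 < y := by linarith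
  have hvy : y / lam ≤ v := by rw [hv]; gcongr
  have hNy : u ≤ N * y / lam := by
    have f1 : lam / (((d : ℝ) - 1) * y * A) ≤ N0 + 1 := (Nat.lt_floor_add_one _).le
    rw [div_le_iff₀ (by linarith)] at f1
    have hA0 : 0 < A := by linarith
    have f2 : lam / A ≤ (N + (d - 1)) * y := by
      rw [div_le_iff₀ hA0, hNr]; linarith
    have f3 : 1 / A ≤ N * y / lam + (d - 1) * (y / lam) := by
      have : 1 / A = lam / A / lam := by field_simp
      rw [this, ← mul_div_assoc, ← add_div, ← add_mul]
      gcongr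
    have f4 : ((d : ℝ) - 1) * (y / lam) ≤ d * v := by
      have : 0 ≤ y / lam := by positivity
      nlinarith
    rw [hu']; linarith
  have hly : r * u - v ≤ l * y / lam := by
    have f1 : r * (N : ℝ) ≤ l + 1 := (Nat.lt_floor_add_one _).le
    have f2 : r * (N * y / lam) ≤ l * y / lam + y / lam := by
      rw [← add_div, ← mul_div_assoc]
      gcongr
      nlinarith
    have f3 : r * u ≤ r * (N * y / lam) := by gcongr
    linarith
  have hky : (1 - r) * u ≤ k * y / lam := by
    have f1 : (1 - r) * (N : ℝ) ≤ k := by rw [hkr]; linarith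
    calc (1 - r) * u ≤ (1 - r) * (N * y / lam) := by
          have : 0 ≤ 1 - r := by linarith
          gcongr
      _ = ((1 - r) * N) * y / lam := by ring
      _ ≤ _ := by gcongr
  have hw : L2 / (L2 / κ + 1) ≤ L2 / y := by gcongr
  have hL20 : 0 < L2 := by linarith
  have h1r : 0 ≤ 1 - r := by linarith
  have hrε : 0 ≤ r - ε := by linarith
  calc (r * u - v) * ((1 - r) * u) * ((r - ε) * (L2 / (L2 / κ + 1))) ≤
      (l * y / lam) * (k * y / lam) * ((r - ε) * (L2 / y)) := by gcongr
    _ = (l * k * ((r - ε) * y)) / (lam ^ 2 / L2) := by field_simp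
    _ ≤ _ := by gcongr

theorem lower_two {d : ℕ} (hd : 2 ≤ d) {r : ℝ} (hr : 0 < r) (hr2 : r < 1 / 2) {c : ℝ}
    (hc : c < r * (1 - r) * r * (1 - r) / ((d : ℝ) / 2 + r ^ 2) ^ 2) :
    ∀ᶠ n : ℕ in atTop, c ≤
      Real.log (congCount d n) / ((Real.log n) ^ 2 / Real.log (Real.log n)) := by
  have hd2 : (2 : ℝ) ≤ d := by exact_mod_cast hd
  have hcont : ContinuousAt (fun ε : ℝ => r * (1 - r) * (r - ε) * (1 - r - 2 * ε) /
      ((d : ℝ) / 2 + r ^ 2 + ε) ^ 2) 0 := by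
    refine ContinuousAt.div (by fun_prop) (by fun_prop) ?_
    positivity
  have hev : ∀ᶠ ε : ℝ in nhds 0, c < r * (1 - r) * (r - ε) * (1 - r - 2 * ε) /
      ((d : ℝ) / 2 + r ^ 2 + ε) ^ 2 := by
    refine hcont.eventually (lt_mem_nhds ?_)
    simpa using hc
  have hev2 : ∀ᶠ ε : ℝ in nhds 0, ε < min r (1 / 4) := gt_mem_nhds (by positivity)
  obtain ⟨ε, ⟨h1, h2⟩, hε⟩ := (((hev.and hev2).filter_mono nhdsWithin_le_nhds).and
    (self_mem_nhdsWithin : ∀ᶠ ε : ℝ in nhdsWithin 0 (Set.Ioi 0), ε ∈ Set.Ioi 0)).exists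
  have hε : 0 < ε := hε
  have hεr : ε < r := h2.trans_le (min_le_left _ _)
  have hε4 : ε < 1 / 4 := h2.trans_le (min_le_right _ _)
  set κ : ℝ := 1 - r - 2 * ε with hκ
  set A : ℝ := (d : ℝ) / 2 + r ^ 2 + ε with hA
  have hκ0 : 0 < κ := by linarith
  have hA0 : 0 < A := by positivity
  have hlog : Tendsto (fun n : ℕ => Real.log n) atTop atTop :=
    Real.tendsto_log_atTop.comp tendsto_natCast_atTop_atTop
  have hloglog : Tendsto (fun n : ℕ => Real.log (Real.log n)) atTop atTop :=
    Real.tendsto_log_atTop.comp hlog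
  have hv : Tendsto (fun n : ℕ => (Real.log (Real.log n) / κ + 1) / Real.log n) atTop (nhds 0) := by
    have a1 : Tendsto (fun z : ℝ => Real.log z / z) atTop (nhds 0) := by
      have := Real.isLittleO_log_id_atTop.tendsto_div_nhds_zero
      exact this
    have a2 : Tendsto (fun z : ℝ => (Real.log z / z) * (1 / κ) + z⁻¹) atTop (nhds (0 * (1 / κ) + 0)) :=
      (a1.mul_const _).add tendsto_inv_atTop_zero
    rw [zero_mul, zero_add] at a2
    refine (a2.comp hlog).congr fun n => ?_
    simp only [Function.comp]
    rw [add_div]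
    congr 1
    · ring
    · rw [one_div]
  have hu : Tendsto (fun n : ℕ => 1 / A - d * ((Real.log (Real.log n) / κ + 1) / Real.log n)) atTop
      (nhds (1 / A)) := by
    have := (tendsto_const_nhds (x := 1 / A)).sub (hv.const_mul (d : ℝ))
    rwa [mul_zero, sub_zero] at this
  have hru : Tendsto (fun n : ℕ => r * (1 / A - d * ((Real.log (Real.log n) / κ + 1) / Real.log n)) -
      (Real.log (Real.log n) / κ + 1) / Real.log n) atTop (nhds (r * (1 / A))) := by
    have := (hu.const_mul r).sub hv
    rwa [sub_zero] at this
  have hw : Tendsto (fun n : ℕ => Real.log (Real.log n) / (Real.log (Real.log n) / κ + 1)) atTop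
      (nhds κ) := by
    have a1 : Tendsto (fun z : ℝ => (1 / κ + z⁻¹)⁻¹) atTop (nhds ((1 / κ + 0)⁻¹)) :=
      (tendsto_inv_atTop_zero.const_add _).inv₀ (by positivity)
    rw [add_zero, one_div, inv_inv] at a1
    refine (a1.comp hloglog).congr' ?_
    filter_upwards [hloglog.eventually_gt_atTop 0] with n hn
    simp only [Function.comp]
    field_simp
  have hG := (hru.mul (hu.const_mul (1 - r))).mul (hw.const_mul (r - ε))
  have hlim : c < r * (1 / A) * ((1 - r) * (1 / A)) * ((r - ε) * κ) := by
    have : r * (1 / A) * ((1 - r) * (1 / A)) * ((r - ε) * κ) =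
        r * (1 - r) * (r - ε) * κ / A ^ 2 := by field_simp
    rw [this]; exact h1
  filter_upwards [lower_one hd hr hr2 hε hεr hκ0 hκ hA, hG.eventually (lt_mem_nhds hlim),
    hu.eventually (lt_mem_nhds (show 0 < 1 / A by positivity)),
    hru.eventually (lt_mem_nhds (show 0 < r * (1 / A) by positivity))] with n g1 g2 g3 g4
  exact g2.le.trans (g1 g3.le g4.le)

end CG

theorem congruence_growth_SLd_lower (d : ℕ) (hd : 2 ≤ d) :
    (Real.sqrt (d * (d + 2)) - d) ^ 2 / (4 * (d : ℝ) ^ 2) ≤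
      liminf
        (fun n : ℕ => Real.log (congCount d n) / ((Real.log n) ^ 2 / Real.log (Real.log n)))
        atTop := by
  have hd2 : (2 : ℝ) ≤ d := by exact_mod_cast hd
  set s := Real.sqrt ((d : ℝ) * ((d : ℝ) + 2)) with hs
  have hs2 : s ^ 2 = (d : ℝ) * ((d : ℝ) + 2) := Real.sq_sqrt (by positivity)
  have hs0 : 0 ≤ s := Real.sqrt_nonneg _
  set r : ℝ := (s - d) / 2 with hr
  have hr0 : 0 < r := by
    have : (d : ℝ) < s := by nlinarith
    rw [hr]; linarith
  have hr2 : r < 1 / 2 := by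
    have : s < d + 1 := by nlinarith
    rw [hr]; linarith
  have hrd : (d : ℝ) * (1 - r) = d / 2 + r ^ 2 := by rw [hr]; nlinarith
  have hconst : (s - (d : ℝ)) ^ 2 / (4 * (d : ℝ) ^ 2) =
      r * (1 - r) * r * (1 - r) / ((d : ℝ) / 2 + r ^ 2) ^ 2 := by
    have h1 : 0 < 1 - r := by linarith
    have h2 : s - d = 2 * r := by rw [hr]; ring
    rw [← hrd, h2]
    field_simp
    ring
  obtain ⟨C, hC⟩ := CG.upper_bound d hd
  refine le_of_forall_lt fun c hc => ?_
  obtain ⟨c', hc1, hc2⟩ := exists_between hc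
  refine hc1.trans_le ?_
  rw [hconst] at hc2
  exact le_liminf_of_le (IsBoundedUnder.isCoboundedUnder_ge ⟨C, by simpa using hC⟩)
    (CG.lower_two hd hr0 hr2 hc2)
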